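/- arXiv:1311.1665 — 7 statements merged into one kernel-verified Lean document; each statement's English description precedes it below -/
import Mathlib

section
/- For each n there exists a constant C = C(k, n) with the following property: every point x ∈ ℙⁿ(k) has a representative (x_0,…,x_n) ∈ 𝔬^{n+1} such that the 𝔬-span ⟨x_0,…,x_n⟩ equals 𝔞_i for some i ∈ {1,…,h}, and ∥(x_0,…,x_n)∥⋆ ≤ C·H_k(x)^{1/s_k}. -/
open NumberField
open scoped nonZeroDivisors

/-- The normalized absolute value `∥x∥_w = |x|_w^{d_w}` at an infinite place `w`. -/
noncomputable def plNorm {k : Type*} [Field k] [NumberField k]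
    (w : InfinitePlace k) (x : k) : ℝ := w x ^ w.mult

/-- The number of infinite places of `k`. -/
noncomputable def sk (k : Type*) [Field k] [NumberField k] : ℕ :=
  Fintype.card (InfinitePlace k)

/-- The height `H_k` of the projective point with integral homogeneous coordinates `y`:
`H_k = N(⟨y_0, …, y_n⟩)⁻¹ · ∏_{w | ∞} max_i ∥y_i∥_w`.  This is independent of the choice of
integral representative. -/
noncomputable def heightFn {k : Type*} [Field k] [NumberField k] {m : ℕ}
    (y : Fin m → 𝓞 k) : ℝ :=
  (Ideal.absNorm (Ideal.span (Set.range y)) : ℝ)⁻¹ *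
    ∏ w : InfinitePlace k, ⨆ i, plNorm w (y i)

/-- `a` is a system of integral ideals representing the ideal classes of `𝓞 k`. -/
def IsClassRep {k : Type*} [Field k] [NumberField k]
    (a : ClassGroup (𝓞 k) → Ideal (𝓞 k)) : Prop :=
  ∀ c : ClassGroup (𝓞 k), ∃ h : a c ∈ (Ideal (𝓞 k))⁰, ClassGroup.mk0 ⟨a c, h⟩ = c

/-- The tuple `y` lies in `Z'_m`: its `𝓞 k`-span is one of the fixed class representatives. -/
def inZ' {k : Type*} [Field k] [NumberField k]
    (a : ClassGroup (𝓞 k) → Ideal (𝓞 k)) {m : ℕ} (y : Fin m → 𝓞 k) : Prop :=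
  ∃ c, Ideal.span (Set.range y) = a c

section SmallRepresentatives

variable {k : Type*} [Field k] [NumberField k]

open NumberField.Units NumberField.Units.dirichletUnitTheorem in
/-- Units translate any trace-zero vector of logarithms into a bounded region. -/
theorem exists_unit_add_mult_log_le :
    ∃ B : ℝ, ∀ g : InfinitePlace k → ℝ, ∑ w, g w = 0 →
      ∃ u : (𝓞 k)ˣ, ∀ w, g w + w.mult * Real.log (w (u : k)) ≤ B := by
  classical
  let b := (basisUnitLattice k).ofZLatticeBasis ℝ (unitLattice k)
  let B := ∑ i, ‖b i‖
  have hB : 0 ≤ B := Finset.sum_nonneg fun i _ ↦ norm_nonneg _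
  refine ⟨B + (Fintype.card {w : InfinitePlace k // w ≠ w₀}) * B, fun g hg ↦ ?_⟩
  let v : logSpace k := fun w ↦ g w
  have hmem : (ZSpan.floor b v : logSpace k) ∈ unitLattice k := by
    rw [← (basisUnitLattice k).ofZLatticeBasis_span ℝ (unitLattice k)]
    exact (ZSpan.floor b v).2
  obtain ⟨x, -, hx⟩ := hmem
  have hx' : logEmbedding k x = ZSpan.floor b v := hx
  have hle (w : {w : InfinitePlace k // w ≠ w₀}) :
      |g w - logEmbedding k x w| ≤ B := by
    have h := (norm_le_pi_norm (ZSpan.fract b v) w).trans (ZSpan.norm_fract_le b v)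
    rwa [ZSpan.fract_apply, ← hx'] at h
  refine ⟨(x.toMul)⁻¹, fun w ↦ ?_⟩
  have hinv : Real.log (w (((x.toMul)⁻¹ : (𝓞 k)ˣ) : k)) = -Real.log (w (x.toMul : k)) := by
    simp [Real.log_inv]
  rw [hinv]
  by_cases hw : w = w₀
  · have hsum := sum_logEmbedding_component x.toMul
    rw [Fintype.sum_eq_add_sum_subtype_ne _ w₀] at hg
    have hbound : ∑ w : {w : InfinitePlace k // w ≠ w₀}, -(g w - logEmbedding k x w)
        ≤ ∑ _w : {w : InfinitePlace k // w ≠ w₀}, B :=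
      Finset.sum_le_sum fun w _ ↦ (neg_le_abs _).trans (hle w)
    simp only [Finset.sum_neg_distrib, Finset.sum_sub_distrib, Finset.sum_const,
      Finset.card_univ, nsmul_eq_mul] at hbound
    rw [ofMul_toMul] at hsum
    subst hw
    linarith
  · have h := (le_abs_self _).trans (hle ⟨w, hw⟩)
    have hcomp : logEmbedding k x ⟨w, hw⟩ = w.mult * Real.log (w (x.toMul : k)) := rfl
    rw [hcomp] at h
    have : 0 ≤ (Fintype.card {w : InfinitePlace k // w ≠ w₀}) * B := by positivity
    linarith

/-- Multiplying by a suitable unit makes all infinite components of a positive vector comparable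
to their geometric mean. -/
theorem exists_unit_plNorm_mul_le :
    ∃ B : ℝ, 0 < B ∧ ∀ f : InfinitePlace k → ℝ, (∀ w, 0 < f w) →
      ∃ u : (𝓞 k)ˣ, ∀ w, plNorm w (u : k) * f w ≤ B * (∏ w, f w) ^ ((1 : ℝ) / (sk k : ℝ)) := by
  obtain ⟨B, hB⟩ := exists_unit_add_mult_log_le (k := k)
  refine ⟨Real.exp B, Real.exp_pos B, fun f hf ↦ ?_⟩
  have hs : (sk k : ℝ) ≠ 0 := Nat.cast_ne_zero.mpr Fintype.card_ne_zero
  have hprod : 0 < ∏ w, f w := Finset.prod_pos fun w _ ↦ hf w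
  obtain ⟨u, hu⟩ := hB (fun w ↦ Real.log (f w) - Real.log (∏ w, f w) * (1 / (sk k : ℝ))) (by
    rw [Finset.sum_sub_distrib, ← Real.log_prod fun w _ ↦ (hf w).ne', Finset.sum_const,
      Finset.card_univ, nsmul_eq_mul, ← sk]
    field_simp
    ring)
  refine ⟨u, fun w ↦ ?_⟩
  have hw : 0 < w (u : k) := w.pos_iff.mpr (Units.coe_ne_zero u)
  have hpl : 0 < plNorm w (u : k) := pow_pos hw _
  rw [Real.rpow_def_of_pos hprod, ← Real.exp_add,
    ← Real.log_le_iff_le_exp (mul_pos hpl (hf w)), Real.log_mul hpl.ne' (hf w).ne',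
    plNorm, Real.log_pow]
  linarith [hu w]

/-- Every projective point has integral coordinates spanning a fixed class representative. -/
theorem exists_mk_eq_and_inZ' {m : ℕ} {a : ClassGroup (𝓞 k) → Ideal (𝓞 k)} (ha : IsClassRep a)
    (x : Projectivization k (Fin m → k)) :
    ∃ (y : Fin m → 𝓞 k) (hy : (fun i => (y i : k)) ≠ 0),
      Projectivization.mk k (fun i => (y i : k)) hy = x ∧ inZ' a y := by
  induction x using Projectivization.ind with | h v hv =>
  obtain ⟨d, hd⟩ := IsLocalization.exist_integer_multiples_of_finite (𝓞 k)⁰ v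
  choose z hz using hd
  have hd0 : ((d : 𝓞 k) : k) ≠ 0 := by simp
  have hz' (i) : (z i : k) = (d : 𝓞 k) * v i :=
    (hz i).trans (Algebra.smul_def _ _)
  have hI : Ideal.span (Set.range z) ≠ 0 := by
    intro h
    refine hv (funext fun i ↦ ?_)
    have hzi : z i = 0 := by
      simpa [h] using Ideal.subset_span (Set.mem_range_self (f := z) i)
    have := hz' i
    rw [hzi] at this
    simpa [hd0] using this.symm
  obtain ⟨hc, hcl⟩ := ha (ClassGroup.mk0 ⟨_, mem_nonZeroDivisors_of_ne_zero hI⟩)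
  generalize hJ : a (ClassGroup.mk0 ⟨_, mem_nonZeroDivisors_of_ne_zero hI⟩) = J at hc hcl
  obtain ⟨β, α, hβ, hα, h⟩ := ClassGroup.mk0_eq_mk0_iff.mp hcl
  simp only at h
  have hdvd (i) : ∃ y ∈ J, β * y = α * z i := by
    rw [← Ideal.mem_span_singleton_mul, h]
    exact Ideal.mul_mem_mul (Ideal.mem_span_singleton_self α)
      (Ideal.subset_span (Set.mem_range_self i))
  choose y hyJ hy using hdvd
  have hβ' : (β : k) ≠ 0 := by simpa using hβ
  have hα' : (α : k) ≠ 0 := by simpa using hα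
  have hyv (i) : (y i : k) = ((α : k) * (d : 𝓞 k) / β) * v i := by
    have : (β : k) * y i = α * z i := by exact_mod_cast congrArg (algebraMap (𝓞 k) k) (hy i)
    rw [hz'] at this
    field_simp
    linear_combination this
  have hspan : Ideal.span (Set.range y) = J := by
    apply Ideal.span_singleton_mul_right_injective hβ
    simp only
    rw [h, Ideal.span_mul_span', Ideal.span_mul_span', Set.singleton_mul, Set.singleton_mul,
      ← Set.range_comp, ← Set.range_comp]
    exact congrArg _ (congrArg _ (funext hy))
  have hy0 : (fun i => (y i : k)) ≠ 0 := by
    intro h0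
    refine hv (funext fun i ↦ ?_)
    have := congrFun h0 i
    simp only [hyv, Pi.zero_apply] at this
    simpa [hα', hβ', hd0] using this
  refine ⟨y, hy0, ?_, _, hspan.trans hJ.symm⟩
  rw [Projectivization.mk_eq_mk_iff']
  exact ⟨_, (funext hyv).symm⟩

theorem plNorm_mul (w : InfinitePlace k) (x y : k) :
    plNorm w (x * y) = plNorm w x * plNorm w y := by
  simp [plNorm, mul_pow]

theorem plNorm_nonneg (w : InfinitePlace k) (x : k) : 0 ≤ plNorm w x :=
  pow_nonneg (apply_nonneg _ _) _

theorem prod_plNorm_unit (u : (𝓞 k)ˣ) : ∏ w : InfinitePlace k, plNorm w (u : k) = 1 := by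
  simpa [plNorm, Units.norm] using InfinitePlace.prod_eq_abs_norm (u : k)

theorem iSup_plNorm_pos {m : ℕ} {y : Fin m → k} (hy : y ≠ 0) (w : InfinitePlace k) :
    0 < ⨆ i, plNorm w (y i) := by
  obtain ⟨i, hi⟩ := Function.ne_iff.mp hy
  exact (pow_pos (w.pos_iff.mpr hi) _).trans_le
    (le_ciSup (f := fun i ↦ plNorm w (y i)) (Set.finite_range _).bddAbove i)

theorem iSup_plNorm_unit_mul {m : ℕ} (y : Fin m → k) (u : (𝓞 k)ˣ) (w : InfinitePlace k) :
    ⨆ i, plNorm w ((u : k) * y i) = plNorm w (u : k) * ⨆ i, plNorm w (y i) := by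
  simp_rw [plNorm_mul, Real.mul_iSup_of_nonneg (plNorm_nonneg w _)]

theorem span_range_unit_mul {R : Type*} [CommRing R] {ι : Type*} (y : ι → R) (u : Rˣ) :
    Ideal.span (Set.range fun i ↦ (u : R) * y i) = Ideal.span (Set.range y) := by
  have h : Ideal.span {(u : R)} * Ideal.span (Set.range y) =
      Ideal.span (Set.range fun i ↦ (u : R) * y i) := by
    rw [Ideal.span_mul_span', Set.singleton_mul, ← Set.range_comp]
    rfl
  rw [← h, Ideal.span_singleton_eq_top.mpr u.isUnit, Ideal.top_mul]

end SmallRepresentatives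

/-- Lemma on small representatives: every point of `ℙⁿ(k)` has an
integral representative whose coordinates span one of the fixed ideal class
representatives, and whose sup-norm `∥·∥⋆` is at most `C · H_k(x)^{1/s_k}` for a
constant `C = C(k, n)`. -/
theorem small_representatives {k : Type*} [Field k] [NumberField k] (n : ℕ)
    (a : ClassGroup (𝓞 k) → Ideal (𝓞 k)) (ha : IsClassRep a) :
    ∃ C : ℝ, 0 < C ∧
      ∀ x : Projectivization k (Fin (n + 1) → k),
        ∃ (y : Fin (n + 1) → 𝓞 k) (hy : (fun i => (y i : k)) ≠ 0),
          Projectivization.mk k (fun i => (y i : k)) hy = x ∧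
          inZ' a y ∧
          (⨆ w : InfinitePlace k, ⨆ i, plNorm w (y i)) ≤
            C * heightFn y ^ ((1 : ℝ) / (sk k : ℝ)) := by
  obtain ⟨B, hB, hunit⟩ := exists_unit_plNorm_mul_le (k := k)
  let N : ℝ := 1 + ∑ c, (Ideal.absNorm (a c) : ℝ)
  have hN : 0 < N := by positivity
  refine ⟨B * N ^ ((1 : ℝ) / (sk k : ℝ)), by positivity, fun x ↦ ?_⟩
  obtain ⟨y, hy, hyx, c, hyc⟩ := exists_mk_eq_and_inZ' ha x
  obtain ⟨u, hu⟩ := hunit (fun w ↦ ⨆ i, plNorm w (y i)) (iSup_plNorm_pos hy)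
  have hu0 : (u : k) ≠ 0 := Units.coe_ne_zero u
  have huy : (fun i ↦ ((u * y i : 𝓞 k) : k)) = (u : k) • fun i ↦ (y i : k) := by
    ext i
    simp
  have huy0 : (fun i ↦ ((u * y i : 𝓞 k) : k)) ≠ 0 := huy ▸ smul_ne_zero hu0 hy
  have hspan := (span_range_unit_mul y u).trans hyc
  refine ⟨fun i ↦ u * y i, huy0, ?_, ⟨c, hspan⟩, ?_⟩
  · rw [← hyx, Projectivization.mk_eq_mk_iff']
    exact ⟨(u : k), huy.symm⟩
  have hsup (w : InfinitePlace k) : ⨆ i, plNorm w ((u * y i : 𝓞 k) : k) =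
      plNorm w (u : k) * ⨆ i, plNorm w (y i) := by
    simp_rw [map_mul]
    exact iSup_plNorm_unit_mul _ u w
  have hP : 0 ≤ ∏ w, ⨆ i, plNorm w (y i : k) :=
    Finset.prod_nonneg fun w _ ↦ (iSup_plNorm_pos hy w).le
  have hac : (0 : ℝ) < Ideal.absNorm (a c) := by
    obtain ⟨h, -⟩ := ha c
    exact_mod_cast Nat.pos_of_ne_zero
      (mt Ideal.absNorm_eq_zero_iff.mp (nonZeroDivisors.ne_zero h))
  have hacN : (Ideal.absNorm (a c) : ℝ) ≤ N :=
    (Finset.single_le_sum (f := fun c ↦ (Ideal.absNorm (a c) : ℝ))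
      (fun _ _ ↦ Nat.cast_nonneg _) (Finset.mem_univ c)).trans (le_add_of_nonneg_left zero_le_one)
  have hheight : heightFn (fun i ↦ (u : 𝓞 k) * y i) =
      (Ideal.absNorm (a c) : ℝ)⁻¹ * ∏ w, ⨆ i, plNorm w (y i : k) := by
    rw [heightFn, hspan]
    simp_rw [hsup]
    rw [Finset.prod_mul_distrib, prod_plNorm_unit, one_mul]
  rw [hheight, mul_assoc, ← Real.mul_rpow hN.le (by positivity)]
  refine ciSup_le fun w ↦ ?_
  rw [hsup]
  refine (hu w).trans ?_
  gcongr
  rw [← mul_assoc]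
  refine le_mul_of_one_le_left hP ?_
  rwa [← div_eq_mul_inv, one_le_div hac]
end

section
/- Let Λ be an 𝔬-lattice in kⁿ with Λ ⊂ 𝔬ⁿ. For each infinite place ν of k let S_ν be a non-empty, open, convex, symmetric, bounded subset of k_ν^n, and let S = ∏_{ν|∞} S_ν, with Λ identified with its image in ∏_{ν|∞} k_ν^n under the diagonal embedding. Let λ_1 ≤ ⋯ ≤ λ_n be the successive minima of Λ with respect to S, where λ_i = inf{λ > 0 : Λ ∩ λS contains i linearly independent vectors}. Then (λ_1⋯λ_n)^d · ∏_{ν|∞} Vol(S_ν) ≤ C(n)·[𝔬ⁿ : Λ], where d = [k : ℚ], the volumes are taken with respect to the Lebesgue measure on k_ν^n when k_ν = ℝ and twice the Lebesgue measure when k_ν = ℂ, and C(n) is a constant depending only on n and k. -/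
open NumberField MeasureTheory
open scoped Pointwise Classical

/-- A compact neighbourhood of `0` contains a basis in which all its points have coordinates
of absolute value at most one. -/
lemma exists_basis_mem_forall_abs_repr_le_one {E : Type*} [NormedAddCommGroup E]
    [NormedSpace ℝ E] {ι : Type*} [Fintype ι] (g : Module.Basis ι ℝ E) {K : Set E}
    (hK : IsCompact K) (h0 : K ∈ nhds (0 : E)) :
    ∃ x : Module.Basis ι ℝ E, (∀ i, x i ∈ K) ∧ ∀ y ∈ K, ∀ i, |x.repr y i| ≤ 1 := by
  have : FiniteDimensional ℝ E := g.finiteDimensional_of_finite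
  have hcont : Continuous fun x : ι → E => |g.det x| := by
    refine continuous_abs.comp (?_ : Continuous fun x : ι → E => g.det x)
    simp only [Module.Basis.det_apply]
    refine Continuous.matrix_det ?_
    refine continuous_matrix fun i j => ?_
    simp only [Module.Basis.toMatrix_apply]
    exact (g.coord i).continuous_of_finiteDimensional.comp (continuous_apply j)
  have hne : (Set.univ.pi fun _ : ι => K).Nonempty :=
    ⟨fun _ => 0, fun _ _ => mem_of_mem_nhds h0⟩
  obtain ⟨x, hxK, hmax⟩ := (isCompact_univ_pi fun _ : ι => hK).exists_isMaxOn hne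
    hcont.continuousOn
  have hpos : 0 < |g.det x| := by
    have hsmall : ∀ᶠ r : ℝ in nhdsWithin 0 (Set.Ioi 0), ∀ i, r • g i ∈ K := by
      rw [Filter.eventually_all]
      intro i
      have : Filter.Tendsto (fun r : ℝ => r • g i) (nhds 0) (nhds 0) := by
        have h : Continuous fun r : ℝ => r • g i := by fun_prop
        simpa using h.tendsto 0
      exact (this.mono_left nhdsWithin_le_nhds) h0
    obtain ⟨r, hr, hr0⟩ := (hsmall.and self_mem_nhdsWithin).exists
    have h := hmax (show (fun i => r • g i) ∈ Set.univ.pi fun _ : ι => K from fun i _ => hr i)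
    refine lt_of_lt_of_le ?_ h
    simp only [AlternatingMap.map_smul_univ, Module.Basis.det_self]
    have hr0 : (0 : ℝ) < r := hr0
    simp only [Finset.prod_const, smul_eq_mul, mul_one]
    positivity
  have hunit : IsUnit (g.det x) := isUnit_iff_ne_zero.mpr (abs_pos.mp hpos)
  obtain ⟨hli, hsp⟩ := (Module.Basis.is_basis_iff_det g).mpr hunit
  let b : Module.Basis ι ℝ E := Module.Basis.mk hli hsp.ge
  have hb : (b : ι → E) = x := Module.Basis.coe_mk _ _
  refine ⟨b, fun i => by rw [hb]; exact hxK i trivial, fun y hy i => ?_⟩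
  have h := hmax (show Function.update x i y ∈ Set.univ.pi fun _ : ι => K from fun j _ => by
    rcases eq_or_ne j i with rfl | hj
    · simpa using hy
    · simpa [hj] using hxK j trivial)
  have h2 : g.det (Function.update x i y) = g.det x * b.repr y i := by
    rw [AlternatingMap.eq_smul_basis_det b g.det, hb, AlternatingMap.smul_apply, smul_eq_mul,
      AlternatingMap.smul_apply, smul_eq_mul, ← hb, b.det_self, mul_one]
    congr 1
    rw [b.det_apply, b.toMatrix_update, b.toMatrix_self]
    rw [← Matrix.cramer_apply]
    simp
  simp only [Set.mem_ofPred_eq, h2, abs_mul] at h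
  nlinarith [abs_nonneg (b.repr y i)]

/-- Gram–Schmidt with respect to the inner product for which `x` is orthonormal: `g` can be
replaced by a basis with the same flag, bounded `x`-coordinates and determinant `±1`. -/
lemma exists_basis_adapted {E : Type*} [AddCommGroup E] [Module ℝ E] {N : ℕ}
    (x g : Module.Basis (Fin N) ℝ E) :
    ∃ f : Module.Basis (Fin N) ℝ E, (∀ m i, |x.repr (f m) i| ≤ 1) ∧ |x.det f| = 1 ∧
      ∀ m, ∀ y ∈ Submodule.span ℝ (g '' Set.Iio m), f.repr y m = 0 := by
  let e : E ≃ₗ[ℝ] EuclideanSpace ℝ (Fin N) :=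
    x.equivFun.trans (WithLp.linearEquiv 2 ℝ (Fin N → ℝ)).symm
  let gs : OrthonormalBasis (Fin N) ℝ (EuclideanSpace ℝ (Fin N)) :=
    InnerProductSpace.gramSchmidtOrthonormalBasis (by simp) (g.map e)
  have hrep : ∀ z i, x.repr (e.symm z) i = z i := fun z i => by
    conv_rhs => rw [← e.apply_symm_apply z]
    rfl
  refine ⟨gs.toBasis.map e.symm, fun m i => ?_, ?_, fun m y hy => ?_⟩
  · rw [Module.Basis.map_apply, hrep, OrthonormalBasis.coe_toBasis]
    have := PiLp.norm_apply_le (gs m) i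
    simpa using this
  · have h1 : x.det (gs.toBasis.map e.symm) =
        (EuclideanSpace.basisFun (Fin N) ℝ).toBasis.det gs := by
      rw [Module.Basis.det_apply, Module.Basis.det_apply]
      congr 1
      ext i j
      rw [Module.Basis.toMatrix_apply, Module.Basis.toMatrix_apply, Module.Basis.map_apply, hrep]
      simp
    rw [h1]
    rcases (EuclideanSpace.basisFun (Fin N) ℝ).det_to_matrix_orthonormalBasis_real gs with h | h
    all_goals
      rw [h]
      simp
  · have h1 : ∀ z, (gs.toBasis.map e.symm).repr z m = inner ℝ (gs m) (e z) := fun z => by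
      simp [OrthonormalBasis.repr_apply_apply]
    rw [h1]
    induction hy using Submodule.span_induction with
    | mem z hz =>
      obtain ⟨j, hj, rfl⟩ := hz
      have := InnerProductSpace.gramSchmidtOrthonormalBasis_inv_triangular
        (𝕜 := ℝ) (f := g.map e)
        (h := (by simp : Module.finrank ℝ (EuclideanSpace ℝ (Fin N)) = Fintype.card (Fin N))) hj
      simpa using this
    | zero => simp
    | add a b _ _ ha hb => simp [inner_add_right, ha, hb]
    | smul c a _ ha => simp [inner_smul_right, ha]

/-- The volume of a box with sides parallel to a basis. -/
lemma measureReal_box {E : Type*} [NormedAddCommGroup E] [NormedSpace ℝ E]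
    [FiniteDimensional ℝ E] [MeasurableSpace E] [BorelSpace E] (μ : Measure E)
    [μ.IsAddHaarMeasure] {ι : Type*} [Fintype ι] (b : Module.Basis ι ℝ E) {t : ι → ℝ}
    (ht : ∀ i, 0 ≤ t i) :
    μ.real {y | ∀ i, |b.repr y i| ≤ t i} =
      (∏ i, 2 * t i) * μ.real (ZSpan.fundamentalDomain b) := by
  let e : E ≃L[ℝ] (ι → ℝ) := b.equivFunL
  have hH : (μ.map e).IsAddHaarMeasure := e.isAddHaarMeasure_map μ
  have hmap : ∀ s, μ (e ⁻¹' s) = μ.map e s := fun s =>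
    (e.toHomeomorph.toMeasurableEquiv.map_apply s).symm
  obtain ⟨c, hc⟩ : ∃ c : NNReal, μ.map e = c • volume :=
    ⟨_, Measure.isAddLeftInvariant_eq_smul _ _⟩
  have h1 : {y | ∀ i, |b.repr y i| ≤ t i} = e ⁻¹' (Set.Icc (fun i => - t i) t) := by
    ext y
    simp [e, Set.mem_Icc, Pi.le_def, abs_le, forall_and]
  have h2 : ZSpan.fundamentalDomain b = e ⁻¹' (Set.univ.pi fun _ : ι => Set.Ico (0 : ℝ) 1) := by
    ext y
    simp [e, ZSpan.mem_fundamentalDomain]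
  rw [h1, h2, measureReal_def, measureReal_def, hmap, hmap, hc]
  simp only [Measure.smul_apply, Real.volume_Icc_pi, volume_pi_pi, ENNReal.toReal_smul,
    ENNReal.toReal_prod, Real.volume_Ico]
  simp only [sub_zero, ENNReal.ofReal_one, ENNReal.toReal_one, Finset.prod_const_one]
  rw [show ∏ i, (ENNReal.ofReal (t i - -t i)).toReal = ∏ i, 2 * t i from
    Finset.prod_congr rfl fun i _ => by
      rw [ENNReal.toReal_ofReal (by linarith [ht i])]; ring]
  simp only [NNReal.smul_def, smul_eq_mul]
  ring

lemma gauge_sum_smul_le {E : Type*} [AddCommGroup E] [Module ℝ E] {S : Set E}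
    (hconv : Convex ℝ S) (hbal : Balanced ℝ S) (habs : Absorbent ℝ S) {ι : Type*}
    (s : Finset ι) (c : ι → ℝ) (z : ι → E) :
    gauge S (∑ i ∈ s, c i • z i) ≤ ∑ i ∈ s, |c i| * gauge S (z i) := by
  refine (gauge_sum_le hconv habs _ _).trans (Finset.sum_le_sum fun i _ => ?_)
  rw [gauge_smul hbal, Real.norm_eq_abs]

/-- A form of Minkowski's second theorem: if every lattice vector outside the span of the first
`m` vectors of a basis has gauge at least `t m`, then the product of the `t m` times the volume of
the body is bounded by a multiple of the covolume. -/
lemma prod_mul_measureReal_le_covolume {E : Type*} [NormedAddCommGroup E] [NormedSpace ℝ E]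
    [FiniteDimensional ℝ E] [MeasurableSpace E] [BorelSpace E] (μ : Measure E)
    [μ.IsAddHaarMeasure] (L : Submodule ℤ E) [DiscreteTopology L] [IsZLattice ℝ L] {N : ℕ}
    (g : Module.Basis (Fin N) ℝ E) {S : Set E} (hne : (0 : E) ∈ S) (hopen : IsOpen S)
    (hconv : Convex ℝ S) (hsymm : ∀ x ∈ S, -x ∈ S) (hbdd : Bornology.IsBounded S)
    {t : Fin N → ℝ} (ht : ∀ m, 0 ≤ t m)
    (hg : ∀ m, ∀ y ∈ L, y ∉ Submodule.span ℝ (g '' Set.Iio m) → t m ≤ gauge S y) :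
    (∏ m, t m) * μ.real S ≤ (2 * ((N : ℝ) ^ 2 + 1)) ^ N * ZLattice.covolume L μ := by
  have h0 : S ∈ nhds (0 : E) := hopen.mem_nhds hne
  have habs : Absorbent ℝ S := absorbent_nhds_zero h0
  have hbal : Balanced ℝ S := (balanced_iff_neg_mem hconv).mpr fun x hx => hsymm x hx
  obtain ⟨x, hx1, hx2⟩ := exists_basis_mem_forall_abs_repr_le_one g
    (hbdd.isCompact_closure) (Filter.mem_of_superset h0 subset_closure)
  obtain ⟨f, hf1, hf2, hf3⟩ := exists_basis_adapted x g
  have hxg : ∀ i, gauge S (x i) ≤ 1 := fun i =>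
    (gauge_le_one_iff_mem_closure hconv h0).mpr (hx1 i)
  have hfg : ∀ m, gauge S (f m) ≤ N := fun m => by
    rw [← x.sum_repr (f m)]
    refine (gauge_sum_smul_le hconv hbal habs _ _ _).trans ?_
    calc ∑ i, |x.repr (f m) i| * gauge S (x i) ≤ ∑ i : Fin N, (1 : ℝ) * 1 :=
          Finset.sum_le_sum fun i _ => mul_le_mul (hf1 m i) (hxg i) (gauge_nonneg _) zero_le_one
      _ = N := by simp
  have hD : μ.real (ZSpan.fundamentalDomain f) = μ.real (ZSpan.fundamentalDomain x) := by
    rw [ZSpan.measureReal_fundamentalDomain f μ x, hf2, one_mul]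
  set τ : Fin N → ℝ := fun m => t m / ((N : ℝ) ^ 2 + 1) with hτ
  have hτ0 : ∀ m, 0 ≤ τ m := fun m => div_nonneg (ht m) (by positivity)
  set K : Set E := {y | ∀ m, |f.repr y m| ≤ τ m} with hK
  have hKL : ∀ y ∈ L, y ∈ K → y = 0 := by
    intro y hyL hyK
    by_contra hy
    have hpos : 0 < gauge S y :=
      (gauge_pos habs ((NormedSpace.isVonNBounded_iff ℝ).mpr hbdd)).mpr hy
    have h1 : gauge S y ≤ ∑ m, |f.repr y m| * gauge S (f m) := by
      conv_lhs => rw [← f.sum_repr y]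
      exact gauge_sum_smul_le hconv hbal habs _ _ _
    have h2 : ∀ m, |f.repr y m| * gauge S (f m) ≤ gauge S y / ((N : ℝ) ^ 2 + 1) * N := by
      intro m
      refine mul_le_mul ?_ (hfg m) (gauge_nonneg _) (by positivity)
      by_cases hc : f.repr y m = 0
      · rw [hc, abs_zero]; positivity
      · refine (hyK m).trans ?_
        have := hg m y hyL fun hmem => hc (hf3 m y hmem)
        simp only [hτ]
        gcongr
    have h3 : gauge S y ≤ N * (gauge S y / ((N : ℝ) ^ 2 + 1) * N) := by
      refine h1.trans ((Finset.sum_le_sum fun m _ => h2 m).trans ?_)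
      simp
    have h4 : N * (gauge S y / ((N : ℝ) ^ 2 + 1) * N) < gauge S y := by
      rw [show N * (gauge S y / ((N : ℝ) ^ 2 + 1) * N) =
        gauge S y * (N : ℝ) ^ 2 / ((N : ℝ) ^ 2 + 1) by ring, div_lt_iff₀ (by positivity)]
      nlinarith
    linarith
  have hKbox := measureReal_box μ f hτ0
  have hSK := measureReal_box μ x (t := fun _ => 1) fun _ => zero_le_one
  have hfund := ZLattice.isAddFundamentalDomain (Module.Free.chooseBasis ℤ L) μ
  have hmin : μ.real K ≤ 2 ^ N * ZLattice.covolume L μ := by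
    rw [ZLattice.covolume_eq_measure_fundamentalDomain L μ hfund]
    by_contra! hlt
    have : Countable L := inferInstance
    have hfin : μ (ZSpan.fundamentalDomain ((Module.Free.chooseBasis ℤ L).ofZLatticeBasis ℝ)) ≠ ⊤ :=
      (ZSpan.fundamentalDomain_isBounded _).measure_lt_top.ne
    obtain ⟨z, hz0, hzK⟩ := exists_ne_zero_mem_lattice_of_measure_mul_two_pow_lt_measure
      (L := L.toAddSubgroup) (s := K) (μ := μ) hfund
      (fun y hy m => by simpa using hy m) (fun a ha b hb u v hu hv huv m => by
        simp only [map_add, map_smul, Finsupp.add_apply, Finsupp.smul_apply, smul_eq_mul]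
        calc |u * f.repr a m + v * f.repr b m| ≤ u * |f.repr a m| + v * |f.repr b m| := by
              refine (abs_add_le _ _).trans ?_
              rw [abs_mul, abs_mul, abs_of_nonneg hu, abs_of_nonneg hv]
          _ ≤ u * τ m + v * τ m := by gcongr <;> [exact ha m; exact hb m]
          _ = τ m := by rw [← add_mul, huv, one_mul]) (by
        rw [Module.finrank_eq_card_basis g, Fintype.card_fin]
        contrapose! hlt
        rw [measureReal_def, measureReal_def, mul_comm,
          show (2 : ℝ) ^ N = ((2 : ENNReal) ^ N).toReal by simp, ← ENNReal.toReal_mul]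
        exact ENNReal.toReal_mono (ENNReal.mul_ne_top hfin (by simp)) hlt)
    exact hz0 (Subtype.ext (hKL z z.2 hzK))
  have hS : μ.real S ≤ 2 ^ N * μ.real (ZSpan.fundamentalDomain x) := by
    have hne : μ {y | ∀ i, |x.repr y i| ≤ 1} ≠ ⊤ := by
      have : Bornology.IsBounded {y | ∀ i, |x.repr y i| ≤ 1} := by
        have h := (x.equivFunL.symm.lipschitz.isBounded_image
          (Metric.isBounded_closedBall (x := (0 : Fin N → ℝ)) (r := 1)))
        refine h.subset fun y hy => ⟨x.equivFunL y, ?_, by simp⟩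
        rw [mem_closedBall_zero_iff, pi_norm_le_iff_of_nonneg zero_le_one]
        exact fun i => hy i
      exact this.measure_lt_top.ne
    have hsub : S ⊆ {y | ∀ i, |x.repr y i| ≤ 1} := fun y hy => hx2 y (subset_closure hy)
    refine (measureReal_mono hsub hne).trans ?_
    rw [hSK]
    simp
  rw [hKbox, hD] at hmin
  have hprod : ∏ m, 2 * τ m = 2 ^ N * (∏ m, t m) / ((N : ℝ) ^ 2 + 1) ^ N := by
    rw [Finset.prod_mul_distrib]
    simp only [hτ]
    rw [Finset.prod_div_distrib]
    simp [mul_div_assoc]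
  rw [hprod] at hmin
  have hP : 0 ≤ ∏ m, t m := Finset.prod_nonneg fun m _ => ht m
  have hQ : (0 : ℝ) < ((N : ℝ) ^ 2 + 1) ^ N := by positivity
  calc (∏ m, t m) * μ.real S ≤ (∏ m, t m) * (2 ^ N * μ.real (ZSpan.fundamentalDomain x)) := by
        gcongr
    _ = (2 ^ N * (∏ m, t m) / ((N : ℝ) ^ 2 + 1) ^ N * μ.real (ZSpan.fundamentalDomain x)) *
        ((N : ℝ) ^ 2 + 1) ^ N := by field_simp
    _ ≤ (2 ^ N * ZLattice.covolume L μ) * ((N : ℝ) ^ 2 + 1) ^ N := by gcongr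
    _ = _ := by rw [mul_pow]; ring

/-- The covolume of a sublattice is its index times the covolume of the larger lattice. -/
lemma covolume_eq_relIndex_mul_covolume {E : Type*} [NormedAddCommGroup E] [NormedSpace ℝ E]
    [FiniteDimensional ℝ E] [MeasurableSpace E] [BorelSpace E] (μ : Measure E)
    [μ.IsAddHaarMeasure] (L₁ L₂ : Submodule ℤ E) [DiscreteTopology L₁] [IsZLattice ℝ L₁]
    [DiscreteTopology L₂] [IsZLattice ℝ L₂] (h : L₁ ≤ L₂) :
    ZLattice.covolume L₁ μ =
      (L₁.toAddSubgroup.relIndex L₂.toAddSubgroup : ℝ) * ZLattice.covolume L₂ μ := by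
  let b₂ := Module.Free.chooseBasis ℤ L₂
  let b₁ := (Module.Free.chooseBasis ℤ L₁).reindex (Fintype.equivOfCardEq
    (β := Module.Free.ChooseBasisIndex ℤ L₂) (by
      rw [← Module.finrank_eq_card_chooseBasisIndex, ← Module.finrank_eq_card_chooseBasisIndex,
        ZLattice.rank ℝ L₁, ZLattice.rank ℝ L₂]))
  have hidx : L₁.toAddSubgroup.relIndex L₂.toAddSubgroup =
      (b₂.det fun i => (⟨b₁ i, h (b₁ i).2⟩ : L₂)).natAbs :=
    AddSubgroup.relIndex_eq_natAbs_det L₁.toAddSubgroup L₂.toAddSubgroup h b₁ b₂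
  rw [ZLattice.covolume_eq_det_mul_measureReal L₁ μ b₁ (b₂.ofZLatticeBasis ℝ L₂),
    ZLattice.covolume_eq_measure_fundamentalDomain L₂ μ (ZLattice.isAddFundamentalDomain b₂ μ),
    hidx, Nat.cast_natAbs, Int.cast_abs]
  congr 2
  rw [Module.Basis.det_apply, Module.Basis.det_apply, Int.cast_det]
  congr 1
  ext i j
  rw [Matrix.map_apply, Module.Basis.toMatrix_apply, Module.Basis.toMatrix_apply]
  exact (b₂.ofZLatticeBasis_repr_apply ℝ L₂ ⟨b₁ j, h (Submodule.coe_mem _)⟩ i)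

/-- For a function with finite sublevel sets on a spanning set, a basis can be chosen greedily. -/
lemma exists_greedy_basis {k V : Type*} [Field k] [AddCommGroup V] [Module k V] {n : ℕ}
    (hn : Module.finrank k V = n) {A : Set V} (hA : Submodule.span k A = ⊤) (p : V → ℝ)
    (hp : ∀ r : ℝ, {x ∈ A | p x ≤ r}.Finite) :
    ∃ v : Fin n → V, LinearIndependent k v ∧ (∀ i, v i ∈ A) ∧
      ∀ i, ∀ x ∈ A, x ∉ Submodule.span k (v '' Set.Iio i) → p (v i) ≤ p x := by
  suffices h : ∀ m ≤ n, ∃ v : Fin m → V, LinearIndependent k v ∧ (∀ i, v i ∈ A) ∧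
      ∀ i, ∀ x ∈ A, x ∉ Submodule.span k (v '' Set.Iio i) → p (v i) ≤ p x from h n le_rfl
  intro m
  induction m with
  | zero =>
    exact fun _ => ⟨Fin.elim0, linearIndependent_empty_type, fun i => i.elim0, fun i => i.elim0⟩
  | succ m ih =>
    intro hm
    obtain ⟨v, hv, hvA, hvp⟩ := ih (by omega)
    obtain ⟨y, hyA, hy⟩ : ∃ y ∈ A, y ∉ Submodule.span k (Set.range v) := by
      by_contra! hcon
      have htop : Submodule.span k (Set.range v) = ⊤ :=
        top_le_iff.mp (hA ▸ Submodule.span_le.mpr hcon)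
      have h1 := finrank_span_eq_card hv
      rw [htop, finrank_top, hn, Fintype.card_fin] at h1
      omega
    obtain ⟨z, ⟨⟨hzA, _⟩, hz⟩, hzmin⟩ := Set.exists_min_image
      {x ∈ {x ∈ A | p x ≤ p y} | x ∉ Submodule.span k (Set.range v)} p
      ((hp (p y)).subset (Set.sep_subset _ _)) ⟨y, ⟨hyA, le_rfl⟩, hy⟩
    have hzmin' : ∀ x ∈ A, x ∉ Submodule.span k (Set.range v) → p z ≤ p x := fun x hx hxs => by
      rcases le_total (p x) (p y) with h | h
      · exact hzmin x ⟨⟨hx, h⟩, hxs⟩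
      · exact (hzmin y ⟨⟨hyA, le_rfl⟩, hy⟩).trans h
    have himage : ∀ i : Fin m, (Fin.snoc v z : Fin (m + 1) → V) '' Set.Iio i.castSucc =
        v '' Set.Iio i := fun i => by
      ext x
      constructor
      · rintro ⟨j, hj, rfl⟩
        have hj' : j.1 < i.1 := hj
        refine ⟨⟨j.1, by omega⟩, hj', ?_⟩
        conv_rhs => rw [show j = Fin.castSucc ⟨j.1, by omega⟩ from rfl]
        rw [Fin.snoc_castSucc]
      · rintro ⟨j, hj, rfl⟩
        exact ⟨j.castSucc, by simpa using hj, by simp⟩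
    have hlast : (Fin.snoc v z : Fin (m + 1) → V) '' Set.Iio (Fin.last m) = Set.range v := by
      ext x
      constructor
      · rintro ⟨j, hj, rfl⟩
        have hj' : j.1 < m := hj
        refine ⟨⟨j.1, hj'⟩, ?_⟩
        conv_rhs => rw [show j = Fin.castSucc ⟨j.1, hj'⟩ from rfl]
        rw [Fin.snoc_castSucc]
      · rintro ⟨j, rfl⟩
        exact ⟨j.castSucc, Fin.castSucc_lt_last j, by simp⟩
    refine ⟨Fin.snoc v z, linearIndependent_finSnoc.mpr ⟨hv, hz⟩, fun i => ?_, fun i => ?_⟩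
    · refine Fin.lastCases ?_ (fun i => ?_) i
      · simpa using hzA
      · simpa using hvA i
    · refine Fin.lastCases ?_ (fun i => ?_) i
      · rw [hlast, Fin.snoc_last]
        exact hzmin'
      · rw [himage, Fin.snoc_castSucc]
        exact hvp i

/-- The product of the spaces `k_wⁿ` over the infinite places `w` of `k`. -/
abbrev ArchSpace (k : Type*) [Field k] (n : ℕ) : Type _ :=
  ({w : InfinitePlace k // w.IsReal} → Fin n → ℝ) ×
    ({w : InfinitePlace k // w.IsComplex} → Fin n → ℂ)

/-- Regrouping the coordinates of a vector over the mixed space by infinite places. -/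
def archEquiv (k : Type*) [Field k] (n : ℕ) :
    (Fin n → mixedEmbedding.mixedSpace k) ≃ₗ[ℝ] ArchSpace k n where
  toFun x := (fun w m => (x m).1 w, fun w m => (x m).2 w)
  invFun y m := (fun w => y.1 w m, fun w => y.2 w m)
  map_add' _ _ := rfl
  map_smul' _ _ := rfl
  left_inv _ := rfl
  right_inv _ := rfl

/-- The diagonal embedding of `kⁿ` in the product of its archimedean completions. -/
noncomputable def archEmbedding (k : Type*) [Field k] (n : ℕ) : (Fin n → k) →+ ArchSpace k n :=
  (archEquiv k n).toLinearMap.toAddMonoidHom.comp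
    ((mixedEmbedding k).toAddMonoidHom.compLeft (Fin n))

lemma archEmbedding_apply {k : Type*} [Field k] {n : ℕ} (x : Fin n → k) :
    archEmbedding k n x = archEquiv k n (fun m => mixedEmbedding k (x m)) := rfl

lemma archEmbedding_injective (k : Type*) [Field k] [NumberField k] (n : ℕ) :
    Function.Injective (archEmbedding k n) := fun x y h => by
  have := (archEquiv k n).injective h
  exact funext fun m => mixedEmbedding_injective k (congrFun this m)

/-- The embedding of `𝔬ⁿ` as a lattice in the product of the archimedean completions. -/
noncomputable def integralEmbedding (k : Type*) [Field k] (n : ℕ) :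
    (Fin n → 𝓞 k) →ₗ[ℤ] ArchSpace k n :=
  ((archEmbedding k n).comp
    ((algebraMap (𝓞 k) k).toAddMonoidHom.compLeft (Fin n))).toIntLinearMap

lemma integralEmbedding_apply {k : Type*} [Field k] {n : ℕ} (x : Fin n → 𝓞 k) :
    integralEmbedding k n x = archEmbedding k n (fun m => (x m : k)) := rfl

lemma integralEmbedding_injective (k : Type*) [Field k] [NumberField k] (n : ℕ) :
    Function.Injective (integralEmbedding k n) := fun x y h => by
  have := archEmbedding_injective k n h
  exact funext fun m => RingOfIntegers.coe_injective (congrFun this m)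

/-- The real basis of the product of the archimedean completions given by an integral basis
of `𝔬ⁿ`. -/
noncomputable def archBasis (k : Type*) [Field k] [NumberField k] (n : ℕ) :
    Module.Basis (Σ _ : Fin n, Module.Free.ChooseBasisIndex ℤ (𝓞 k)) ℝ (ArchSpace k n) :=
  (Pi.basis fun _ => mixedEmbedding.latticeBasis k).map (archEquiv k n)

lemma span_range_archBasis (k : Type*) [Field k] [NumberField k] (n : ℕ) :
    Submodule.span ℤ (Set.range (archBasis k n)) = LinearMap.range (integralEmbedding k n) := by
  let b : Module.Basis (Σ _ : Fin n, Module.Free.ChooseBasisIndex ℤ (𝓞 k)) ℤ (Fin n → 𝓞 k) :=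
    Pi.basis fun _ => RingOfIntegers.basis k
  have h : (archBasis k n : _ → ArchSpace k n) = integralEmbedding k n ∘ b := by
    funext i
    rw [Function.comp_apply, integralEmbedding_apply, archEmbedding_apply, archBasis,
      Module.Basis.map_apply]
    congr 1
    funext m
    rw [Pi.basis_apply, Pi.basis_apply, mixedEmbedding.latticeBasis_apply, integralBasis_apply]
    rcases eq_or_ne m i.1 with rfl | hm
    · simp
    · simp [hm]
  rw [h, Set.range_comp, ← Submodule.map_span, b.span_eq, LinearMap.range_eq_map]

instance (k : Type*) [Field k] [NumberField k] (n : ℕ) :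
    DiscreteTopology (LinearMap.range (integralEmbedding k n)) := by
  rw [← span_range_archBasis]
  infer_instance

instance (k : Type*) [Field k] [NumberField k] (n : ℕ) :
    IsZLattice ℝ (LinearMap.range (integralEmbedding k n)) := by
  simp_rw [← span_range_archBasis]
  infer_instance

/-- A basis of `kⁿ` together with an integral basis of `k` gives a real basis of the product of
the archimedean completions. -/
lemma exists_basis_archEmbedding {k : Type*} [Field k] [NumberField k] {n : ℕ}
    {v : Fin n → Fin n → k} (hv : LinearIndependent k v) :
    ∃ g : Module.Basis (Σ _ : Fin n, Module.Free.ChooseBasisIndex ℤ (𝓞 k)) ℝ (ArchSpace k n),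
      ∀ i, g i = archEmbedding k n (((RingOfIntegers.basis k i.2 : 𝓞 k) : k) • v i.1) := by
  let A : Matrix (Fin n) (Fin n) k := v
  have hA : IsUnit A.det :=
    (Matrix.isUnit_iff_isUnit_det A).mp (Matrix.linearIndependent_rows_iff_isUnit.mp hv)
  let σ := mixedEmbedding k
  have h1 : A.map σ * A⁻¹.map σ = 1 := by
    rw [← Matrix.map_mul, Matrix.mul_nonsing_inv _ hA, Matrix.map_one _ (map_zero σ) (map_one σ)]
  have h2 : A⁻¹.map σ * A.map σ = 1 := by
    rw [← Matrix.map_mul, Matrix.nonsing_inv_mul _ hA, Matrix.map_one _ (map_zero σ) (map_one σ)]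
  let T : (Fin n → mixedEmbedding.mixedSpace k) ≃ₗ[ℝ] (Fin n → mixedEmbedding.mixedSpace k) :=
    { toFun := fun c => Matrix.vecMul c (A.map σ)
      invFun := fun c => Matrix.vecMul c (A⁻¹.map σ)
      map_add' := fun c d => Matrix.add_vecMul _ _ _
      map_smul' := fun r c => Matrix.smul_vecMul _ _ _
      left_inv := fun c => by
        change Matrix.vecMul (Matrix.vecMul c (A.map σ)) (A⁻¹.map σ) = c
        rw [Matrix.vecMul_vecMul, h1, Matrix.vecMul_one]
      right_inv := fun c => by
        change Matrix.vecMul (Matrix.vecMul c (A⁻¹.map σ)) (A.map σ) = c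
        rw [Matrix.vecMul_vecMul, h2, Matrix.vecMul_one] }
  refine ⟨((Pi.basis fun _ => mixedEmbedding.latticeBasis k).map T).map (archEquiv k n),
    fun i => ?_⟩
  rw [Module.Basis.map_apply, Module.Basis.map_apply, archEmbedding_apply, Pi.basis_apply,
    mixedEmbedding.latticeBasis_apply, integralBasis_apply]
  congr 1
  change Matrix.vecMul (Pi.single i.1 _) (A.map σ) = _
  rw [Matrix.single_vecMul]
  exact funext fun m => (map_mul σ _ (v i.1 m)).symm

lemma archEmbedding_smul_mem_span {k : Type*} [Field k] [NumberField k] {n : ℕ} (c : k)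
    (x : Fin n → k) :
    archEmbedding k n (c • x) ∈ Submodule.span ℝ (Set.range fun a =>
      archEmbedding k n (((RingOfIntegers.basis k a : 𝓞 k) : k) • x)) := by
  have h : archEmbedding k n (c • x) = ∑ a, (mixedEmbedding.latticeBasis k).repr
      (mixedEmbedding k c) a •
        archEmbedding k n (((RingOfIntegers.basis k a : 𝓞 k) : k) • x) := by
    simp only [archEmbedding_apply, ← map_smul, ← map_sum]
    congr 1
    funext m
    have hc := (mixedEmbedding.latticeBasis k).sum_repr (mixedEmbedding k c)
    rw [Pi.smul_apply, smul_eq_mul, map_mul]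
    conv_lhs => rw [← hc]
    simp [Finset.sum_mul, mixedEmbedding.latticeBasis_apply, integralBasis_apply]
  rw [h]
  exact Submodule.sum_mem _ fun a _ =>
    Submodule.smul_mem _ _ (Submodule.subset_span ⟨a, rfl⟩)

lemma archEmbedding_mem_span {k : Type*} [Field k] [NumberField k] {n : ℕ}
    {s : Set (Fin n → k)} {x : Fin n → k} (hx : x ∈ Submodule.span k s)
    {W : Submodule ℝ (ArchSpace k n)}
    (hW : ∀ y ∈ s, ∀ a, archEmbedding k n (((RingOfIntegers.basis k a : 𝓞 k) : k) • y) ∈ W) :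
    archEmbedding k n x ∈ W := by
  induction hx using Submodule.closure_induction with
  | zero => simp
  | add a b _ _ ha hb => rw [map_add]; exact W.add_mem ha hb
  | smul_mem c y hy =>
    refine (Submodule.span_le.mpr ?_) (archEmbedding_smul_mem_span c y)
    rintro _ ⟨a, rfl⟩
    exact hW y hy a

lemma mem_smul_prod_pi_iff {k : Type*} [Field k] {n : ℕ}
    {Sr : {w : InfinitePlace k // w.IsReal} → Set (Fin n → ℝ)}
    {Sc : {w : InfinitePlace k // w.IsComplex} → Set (Fin n → ℂ)} {l : ℝ} (hl : 0 < l)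
    (x : Fin n → k) :
    archEmbedding k n x ∈ l • (Set.univ.pi Sr ×ˢ Set.univ.pi Sc) ↔
      (∀ w : {w : InfinitePlace k // w.IsReal},
        (fun m => InfinitePlace.embedding_of_isReal w.2 (x m)) ∈ l • Sr w) ∧
      ∀ w : {w : InfinitePlace k // w.IsComplex}, (fun m => w.1.embedding (x m)) ∈ l • Sc w := by
  simp only [Set.mem_smul_set_iff_inv_smul_mem₀ hl.ne', Set.mem_prod, Set.mem_univ_pi]
  simp only [archEmbedding_apply, archEquiv, LinearEquiv.coe_mk, LinearMap.coe_mk, AddHom.coe_mk,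
    Prod.smul_mk, Pi.smul_def, mixedEmbedding.mixedEmbedding_apply_isReal,
    mixedEmbedding.mixedEmbedding_apply_isComplex]

instance (k : Type*) [Field k] [NumberField k] (n : ℕ) :
    (volume : Measure (ArchSpace k n)).IsAddHaarMeasure :=
  have : (volume : Measure ({w : InfinitePlace k // w.IsReal} → Fin n → ℝ)).IsAddHaarMeasure :=
    Measure.pi.isAddHaarMeasure _
  have : (volume : Measure ({w : InfinitePlace k // w.IsComplex} → Fin n → ℂ)).IsAddHaarMeasure :=
    Measure.pi.isAddHaarMeasure _
  Measure.prod.instIsAddHaarMeasure volume volume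

lemma finite_setOf_gauge_archEmbedding_le {k : Type*} [Field k] [NumberField k] {n : ℕ}
    {S : Set (ArchSpace k n)} (h0 : S ∈ nhds 0) (hconv : Convex ℝ S)
    (hbdd : Bornology.IsBounded S) (Λ : Set (Fin n → 𝓞 k)) (r : ℝ) :
    {x ∈ (fun (y : Fin n → 𝓞 k) => fun i => (y i : k)) '' Λ |
      gauge S (archEmbedding k n x) ≤ r}.Finite := by
  have hr : (0 : ℝ) < |r| + 1 := by positivity
  have hb : Bornology.IsBounded ((|r| + 1) • S) := hbdd.smul₀ (|r| + 1)
  refine ((ZSpan.setFinite_inter (archBasis k n) hb).preimage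
    (archEmbedding_injective k n).injOn).subset ?_
  rintro _ ⟨⟨y, -, rfl⟩, hy⟩
  refine ⟨?_, ?_⟩
  · by_contra hmem
    have := le_gauge_of_notMem (hconv.starConvex (mem_of_mem_nhds h0))
      ((absorbent_nhds_zero h0).absorbs) hmem
    linarith [le_abs_self r]
  · rw [span_range_archBasis]
    exact ⟨y, rfl⟩

/-- Minkowski's second theorem for an `𝔬`-lattice, in terms of the gauges of a greedily chosen
basis. -/
lemma prod_gauge_pow_mul_measureReal_le {k : Type*} [Field k] [NumberField k] {n : ℕ}
    (Λ : Submodule (𝓞 k) (Fin n → 𝓞 k)) {S : Set (ArchSpace k n)} (hne : 0 ∈ S) (hopen : IsOpen S)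
    (hconv : Convex ℝ S) (hsymm : ∀ x ∈ S, -x ∈ S) (hbdd : Bornology.IsBounded S)
    {v : Fin n → Fin n → k} (hv : LinearIndependent k v)
    (hvΛ : ∀ i, v i ∈ (fun (y : Fin n → 𝓞 k) => fun i => (y i : k)) '' (Λ : Set (Fin n → 𝓞 k)))
    (hmin : ∀ i, ∀ x ∈ (fun (y : Fin n → 𝓞 k) => fun i => (y i : k)) '' (Λ : Set (Fin n → 𝓞 k)),
      x ∉ Submodule.span k (v '' Set.Iio i) →
        gauge S (archEmbedding k n (v i)) ≤ gauge S (archEmbedding k n x)) :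
    (∏ i, gauge S (archEmbedding k n (v i))) ^ Module.finrank ℚ k * volume.real S ≤
      (2 * (((n * Module.finrank ℚ k : ℕ) : ℝ) ^ 2 + 1)) ^ (n * Module.finrank ℚ k) *
        ZLattice.covolume (LinearMap.range (integralEmbedding k n)) volume *
          (Λ.toAddSubgroup.index : ℝ) := by
  have hd : Fintype.card (Module.Free.ChooseBasisIndex ℤ (𝓞 k)) = Module.finrank ℚ k := by
    rw [← Module.finrank_eq_card_chooseBasisIndex, RingOfIntegers.rank]
  obtain ⟨g, hg⟩ := exists_basis_archEmbedding hv
  let L₂ := LinearMap.range (integralEmbedding k n)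
  let L₁ : Submodule ℤ (ArchSpace k n) := (Λ.restrictScalars ℤ).map (integralEmbedding k n)
  have hle : L₁ ≤ L₂ := LinearMap.map_le_range
  have hgL : ∀ i, g i ∈ L₁ := fun i => by
    obtain ⟨y, hy, hyv⟩ := hvΛ i.1
    refine ⟨RingOfIntegers.basis k i.2 • y, Λ.smul_mem _ hy, ?_⟩
    rw [hg, ← hyv, integralEmbedding_apply]
    congr 1
  have : DiscreteTopology L₁ := DiscreteTopology.of_subset (s := L₂)
    (inferInstanceAs (DiscreteTopology L₂)) hle
  have : IsZLattice ℝ L₁ := ⟨top_le_iff.mp (g.span_eq ▸ Submodule.span_mono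
    (Set.range_subset_iff.mpr hgL))⟩
  have hcov : ZLattice.covolume L₁ volume =
      (Λ.toAddSubgroup.index : ℝ) * ZLattice.covolume L₂ volume := by
    rw [covolume_eq_relIndex_mul_covolume volume L₁ L₂ hle]
    congr 2
    rw [← AddSubgroup.relIndex_top_right, ← AddSubgroup.relIndex_map_map_of_injective
      Λ.toAddSubgroup ⊤ (f := (integralEmbedding k n).toAddMonoidHom)
      (integralEmbedding_injective k n)]
    congr 1
    ext x
    simp [L₂]
  let e : (Σ _ : Fin n, Module.Free.ChooseBasisIndex ℤ (𝓞 k)) ≃ Fin (n * Module.finrank ℚ k) :=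
    (Equiv.sigmaEquivProd _ _).trans
      (((Equiv.refl _).prodCongr (Fintype.equivFinOfCardEq hd)).trans finProdFinEquiv)
  have he : ∀ i j, i.1 < j.1 → e i < e j := by
    rintro ⟨i, a⟩ ⟨j, b⟩ hij
    rw [Fin.lt_def]
    have ha := (Fintype.equivFinOfCardEq hd a).2
    have : (i : ℕ) + 1 ≤ j := hij
    change (Fintype.equivFinOfCardEq hd a : ℕ) + Module.finrank ℚ k * i <
      Fintype.equivFinOfCardEq hd b + Module.finrank ℚ k * j
    nlinarith
  have key := prod_mul_measureReal_le_covolume volume L₁ (g.reindex e) hne hopen hconv hsymm hbdd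
    (t := fun m => gauge S (archEmbedding k n (v (e.symm m).1))) (fun m => gauge_nonneg _)
    (fun m y hy hym => by
      obtain ⟨x, hx, rfl⟩ := hy
      refine hmin _ _ ⟨x, hx, rfl⟩ fun hspan => hym ?_
      rw [integralEmbedding_apply]
      refine archEmbedding_mem_span hspan ?_
      rintro _ ⟨j, hj, rfl⟩ a
      refine Submodule.subset_span ⟨e ⟨j, a⟩, ?_, ?_⟩
      · have := he ⟨j, a⟩ (e.symm m) hj
        rwa [e.apply_symm_apply] at this
      · rw [Module.Basis.reindex_apply, e.symm_apply_apply, hg])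
  have hprod : ∏ m, gauge S (archEmbedding k n (v (e.symm m).1)) =
      (∏ i, gauge S (archEmbedding k n (v i))) ^ Module.finrank ℚ k := by
    rw [e.symm.prod_comp (fun i => gauge S (archEmbedding k n (v i.1))), Fintype.prod_sigma]
    simp [Finset.prod_pow, hd]
  rw [hprod, hcov] at key
  exact key.trans_eq (by ring)

/-- The successive minima are bounded by the gauges of a greedily chosen basis. -/
lemma sInf_le_gauge {k : Type*} [Field k] [NumberField k] {n : ℕ} {A : Set (Fin n → k)}
    {S : Set (ArchSpace k n)} (h0 : S ∈ nhds 0) (hconv : Convex ℝ S) {v : Fin n → Fin n → k}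
    (hv : LinearIndependent k v) (hvA : ∀ i, v i ∈ A)
    (hmin : ∀ i, ∀ x ∈ A, x ∉ Submodule.span k (v '' Set.Iio i) →
        gauge S (archEmbedding k n (v i)) ≤ gauge S (archEmbedding k n x)) (i : Fin n) :
    sInf {l : ℝ | 0 < l ∧ ∃ u : Fin (i.1 + 1) → Fin n → k,
      (∀ j, u j ∈ A ∧ archEmbedding k n (u j) ∈ l • S) ∧ LinearIndependent k u} ≤
        gauge S (archEmbedding k n (v i)) := by
  refine le_of_forall_gt_imp_ge_of_dense fun l hl => csInf_le ⟨0, fun _ h => h.1.le⟩ ?_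
  refine ⟨(gauge_nonneg _).trans_lt hl, v ∘ Fin.castLE i.2, fun j => ⟨hvA _, ?_⟩,
    hv.comp _ (Fin.castLE_injective _)⟩
  by_contra hmem
  refine (le_gauge_of_notMem (hconv.starConvex (mem_of_mem_nhds h0))
    ((absorbent_nhds_zero h0).absorbs) hmem).not_gt (lt_of_le_of_lt ?_ hl)
  refine hmin _ _ (hvA i) fun hspan => ?_
  refine hv.notMem_span_image (s := Set.Iio (Fin.castLE i.2 j)) (x := i) ?_ hspan
  simp only [Set.mem_Iio, not_lt, Fin.le_def, Fin.val_castLE]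
  omega

/-- adelic Minkowski second theorem, after Bombieri–Vaaler:  for each
`n` there is a constant `C = C(n, k)` such that for every full `𝔬`-lattice `Λ ⊆ 𝔬ⁿ`,
every product `S = ∏_{w | ∞} S_w` of non-empty open convex symmetric bounded subsets
`S_w ⊆ k_wⁿ` (with `k_w = ℝ` at real places and `k_w = ℂ` at complex places), and the
successive minima `λ_1 ≤ ⋯ ≤ λ_n` of `Λ` with respect to `S`, one has
`(λ_1⋯λ_n)^d · ∏_{w | ∞} Vol(S_w) ≤ C·[𝔬ⁿ : Λ]`, where `d = [k : ℚ]` and the volume at a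
complex place is `2ⁿ` times Lebesgue measure (`dμ_w` being twice Lebesgue measure
on `k_w = ℂ`). -/
theorem adelic_minkowski {k : Type*} [Field k] [NumberField k] (n : ℕ) :
    ∃ C : ℝ, 0 < C ∧
      ∀ (Λ : Submodule (𝓞 k) (Fin n → 𝓞 k)),
        Submodule.span k ((fun (y : Fin n → 𝓞 k) => fun i => (y i : k)) ''
          (Λ : Set (Fin n → 𝓞 k))) = ⊤ →
      ∀ (Sr : {w : InfinitePlace k // w.IsReal} → Set (Fin n → ℝ))
        (Sc : {w : InfinitePlace k // w.IsComplex} → Set (Fin n → ℂ)),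
        (∀ w, (Sr w).Nonempty ∧ IsOpen (Sr w) ∧ Convex ℝ (Sr w) ∧
          (∀ x ∈ Sr w, -x ∈ Sr w) ∧ Bornology.IsBounded (Sr w)) →
        (∀ w, (Sc w).Nonempty ∧ IsOpen (Sc w) ∧ Convex ℝ (Sc w) ∧
          (∀ x ∈ Sc w, -x ∈ Sc w) ∧ Bornology.IsBounded (Sc w)) →
      ∀ lam : Fin n → ℝ,
        (∀ i : Fin n, lam i =
          sInf {l : ℝ | 0 < l ∧ ∃ v : Fin (i.1 + 1) → (Fin n → 𝓞 k),
            (∀ j, v j ∈ Λ ∧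
              (∀ w : {w : InfinitePlace k // w.IsReal},
                (fun m => (InfinitePlace.embedding_of_isReal w.2 ((v j m : k)))) ∈ l • Sr w) ∧
              (∀ w : {w : InfinitePlace k // w.IsComplex},
                (fun m => (w.1.embedding ((v j m : k)))) ∈ l • Sc w)) ∧
            LinearIndependent k (fun j => (fun m => ((v j m : k))))}) →
        (∏ i : Fin n, lam i) ^ (Module.finrank ℚ k) *
            ((∏ w : {w : InfinitePlace k // w.IsReal}, (volume (Sr w)).toReal) *
              ∏ w : {w : InfinitePlace k // w.IsComplex},
                (2 : ℝ) ^ n * (volume (Sc w)).toReal) ≤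
          C * (Λ.toAddSubgroup.index : ℝ) := by
  have hcov := ZLattice.covolume_pos (LinearMap.range (integralEmbedding k n)) volume
  refine ⟨(∏ _w : {w : InfinitePlace k // w.IsComplex}, (2 : ℝ) ^ n) *
    ((2 * (((n * Module.finrank ℚ k : ℕ) : ℝ) ^ 2 + 1)) ^ (n * Module.finrank ℚ k) *
        ZLattice.covolume (LinearMap.range (integralEmbedding k n)) volume), by positivity, ?_⟩
  intro Λ hΛ Sr Sc hSr hSc lam hlam
  have zero_mem : ∀ {E : Type _} [AddCommGroup E] [Module ℝ E] {s : Set E}, s.Nonempty →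
      Convex ℝ s → (∀ x ∈ s, -x ∈ s) → (0 : E) ∈ s := by
    intro E _ _ s ⟨x, hx⟩ hs hneg
    have := hs hx (hneg x hx) (show (0 : ℝ) ≤ 1 / 2 by norm_num) (show (0 : ℝ) ≤ 1 / 2 by norm_num)
      (by norm_num)
    rwa [smul_neg, add_neg_cancel] at this
  set S : Set (ArchSpace k n) := Set.univ.pi Sr ×ˢ Set.univ.pi Sc with hS
  have hne : (0 : ArchSpace k n) ∈ S :=
    ⟨fun w _ => zero_mem (hSr w).1 (hSr w).2.2.1 (hSr w).2.2.2.1,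
      fun w _ => zero_mem (hSc w).1 (hSc w).2.2.1 (hSc w).2.2.2.1⟩
  have hopen : IsOpen S := (isOpen_set_pi Set.finite_univ fun w _ => (hSr w).2.1).prod
    (isOpen_set_pi Set.finite_univ fun w _ => (hSc w).2.1)
  have hconv : Convex ℝ S := (convex_pi fun w _ => (hSr w).2.2.1).prod
    (convex_pi fun w _ => (hSc w).2.2.1)
  have hsymm : ∀ x ∈ S, -x ∈ S := fun x hx =>
    ⟨fun w hw => (hSr w).2.2.2.1 _ (hx.1 w hw), fun w hw => (hSc w).2.2.2.1 _ (hx.2 w hw)⟩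
  have hbdd : Bornology.IsBounded S := (Bornology.IsBounded.pi fun w => (hSr w).2.2.2.2).prod
    (Bornology.IsBounded.pi fun w => (hSc w).2.2.2.2)
  have h0 : S ∈ nhds 0 := hopen.mem_nhds hne
  obtain ⟨v, hv, hvA, hmin⟩ := exists_greedy_basis (Module.finrank_fin_fun k) hΛ
    (fun x => gauge S (archEmbedding k n x)) (finite_setOf_gauge_archEmbedding_le h0 hconv hbdd Λ)
  have hlam0 : ∀ i, 0 ≤ lam i := fun i => by
    rw [hlam]
    exact Real.sInf_nonneg fun l hl => hl.1.le
  have hlam1 : ∀ i, lam i ≤ gauge S (archEmbedding k n (v i)) := fun i => by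
    rw [hlam]
    refine le_of_eq_of_le (congrArg sInf ?_) (sInf_le_gauge h0 hconv hv hvA hmin i)
    ext l
    refine and_congr_right fun hl => ⟨?_, ?_⟩
    · rintro ⟨u, hu, hli⟩
      exact ⟨_, fun j => ⟨⟨u j, (hu j).1, rfl⟩, (mem_smul_prod_pi_iff hl _).mpr (hu j).2⟩, hli⟩
    · rintro ⟨u, hu, hli⟩
      choose y hy hyu using fun j => (hu j).1
      obtain rfl : (fun j => fun m => ((y j m : 𝓞 k) : k)) = u := funext hyu
      exact ⟨y, fun j => ⟨hy j, (mem_smul_prod_pi_iff hl _).mp (hu j).2⟩, hli⟩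
  have hvol : volume.real S =
      (∏ w, (volume (Sr w)).toReal) * ∏ w, (volume (Sc w)).toReal := by
    rw [hS, measureReal_def, Measure.volume_eq_prod, Measure.prod_prod, volume_pi_pi, volume_pi_pi,
      ENNReal.toReal_mul, ENNReal.toReal_prod, ENNReal.toReal_prod]
  have key := prod_gauge_pow_mul_measureReal_le Λ hne hopen hconv hsymm hbdd hv hvA hmin
  calc (∏ i, lam i) ^ Module.finrank ℚ k * ((∏ w, (volume (Sr w)).toReal) *
          ∏ w : {w : InfinitePlace k // w.IsComplex}, (2 : ℝ) ^ n * (volume (Sc w)).toReal)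
      = (∏ _w : {w : InfinitePlace k // w.IsComplex}, (2 : ℝ) ^ n) *
          ((∏ i, lam i) ^ Module.finrank ℚ k * volume.real S) := by
        rw [hvol, Finset.prod_mul_distrib]
        ring
    _ ≤ (∏ _w : {w : InfinitePlace k // w.IsComplex}, (2 : ℝ) ^ n) *
          ((∏ i, gauge S (archEmbedding k n (v i))) ^ Module.finrank ℚ k * volume.real S) := by
        refine mul_le_mul_of_nonneg_left (mul_le_mul_of_nonneg_right (pow_le_pow_left₀
          (Finset.prod_nonneg fun i _ => hlam0 i)
          (Finset.prod_le_prod (fun i _ => hlam0 i) fun i _ => hlam1 i) _)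
          measureReal_nonneg) (by positivity)
    _ ≤ _ := by
        rw [mul_assoc]
        gcongr
end

section
/- Consider the equation F(x) = a_1 x_1^t + a_2 x_2^t + a_3 x_3^t = 0, with a_1, a_2, a_3 ∈ 𝔬 all nonzero and t ∈ ℤ, t ≥ 2. Let Δ(F) = ⟨a_1 a_2 a_3⟩ and Δ_0(F) = ⟨a_1 a_2, a_2 a_3, a_3 a_1⟩ as integral ideals of 𝔬, and let δ_t be the multiplicative function on integral ideals determined by δ_t(𝔭^r) = r + t − 1 for each prime ideal 𝔭 and r ≥ 1. Then there exist 𝔬-lattices Γ_1,…,Γ_J ⊂ 𝔬³, each of dimension 3 (i.e. each containing a k-basis of k³), such that every solution x ∈ 𝔬³ of F(x) = 0 lies in some Γ_j, with J ≤ t^{3d}·δ_t(Δ(F)) where d = [k : ℚ], and det Γ_j = [𝔬³ : Γ_j] ≥ t^{−2d}·N_k(Δ(F))^{2/t} / N_k(Δ_0(F))^{3/t} for every j. -/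
open NumberField

namespace FermatLattice

section Order

variable {R : Type*} [CommRing R] {P : Ideal R}

/-- The element `x` has `P`-adic order exactly `n`. -/
def HasOrd (P : Ideal R) (x : R) (n : ℕ) : Prop := x ∈ P ^ n ∧ x ∉ P ^ (n + 1)

theorem hasOrd_one (hP : Prime P) : HasOrd P (1 : R) 0 := by
  refine ⟨by simp, fun h ↦ hP.not_isUnit ?_⟩
  rw [zero_add, pow_one] at h
  exact Ideal.isUnit_iff.2 ((Ideal.eq_top_iff_one P).2 h)

theorem HasOrd.lt_of_notMem {x : R} {m n : ℕ} (hm : HasOrd P x m) (hn : x ∉ P ^ n) : m < n := by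
  by_contra h
  exact hn (Ideal.pow_le_pow_right (not_lt.1 h) hm.1)

theorem HasOrd.ne_zero {x : R} {m : ℕ} (hm : HasOrd P x m) : x ≠ 0 := by
  rintro rfl
  exact hm.2 (zero_mem _)

theorem HasOrd.add_of_mem {x y : R} {n : ℕ} (hx : HasOrd P x n) (hy : y ∈ P ^ (n + 1)) :
    HasOrd P (x + y) n := by
  refine ⟨add_mem hx.1 (Ideal.pow_le_pow_right n.le_succ hy), fun h ↦ hx.2 ?_⟩
  simpa using sub_mem h hy

theorem pow_sub_pow_mem {A B : R} {s f : ℕ} (hA : A ∈ P ^ s) (hB : B ∈ P ^ s)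
    (hAB : A - B ∈ P ^ (s + f)) (i : ℕ) : A ^ i - B ^ i ∈ P ^ (s * i + f) := by
  induction i with
  | zero => simp
  | succ i ih =>
    have h1 : A * (A ^ i - B ^ i) ∈ P ^ (s * (i + 1) + f) := by
      have := Ideal.mul_mem_mul hA ih
      rwa [← pow_add, show s + (s * i + f) = s * (i + 1) + f by ring] at this
    have h2 : (A - B) * B ^ i ∈ P ^ (s * (i + 1) + f) := by
      have := Ideal.mul_mem_mul hAB (Ideal.pow_mem_pow hB i)
      rwa [← pow_mul, ← pow_add, show s + f + s * i = s * (i + 1) + f by ring] at this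
    have := add_mem h1 h2
    rwa [show A * (A ^ i - B ^ i) + (A - B) * B ^ i = A ^ (i + 1) - B ^ (i + 1) by ring] at this

variable [IsDedekindDomain R]

theorem hasOrd_iff {x : R} {n : ℕ} :
    HasOrd P x n ↔ emultiplicity P (Ideal.span {x}) = n := by
  rw [emultiplicity_eq_coe, Ideal.dvd_span_singleton, Ideal.dvd_span_singleton, HasOrd]

theorem mem_pow_iff {x : R} {n : ℕ} :
    x ∈ P ^ n ↔ (n : ℕ∞) ≤ emultiplicity P (Ideal.span {x}) := by
  rw [← pow_dvd_iff_le_emultiplicity, Ideal.dvd_span_singleton]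

theorem emultiplicity_span_mul (hP : Prime P) (x y : R) :
    emultiplicity P (Ideal.span {x * y}) =
      emultiplicity P (Ideal.span {x}) + emultiplicity P (Ideal.span {y}) := by
  rw [← Ideal.span_singleton_mul_span_singleton, emultiplicity_mul hP]

theorem HasOrd.mul (hP : Prime P) {x y : R} {m n : ℕ} (hx : HasOrd P x m) (hy : HasOrd P y n) :
    HasOrd P (x * y) (m + n) := by
  rw [hasOrd_iff] at *
  rw [emultiplicity_span_mul hP, hx, hy, Nat.cast_add]

theorem HasOrd.pow (hP : Prime P) {x : R} {m : ℕ} (hx : HasOrd P x m) (t : ℕ) :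
    HasOrd P (x ^ t) (t * m) := by
  induction t with
  | zero => simpa using hasOrd_one hP
  | succ t ih => rw [pow_succ, Nat.succ_mul]; exact ih.mul hP hx

theorem HasOrd.mem_of_mul_mem (hP : Prime P) {x y : R} {a b : ℕ} (hx : HasOrd P x a)
    (h : x * y ∈ P ^ (a + b)) : y ∈ P ^ b := by
  rw [hasOrd_iff] at hx
  rw [mem_pow_iff] at *
  rw [emultiplicity_span_mul hP, hx, Nat.cast_add] at h
  exact (ENat.add_le_add_iff_left (ENat.natCast_ne_top a)).1 h

theorem HasOrd.unique {x : R} {m n : ℕ} (hm : HasOrd P x m) (hn : HasOrd P x n) : m = n := by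
  rw [hasOrd_iff] at *
  exact_mod_cast hm.symm.trans hn

theorem exists_hasOrd (hP : Prime P) {x : R} (hx : x ≠ 0) : ∃ n, HasOrd P x n := by
  have h : FiniteMultiplicity P (Ideal.span {x}) :=
    FiniteMultiplicity.of_prime_left hP (by simpa using hx)
  exact ⟨_, hasOrd_iff.2 h.emultiplicity_eq_multiplicity⟩

theorem exists_sub_mul_mem (hP : Prime P) {g c : R} {a : ℕ} (hg : HasOrd P g a)
    (hc : c ∈ P ^ a) (b : ℕ) : ∃ r, c - r * g ∈ P ^ (a + b) := by
  have hdvd : Ideal.span {g} ⊔ P ^ (a + b) ∣ P ^ (a + b) := Ideal.dvd_iff_le.2 le_sup_right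
  obtain ⟨i, -, hi⟩ := (dvd_prime_pow hP _).1 hdvd
  rw [associated_iff_eq] at hi
  have hgi : g ∈ P ^ i := hi ▸ Ideal.mem_sup_left (Ideal.mem_span_singleton_self g)
  have hia : i ≤ a := by
    by_contra h
    exact hg.2 (Ideal.pow_le_pow_right (by omega) hgi)
  have hc' : c ∈ Ideal.span {g} ⊔ P ^ (a + b) := hi ▸ Ideal.pow_le_pow_right hia hc
  obtain ⟨y, hy, z, hz, rfl⟩ := Submodule.mem_sup.1 hc'
  obtain ⟨r, rfl⟩ := Ideal.mem_span_singleton'.1 hy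
  exact ⟨r, by simpa using hz⟩

/-- If `A ≡ B` to relative precision `e + 1`, where `e` is the order of `t`, then the order of
`A ^ t - B ^ t` is exactly `e + s (t - 1)` more than that of `A - B`. -/
theorem sub_mem_of_pow_sub_pow_mem (hP : Prime P) {A B : R} {s t e n : ℕ} (ht : 1 ≤ t)
    (he : HasOrd P (t : R) e) (hA : A ∈ P ^ s) (hB : HasOrd P B s)
    (hAB : A - B ∈ P ^ (s + (e + 1))) (h : A ^ t - B ^ t ∈ P ^ (e + (t - 1) * s + n)) :
    A - B ∈ P ^ n := by
  have key : HasOrd P (∑ i ∈ Finset.range t, A ^ i * B ^ (t - 1 - i)) (e + (t - 1) * s) := by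
    have h0 : ∑ i ∈ Finset.range t, A ^ i * B ^ (t - 1 - i) = t * B ^ (t - 1) +
        ∑ i ∈ Finset.range t, (A ^ i - B ^ i) * B ^ (t - 1 - i) := by
      have : (t : R) * B ^ (t - 1) = ∑ i ∈ Finset.range t, B ^ i * B ^ (t - 1 - i) := by
        rw [Finset.sum_congr rfl (g := fun _ ↦ B ^ (t - 1)), Finset.sum_const, Finset.card_range,
          nsmul_eq_mul]
        intro i hi
        rw [← pow_add, Nat.add_sub_cancel' (by have := Finset.mem_range.1 hi; omega)]
      rw [this, ← Finset.sum_add_distrib]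
      exact Finset.sum_congr rfl fun i _ ↦ by ring
    rw [h0]
    refine (he.mul hP (hB.pow hP (t - 1))).add_of_mem (Ideal.sum_mem _ fun i hi ↦ ?_)
    have := Ideal.mul_mem_mul (pow_sub_pow_mem hA hB.1 hAB i)
      (Ideal.pow_mem_pow hB.1 (t - 1 - i))
    rw [← pow_mul, ← pow_add] at this
    have hi' : i + (t - 1 - i) = t - 1 := by have := Finset.mem_range.1 hi; omega
    rwa [show s * i + (e + 1) + s * (t - 1 - i) = e + (i + (t - 1 - i)) * s + 1 by ring, hi']
      at this
  rw [← geom_sum₂_mul] at h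
  exact key.mem_of_mul_mem hP h

end Order

section Lattice

variable {R : Type*} [CommRing R]

/-- Vectors whose `j`-th coordinate lies in `P ^ b` and whose `i`-th and `j`-th coordinates are
in ratio `p : q` modulo `P ^ K`. -/
def ratioLattice (P : Ideal R) (i j : Fin 3) (p q : R) (b K : ℕ) : Submodule R (Fin 3 → R) where
  carrier := {y | y j ∈ P ^ b ∧ y i * q - p * y j ∈ P ^ K}
  add_mem' := by
    rintro x y ⟨h1, h2⟩ ⟨h3, h4⟩
    refine ⟨add_mem h1 h3, ?_⟩
    have := add_mem h2 h4
    rwa [show x i * q - p * x j + (y i * q - p * y j) = (x + y) i * q - p * (x + y) j by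
      simp only [Pi.add_apply]; ring] at this
  zero_mem' := by simp
  smul_mem' := by
    rintro c x ⟨h1, h2⟩
    refine ⟨Ideal.mul_mem_left _ c h1, ?_⟩
    have := Ideal.mul_mem_left _ c h2
    rwa [show c * (x i * q - p * x j) = (c • x) i * q - p * (c • x) j by
      simp only [Pi.smul_apply, smul_eq_mul]; ring] at this

theorem mem_ratioLattice {P : Ideal R} {i j : Fin 3} {p q : R} {b K : ℕ} {y : Fin 3 → R} :
    y ∈ ratioLattice P i j p q b K ↔ y j ∈ P ^ b ∧ y i * q - p * y j ∈ P ^ K := Iff.rfl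

/-- Vectors whose `i`-th and `j`-th coordinates lie in `P ^ u` and `P ^ v`. -/
def coordLattice (P : Ideal R) (i j : Fin 3) (u v : ℕ) : Submodule R (Fin 3 → R) where
  carrier := {y | y i ∈ P ^ u ∧ y j ∈ P ^ v}
  add_mem' := fun h h' ↦ ⟨add_mem h.1 h'.1, add_mem h.2 h'.2⟩
  zero_mem' := by simp
  smul_mem' := fun c _ h ↦ ⟨Ideal.mul_mem_left _ c h.1, Ideal.mul_mem_left _ c h.2⟩

theorem mem_coordLattice {P : Ideal R} {i j : Fin 3} {u v : ℕ} {y : Fin 3 → R} :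
    y ∈ coordLattice P i j u v ↔ y i ∈ P ^ u ∧ y j ∈ P ^ v := Iff.rfl

theorem finite_quotient_of_forall_mem {I : Ideal R} [Finite (R ⧸ I)]
    {L : Submodule R (Fin 3 → R)} (hL : ∀ y : Fin 3 → R, (∀ i, y i ∈ I) → y ∈ L) :
    Finite ((Fin 3 → R) ⧸ L.toAddSubgroup) := by
  refine Finite.of_surjective
    (fun q : Fin 3 → R ⧸ I ↦
      (QuotientAddGroup.mk (fun i ↦ (q i).out) : (Fin 3 → R) ⧸ L.toAddSubgroup)) fun y ↦ ?_
  obtain ⟨y, rfl⟩ := QuotientAddGroup.mk_surjective y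
  refine ⟨fun i ↦ Ideal.Quotient.mk I (y i), ?_⟩
  rw [QuotientAddGroup.eq]
  refine hL _ fun i ↦ ?_
  rw [← Ideal.Quotient.eq_zero_iff_mem]
  have : Ideal.Quotient.mk I (Quotient.out (Ideal.Quotient.mk I (y i))) =
      Ideal.Quotient.mk I (y i) := Quotient.out_eq _
  simp only [Pi.add_apply, Pi.neg_apply, map_add, map_neg, this, neg_add_cancel]

theorem index_inf_eq_mul {I J : Ideal R} (hIJ : IsCoprime I J) {L M : Submodule R (Fin 3 → R)}
    (hL : ∀ y : Fin 3 → R, (∀ i, y i ∈ I) → y ∈ L)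
    (hM : ∀ y : Fin 3 → R, (∀ i, y i ∈ J) → y ∈ M) :
    (L ⊓ M).toAddSubgroup.index = L.toAddSubgroup.index * M.toAddSubgroup.index := by
  have hsup : M.toAddSubgroup ⊔ L.toAddSubgroup = ⊤ := by
    rw [eq_top_iff]
    intro y _
    obtain ⟨u, hu, v, hv, huv⟩ := Ideal.isCoprime_iff_exists.1 hIJ
    have h : y = v • y + u • y := by rw [← add_smul, add_comm v, huv, one_smul]
    rw [h]
    exact add_mem (AddSubgroup.mem_sup_left (hM _ fun i ↦ Ideal.mul_mem_right _ _ hv))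
      (AddSubgroup.mem_sup_right (hL _ fun i ↦ Ideal.mul_mem_right _ _ hu))
  have hinf : (L ⊓ M).toAddSubgroup = L.toAddSubgroup ⊓ M.toAddSubgroup := rfl
  rw [hinf, ← AddSubgroup.relIndex_mul_index inf_le_right, AddSubgroup.inf_relIndex_right,
    ← AddSubgroup.relIndex_sup_right M.toAddSubgroup L.toAddSubgroup, hsup,
    AddSubgroup.relIndex_top_right]

theorem card_mul_card_le_index {I U V : Ideal R} [Finite (R ⧸ I)]
    {L : Submodule R (Fin 3 → R)} (hL : ∀ y : Fin 3 → R, (∀ i, y i ∈ I) → y ∈ L) {i j : Fin 3}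
    (hij : i ≠ j) (hU : ∀ y ∈ L, y j ∈ U) (hV : ∀ y ∈ L, y j = 0 → y i ∈ V) :
    Nat.card (R ⧸ U) * Nat.card (R ⧸ V) ≤ L.toAddSubgroup.index := by
  have := finite_quotient_of_forall_mem hL
  rw [← Nat.card_prod, AddSubgroup.index]
  refine Nat.card_le_card_of_injective
    (fun q : (R ⧸ U) × (R ⧸ V) ↦
      (QuotientAddGroup.mk (Function.update (Function.update 0 j q.1.out) i q.2.out) :
        (Fin 3 → R) ⧸ L.toAddSubgroup)) ?_
  rintro ⟨u, v⟩ ⟨u', v'⟩ h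
  rw [QuotientAddGroup.eq] at h
  have hu : u = u' := by
    have := hU _ h
    simp only [Pi.add_apply, Pi.neg_apply, Function.update_of_ne hij.symm,
      Function.update_self] at this
    rw [← Quotient.out_eq u, ← Quotient.out_eq u']
    exact (QuotientAddGroup.eq (s := U.toAddSubgroup)).2 this
  subst hu
  have hv : v = v' := by
    have := hV _ h (by simp [Function.update_of_ne hij.symm])
    simp only [Pi.add_apply, Pi.neg_apply, Function.update_self] at this
    rw [← Quotient.out_eq v, ← Quotient.out_eq v']
    exact (QuotientAddGroup.eq (s := V.toAddSubgroup)).2 this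
  rw [hv]

end Lattice

section Local

variable {R : Type*} [CommRing R] [IsDedekindDomain R] {P : Ideal R}

/-- The pair `(x, y)` has orders `(a, b)` and solves the binary congruence
`c x ^ t + c' y ^ t ≡ 0` modulo `P ^ γ`. -/
structure IsBinarySolution (P : Ideal R) (t : ℕ) (c c' : R) (γ a b : ℕ) (x y : R) : Prop where
  left : HasOrd P x a
  right : HasOrd P y b
  mem : c * x ^ t + c' * y ^ t ∈ P ^ γ

theorem IsBinarySolution.cross_pow_sub_mem (hP : Prime P) {t : ℕ} {c c' : R} {α γ a b : ℕ}
    {x y z w : R} (hc : HasOrd P c α) (hxy : IsBinarySolution P t c c' γ a b x y)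
    (hzw : IsBinarySolution P t c c' γ a b z w) {n : ℕ} (hn : α + n ≤ γ + t * b) :
    (x * w) ^ t - (z * y) ^ t ∈ P ^ n := by
  refine hc.mem_of_mul_mem hP (Ideal.pow_le_pow_right hn ?_)
  have h1 := Ideal.mul_mem_mul hxy.mem (hzw.right.pow hP t).1
  have h2 := Ideal.mul_mem_mul hzw.mem (hxy.right.pow hP t).1
  rw [← pow_add] at h1 h2
  have := sub_mem h1 h2
  rwa [show (c * x ^ t + c' * y ^ t) * w ^ t - (c * z ^ t + c' * w ^ t) * y ^ t =
    c * ((x * w) ^ t - (z * y) ^ t) by ring] at this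

/-- Two solutions with close ratios have much closer ratios. -/
theorem IsBinarySolution.cross_sub_mem (hP : Prime P) {t : ℕ} (ht : 1 ≤ t) {c c' : R}
    {α β γ a b e : ℕ} {x y z w : R} (hc : HasOrd P c α) (he : HasOrd P (t : R) e)
    (hm : α + t * a = β + t * b)
    (hxy : IsBinarySolution P t c c' γ a b x y) (hzw : IsBinarySolution P t c c' γ a b z w)
    (h : x * w - z * y ∈ P ^ (a + b + (e + 1))) :
    x * w - z * y ∈ P ^ (a + b + (γ - (β + t * b)) - e) := by
  by_cases hlt : a + b + (γ - (β + t * b)) < e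
  · rw [Nat.sub_eq_zero_of_le hlt.le]; simp
  by_cases hγ : γ < β + t * b
  · refine Ideal.pow_le_pow_right ?_ h
    omega
  refine sub_mem_of_pow_sub_pow_mem hP ht he (hxy.left.mul hP hzw.right).1
    (hzw.left.mul hP hxy.right) h (hxy.cross_pow_sub_mem hP hc hzw ?_)
  obtain ⟨t, rfl⟩ := Nat.exists_eq_add_of_le' ht
  obtain ⟨D, rfl⟩ := Nat.exists_eq_add_of_le (not_lt.1 hγ)
  simp only [Nat.add_sub_cancel, Nat.add_sub_cancel_left] at *
  obtain ⟨E, hE⟩ := Nat.exists_eq_add_of_le (not_lt.1 hlt)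
  rw [hE, Nat.add_sub_cancel_left]
  nlinarith

theorem exists_ceil_div {t β γ : ℕ} (ht : 1 ≤ t) (h : β ≤ γ) :
    ∃ B, γ ≤ β + t * B ∧ β + t * B + 1 ≤ γ + t := by
  refine ⟨(γ - β + (t - 1)) / t, ?_, ?_⟩
  · have := Nat.lt_mul_div_succ (γ - β + (t - 1)) ht
    rw [mul_add, mul_one] at this
    omega
  · have := Nat.mul_div_le (γ - β + (t - 1)) t
    omega

/-- If the sum of two terms is divisible by `P ^ γ` and the second is not, then both terms have
the same order, which is less than `γ`. -/
theorem exists_isBinarySolution (hP : Prime P) {t : ℕ} (ht : 1 ≤ t) {c c' x y : R}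
    {α β γ B : ℕ} (hc : HasOrd P c α) (hc' : HasOrd P c' β) (hB : β + t * B + 1 ≤ γ + t)
    (h : c * x ^ t + c' * y ^ t ∈ P ^ γ) (hy : y ∉ P ^ B) :
    ∃ a b, IsBinarySolution P t c c' γ a b x y ∧ α + t * a = β + t * b ∧ β + t * b < γ := by
  have hy0 : y ≠ 0 := fun h0 ↦ hy (h0 ▸ zero_mem _)
  obtain ⟨b, hb⟩ := exists_hasOrd hP hy0
  have hbB := hb.lt_of_notMem hy
  have hbγ : β + t * b < γ := by
    obtain ⟨u, rfl⟩ := Nat.exists_eq_add_of_lt hbB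
    nlinarith
  have hcy := hc'.mul hP (hb.pow hP t)
  have hcx : HasOrd P (-(c * x ^ t)) (β + t * b) := by
    have := hcy.add_of_mem (y := -(c * x ^ t + c' * y ^ t))
      (Ideal.pow_le_pow_right hbγ (neg_mem h))
    rwa [show c' * y ^ t + -(c * x ^ t + c' * y ^ t) = -(c * x ^ t) by ring] at this
  have hx0 : x ≠ 0 := by
    rintro rfl
    refine hcx.ne_zero ?_
    rw [zero_pow (by omega), mul_zero, neg_zero]
  obtain ⟨a, ha⟩ := exists_hasOrd hP hx0
  have hcx' := hc.mul hP (ha.pow hP t)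
  have heq : α + t * a = β + t * b := by
    refine hcx'.unique ⟨?_, fun h' ↦ hcx.2 (neg_mem h')⟩
    simpa using neg_mem hcx.1
  exact ⟨a, b, ⟨ha, hb, h⟩, heq, hbγ⟩

variable [Module.Free ℤ R]

theorem card_quotient_pow (P : Ideal R) (n : ℕ) :
    Nat.card (R ⧸ P ^ n) = Ideal.absNorm P ^ n := by
  rw [← map_pow, Ideal.absNorm_apply, Submodule.cardQuot_apply]

variable [Module.Finite ℤ R]

theorem finite_quotient_pow (hP : Prime P) (n : ℕ) : Finite (R ⧸ P ^ n) :=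
  Ideal.finiteQuotientOfFreeOfNeBot _ (pow_ne_zero n hP.ne_zero)

theorem one_le_absNorm (hP : Prime P) : 1 ≤ Ideal.absNorm P := by
  have := finite_quotient_pow hP 1
  have h := card_quotient_pow P 1
  rw [pow_one (Ideal.absNorm P)] at h
  rw [← h]
  exact Nat.card_pos

theorem ncard_approx_roots_le (hP : Prime P) {t : ℕ} (ht : 1 ≤ t) (e : ℕ) :
    {r : R ⧸ P ^ (e + 1) | e = 0 → r ^ t = 1}.ncard ≤ t * Ideal.absNorm P ^ (2 * e) := by
  classical
  have := finite_quotient_pow hP (e + 1)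
  rcases Nat.eq_zero_or_pos e with rfl | he
  · have : (P ^ (0 + 1)).IsPrime := by
      rw [zero_add, pow_one]; exact Ideal.isPrime_of_prime hP
    have hsub : {r : R ⧸ P ^ (0 + 1) | 0 = 0 → r ^ t = 1} ⊆
        ((Polynomial.nthRoots t (1 : R ⧸ P ^ (0 + 1))).toFinset : Set (R ⧸ P ^ (0 + 1))) := by
      intro r hr
      simpa [Polynomial.mem_nthRoots ht] using hr
    refine (Set.ncard_le_ncard hsub (Finset.finite_toSet _)).trans ?_
    rw [Set.ncard_coe_finset]
    simpa using (Multiset.toFinset_card_le _).trans (Polynomial.card_nthRoots t 1)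
  · calc _ ≤ (Set.univ : Set (R ⧸ P ^ (e + 1))).ncard := Set.ncard_le_ncard (Set.subset_univ _)
      _ = Ideal.absNorm P ^ (e + 1) := by rw [Set.ncard_univ, card_quotient_pow]
      _ ≤ Ideal.absNorm P ^ (2 * e) := Nat.pow_le_pow_right (one_le_absNorm hP) (by omega)
      _ ≤ t * Ideal.absNorm P ^ (2 * e) := Nat.le_mul_of_pos_left _ ht

/-- Binary solutions fall into at most `t N(P) ^ (2 e)` classes of close ratios. -/
theorem exists_ratio_class (hP : Prime P) {t : ℕ} (ht : 1 ≤ t) {c c' : R}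
    {α β γ a b : ℕ} (e : ℕ) (hc : HasOrd P c α) (hm : α + t * a = β + t * b)
    (hγ : β + t * b < γ) :
    ∃ (T : Set (R ⧸ P ^ (e + 1))) (f : R → R → R ⧸ P ^ (e + 1)),
      T.ncard ≤ t * Ideal.absNorm P ^ (2 * e) ∧
      (∀ x y, IsBinarySolution P t c c' γ a b x y → f x y ∈ T) ∧
      ∀ x y x' y', IsBinarySolution P t c c' γ a b x y → IsBinarySolution P t c c' γ a b x' y' →
        f x y = f x' y' → x * y' - x' * y ∈ P ^ (a + b + (e + 1)) := by
  by_cases hne : ∃ z w, IsBinarySolution P t c c' γ a b z w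
  swap
  · refine ⟨∅, fun _ _ ↦ 0, by simp, fun x y h ↦ (hne ⟨x, y, h⟩).elim,
      fun x y _ _ h ↦ (hne ⟨x, y, h⟩).elim⟩
  obtain ⟨z, w, hzw⟩ := hne
  have hex : ∀ x y, ∃ r, IsBinarySolution P t c c' γ a b x y →
      x * w - r * (z * y) ∈ P ^ (a + b + (e + 1)) := by
    intro x y
    by_cases h : IsBinarySolution P t c c' γ a b x y
    · obtain ⟨r, hr⟩ := exists_sub_mul_mem hP (hzw.left.mul hP h.right)
        (h.left.mul hP hzw.right).1 (e + 1)
      exact ⟨r, fun _ ↦ hr⟩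
    · exact ⟨0, fun h' ↦ (h h').elim⟩
  choose r hr using hex
  refine ⟨_, fun x y ↦ Ideal.Quotient.mk _ (r x y), ncard_approx_roots_le hP ht e, ?_, ?_⟩
  · rintro x y h rfl
    rw [← map_pow, ← map_one (Ideal.Quotient.mk _), Ideal.Quotient.eq]
    have hB := (hzw.left.mul hP h.right).pow hP t
    refine hB.mem_of_mul_mem hP ?_
    have h1 := h.cross_pow_sub_mem hP hc hzw (n := t * (a + b) + (0 + 1)) (by nlinarith)
    have h2 := pow_sub_pow_mem (h.left.mul hP hzw.right).1
      (Ideal.mul_mem_left _ (r x y) (hzw.left.mul hP h.right).1) (hr x y h) t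
    have := sub_mem h1 (by rwa [mul_comm (a + b)] at h2)
    rwa [show (x * w) ^ t - (z * y) ^ t - ((x * w) ^ t - (r x y * (z * y)) ^ t) =
      (z * y) ^ t * (r x y ^ t - 1) by ring] at this
  · intro x y x' y' h h' hf
    rw [Ideal.Quotient.eq] at hf
    refine hzw.right.mem_of_mul_mem hP ?_
    have h1 := Ideal.mul_mem_mul (hr x y h) h'.right.1
    have h2 := Ideal.mul_mem_mul (hr x' y' h') h.right.1
    have h3 := Ideal.mul_mem_mul hf ((hzw.left.mul hP h.right).mul hP h'.right).1
    rw [← pow_add] at h1 h2 h3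
    rw [show b + (a + b + (e + 1)) = a + b + (e + 1) + b by ring]
    rw [show e + 1 + (a + b + b) = a + b + (e + 1) + b by ring] at h3
    have := add_mem (sub_mem h1 h2) h3
    rwa [show (x * w - r x y * (z * y)) * y' - (x' * w - r x' y' * (z * y')) * y +
      (r x y - r x' y') * (z * y * y') = w * (x * y' - x' * y) by ring] at this

theorem exists_ratio_family (hP : Prime P) {t : ℕ} (ht : 1 ≤ t) {c c' : R} {i j : Fin 3}
    (hij : i ≠ j) {α β γ p b e : ℕ} (he : HasOrd P (t : R) e) (hc : HasOrd P c α)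
    (hm : α + t * p = β + t * b) (hγ : β + t * b < γ) :
    ∃ 𝓕 : Finset (Submodule R (Fin 3 → R)), 𝓕.card ≤ t * Ideal.absNorm P ^ (2 * e) ∧
      (∀ Γ ∈ 𝓕,
        (∀ y : Fin 3 → R, y i ∈ P ^ (p + (γ - (β + t * b))) →
          y j ∈ P ^ (b + (γ - (β + t * b))) → y ∈ Γ) ∧
        Ideal.absNorm P ^ (p + b + (γ - (β + t * b))) ≤
          Γ.toAddSubgroup.index * Ideal.absNorm P ^ e) ∧
      ∀ y : Fin 3 → R, IsBinarySolution P t c c' γ p b (y i) (y j) → ∃ Γ ∈ 𝓕, y ∈ Γ := by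
  obtain ⟨T, f, hT, hfT, hf⟩ := exists_ratio_class (c' := c') hP ht e hc hm hγ
  have := finite_quotient_pow hP (e + 1)
  generalize hD : γ - (β + t * b) = D
  let S : Set (Fin 3 → R) := {y | IsBinarySolution P t c c' γ p b (y i) (y j)}
  let F : (Fin 3 → R) → R ⧸ P ^ (e + 1) := fun y ↦ f (y i) (y j)
  obtain ⟨s, hsS, hs⟩ := Set.exists_subset_bijOn S F
  have hFT : F '' S ⊆ T := by
    rintro _ ⟨y, hy, rfl⟩
    exact hfT _ _ hy
  have hsfin : s.Finite := Set.Finite.of_finite_image (Set.toFinite _) hs.injOn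
  let Λ : (Fin 3 → R) → Submodule R (Fin 3 → R) :=
    fun x ↦ ratioLattice P i j (x i) (x j) b (p + b + D - e)
  have hΛ : (Λ '' s).Finite := hsfin.image Λ
  refine ⟨hΛ.toFinset, ?_, ?_, ?_⟩
  · rw [← Set.ncard_eq_toFinset_card _ hΛ]
    calc _ ≤ s.ncard := Set.ncard_image_le hsfin
      _ = (F '' S).ncard := by rw [← hs.image_eq, hs.injOn.ncard_image]
      _ ≤ T.ncard := Set.ncard_le_ncard hFT (Set.toFinite _)
      _ ≤ _ := hT
  · intro Γ hΓ
    obtain ⟨x, hx, rfl⟩ := hΛ.mem_toFinset.1 hΓ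
    have hxS : IsBinarySolution P t c c' γ p b (x i) (x j) := hsS hx
    have hmem : ∀ y : Fin 3 → R, y i ∈ P ^ (p + D) → y j ∈ P ^ (b + D) → y ∈ Λ x := by
      intro y hyi hyj
      refine mem_ratioLattice.2 ⟨Ideal.pow_le_pow_right (by omega) hyj, ?_⟩
      have h1 := Ideal.mul_mem_mul hyi hxS.right.1
      have h2 := Ideal.mul_mem_mul hxS.left.1 hyj
      rw [← pow_add] at h1 h2
      exact sub_mem (Ideal.pow_le_pow_right (by omega) h1) (Ideal.pow_le_pow_right (by omega) h2)
    refine ⟨hmem, ?_⟩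
    have := finite_quotient_pow hP (p + b + D)
    have hidx := card_mul_card_le_index (I := P ^ (p + b + D)) (L := Λ x) (i := i) (j := j)
      (U := P ^ b) (V := P ^ (p + b + D - e - b))
      (fun y hy ↦ hmem y (Ideal.pow_le_pow_right (by omega) (hy i))
        (Ideal.pow_le_pow_right (by omega) (hy j))) hij
      (fun y hy ↦ (mem_ratioLattice.1 hy).1) (fun y hy hy0 ↦ by
        have h := (mem_ratioLattice.1 hy).2
        rw [hy0, mul_zero, sub_zero, mul_comm] at h
        by_cases hb : p + b + D - e < b
        · rw [Nat.sub_eq_zero_of_le hb.le]; simp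
        · refine hxS.right.mem_of_mul_mem hP ?_
          rwa [Nat.add_sub_cancel' (not_lt.1 hb)])
    rw [card_quotient_pow, card_quotient_pow, ← pow_add] at hidx
    calc _ ≤ Ideal.absNorm P ^ (b + (p + b + D - e - b) + e) :=
          Nat.pow_le_pow_right (one_le_absNorm hP) (by omega)
      _ ≤ _ := by rw [pow_add]; exact Nat.mul_le_mul_right _ hidx
  · intro y hy
    obtain ⟨x, hx, hxy⟩ : F y ∈ F '' s := hs.image_eq ▸ ⟨y, hy, rfl⟩
    have hxS : IsBinarySolution P t c c' γ p b (x i) (x j) := hsS hx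
    refine ⟨Λ x, hΛ.mem_toFinset.2 ⟨x, hx, rfl⟩, mem_ratioLattice.2 ⟨hy.right.1, ?_⟩⟩
    rw [← hD]
    exact hy.cross_sub_mem hP ht hc he hm hxS (hf _ _ _ _ hy hxS hxy.symm)

theorem exists_level_family (hP : Prime P) {t : ℕ} (ht : 1 ≤ t) {c c' : R} {i j : Fin 3}
    (hij : i ≠ j) {α β γ e : ℕ} (he : HasOrd P (t : R) e) (hc : HasOrd P c α) (b : ℕ) :
    ∃ 𝓕 : Finset (Submodule R (Fin 3 → R)), 𝓕.card ≤ t * Ideal.absNorm P ^ (2 * e) ∧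
      (∀ Γ ∈ 𝓕, ∃ p, α + t * p = β + t * b ∧ β + t * b < γ ∧
        (∀ y : Fin 3 → R, y i ∈ P ^ (p + (γ - (β + t * b))) →
          y j ∈ P ^ (b + (γ - (β + t * b))) → y ∈ Γ) ∧
        Ideal.absNorm P ^ (p + b + (γ - (β + t * b))) ≤
          Γ.toAddSubgroup.index * Ideal.absNorm P ^ e) ∧
      ∀ (p : ℕ) (y : Fin 3 → R), α + t * p = β + t * b → β + t * b < γ →
        IsBinarySolution P t c c' γ p b (y i) (y j) → ∃ Γ ∈ 𝓕, y ∈ Γ := by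
  by_cases h : ∃ p, α + t * p = β + t * b ∧ β + t * b < γ
  · obtain ⟨p, hp, hγ⟩ := h
    obtain ⟨𝓕, h1, h2, h3⟩ := exists_ratio_family (c' := c') hP ht hij he hc hp hγ
    refine ⟨𝓕, h1, fun Γ hΓ ↦ ⟨p, hp, hγ, h2 Γ hΓ⟩, fun p' y hp' _ hy ↦ h3 y ?_⟩
    have : t * p' = t * p := by omega
    rwa [Nat.eq_of_mul_eq_mul_left ht this] at hy
  · exact ⟨∅, by simp, by simp, fun p y hp hγ _ ↦ (h ⟨p, hp, hγ⟩).elim⟩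

theorem norm_pow_le_of_le (hP : Prime P) {t e E r s m : ℕ}
    (h : Ideal.absNorm P ^ E ≤ m * Ideal.absNorm P ^ e) (hE : 2 * r ≤ t * E + 3 * s) :
    (Ideal.absNorm P ^ r) ^ 2 ≤
      m ^ t * ((Ideal.absNorm P ^ s) ^ 3 * ((Ideal.absNorm P ^ e) ^ 2) ^ t) := by
  have hN := one_le_absNorm hP
  calc (Ideal.absNorm P ^ r) ^ 2 = Ideal.absNorm P ^ (2 * r) := by rw [← pow_mul, mul_comm]
    _ ≤ Ideal.absNorm P ^ (t * E + 3 * s) := Nat.pow_le_pow_right hN hE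
    _ = (Ideal.absNorm P ^ E) ^ t * (Ideal.absNorm P ^ s) ^ 3 := by
      rw [pow_add, ← pow_mul, ← pow_mul, mul_comm E, mul_comm s]
    _ ≤ (m * Ideal.absNorm P ^ e) ^ t * (Ideal.absNorm P ^ s) ^ 3 :=
      Nat.mul_le_mul_right _ (Nat.pow_le_pow_left h t)
    _ = m ^ t * ((Ideal.absNorm P ^ s) ^ 3 * (Ideal.absNorm P ^ e) ^ t) := by
      rw [mul_pow]; ring
    _ ≤ _ := by
      refine Nat.mul_le_mul_left _ (Nat.mul_le_mul_left _ (Nat.pow_le_pow_left ?_ t))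
      exact Nat.le_self_pow two_ne_zero _

/-- The covering at a single prime `P` dividing the discriminant. -/
theorem exists_local_family (hP : Prime P) {t : ℕ} (ht : 2 ≤ t) {a : Fin 3 → R} {i j l : Fin 3}
    (hij : i ≠ j) {α β γ e : ℕ} (he : HasOrd P (t : R) e) (hα : HasOrd P (a i) α)
    (hβ : HasOrd P (a j) β) (hγ : HasOrd P (a l) γ) (hαβ : α ≤ β) (hβγ : β ≤ γ) (hγ1 : 1 ≤ γ) :
    ∃ 𝓕 : Finset (Submodule R (Fin 3 → R)),
      𝓕.card ≤ (Ideal.absNorm P ^ e) ^ 3 * (α + β + γ + t - 1) ∧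
      (∀ Γ ∈ 𝓕, (∃ n, ∀ y : Fin 3 → R, (∀ i, y i ∈ P ^ n) → y ∈ Γ) ∧
        (Ideal.absNorm P ^ (α + β + γ)) ^ 2 ≤ Γ.toAddSubgroup.index ^ t *
          ((Ideal.absNorm P ^ (α + β)) ^ 3 * ((Ideal.absNorm P ^ e) ^ 2) ^ t)) ∧
      ∀ y : Fin 3 → R, a i * y i ^ t + a j * y j ^ t + a l * y l ^ t = 0 → ∃ Γ ∈ 𝓕, y ∈ Γ := by
  classical
  have ht1 : 1 ≤ t := by omega
  obtain ⟨A, hA, hA'⟩ := exists_ceil_div ht1 (hαβ.trans hβγ)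
  obtain ⟨B, hB, hB'⟩ := exists_ceil_div ht1 hβγ
  choose 𝓖 h𝓖card h𝓖 h𝓖cov using fun b ↦
    exists_level_family (c' := a j) (β := β) (γ := γ) hP ht1 hij he hα b
  set M := Ideal.absNorm P ^ (2 * e) with hM
  have hM1 : 1 ≤ M := Nat.one_le_pow _ _ (one_le_absNorm hP)
  have hMle : M ≤ (Ideal.absNorm P ^ e) ^ 3 := by
    rw [← pow_mul]; exact Nat.pow_le_pow_right (one_le_absNorm hP) (by omega)
  have hcard : ∀ n, ((Finset.range n).biUnion 𝓖).card ≤ M * (t * n) := by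
    intro n
    refine (Finset.card_biUnion_le_card_mul _ _ (t * M) fun b _ ↦ h𝓖card b).trans ?_
    rw [Finset.card_range]
    exact le_of_eq (by ring)
  have hprop : ∀ Γ ∈ insert (coordLattice P i j A B) ((Finset.range B).biUnion 𝓖),
      (∃ n, ∀ y : Fin 3 → R, (∀ i, y i ∈ P ^ n) → y ∈ Γ) ∧
        (Ideal.absNorm P ^ (α + β + γ)) ^ 2 ≤ Γ.toAddSubgroup.index ^ t *
          ((Ideal.absNorm P ^ (α + β)) ^ 3 * ((Ideal.absNorm P ^ e) ^ 2) ^ t) := by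
    intro Γ hΓ
    rcases Finset.mem_insert.1 hΓ with rfl | hΓ
    · have hmem : ∀ y : Fin 3 → R, (∀ i, y i ∈ P ^ (A + B)) → y ∈ coordLattice P i j A B :=
        fun y hy ↦ mem_coordLattice.2 ⟨Ideal.pow_le_pow_right (by omega) (hy i),
          Ideal.pow_le_pow_right (by omega) (hy j)⟩
      refine ⟨⟨_, hmem⟩, norm_pow_le_of_le hP (E := A + B) ?_ ?_⟩
      · have := finite_quotient_pow hP (A + B)
        have hidx := card_mul_card_le_index hmem hij (fun y hy ↦ (mem_coordLattice.1 hy).2)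
          (fun y hy _ ↦ (mem_coordLattice.1 hy).1)
        rw [card_quotient_pow, card_quotient_pow, ← pow_add, add_comm B] at hidx
        exact hidx.trans (Nat.le_mul_of_pos_right _ (Nat.pow_pos (one_le_absNorm hP)))
      · rw [mul_add t]; omega
    · obtain ⟨b, -, hb⟩ := Finset.mem_biUnion.1 hΓ
      obtain ⟨p, hp, hlt, hmem, hidx⟩ := h𝓖 b Γ hb
      refine ⟨⟨p + b + (γ - (β + t * b)), fun y hy ↦ hmem y
        (Ideal.pow_le_pow_right (by omega) (hy i)) (Ideal.pow_le_pow_right (by omega) (hy j))⟩,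
        norm_pow_le_of_le hP hidx ?_⟩
      have := Nat.mul_le_mul_right (γ - (β + t * b)) ht
      rw [mul_add t, mul_add t]
      omega
  have hcov : ∀ y : Fin 3 → R, a i * y i ^ t + a j * y j ^ t + a l * y l ^ t = 0 →
      y ∈ coordLattice P i j A B ∨ ∃ Γ ∈ (Finset.range B).biUnion 𝓖, y ∈ Γ := by
    intro y hy
    have hmem : a i * y i ^ t + a j * y j ^ t ∈ P ^ γ := by
      have := neg_mem (Ideal.mul_mem_right (y l ^ t) _ hγ.1)
      rwa [← eq_neg_of_add_eq_zero_left hy] at this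
    by_cases h : y ∈ coordLattice P i j A B
    · exact Or.inl h
    right
    have hsol : ∃ p b, IsBinarySolution P t (a i) (a j) γ p b (y i) (y j) ∧
        α + t * p = β + t * b ∧ β + t * b < γ := by
      by_cases hyj : y j ∈ P ^ B
      · have hyi : y i ∉ P ^ A := fun hyi ↦ h (mem_coordLattice.2 ⟨hyi, hyj⟩)
        obtain ⟨b, p, hs, heq, hlt⟩ :=
          exists_isBinarySolution hP ht1 hβ hα hA' (by rwa [add_comm]) hyi
        exact ⟨p, b, ⟨hs.right, hs.left, hmem⟩, heq.symm, heq ▸ hlt⟩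
      · exact exists_isBinarySolution hP ht1 hα hβ hB' hmem hyj
    obtain ⟨p, b, hs, heq, hlt⟩ := hsol
    obtain ⟨Γ, hΓ, hyΓ⟩ := h𝓖cov b p y heq hlt hs
    have hbB : b < B := by
      by_contra hbB
      have := Nat.mul_le_mul_left t (not_lt.1 hbB)
      omega
    exact ⟨Γ, Finset.mem_biUnion.2 ⟨b, Finset.mem_range.2 hbB, hΓ⟩, hyΓ⟩
  by_cases hmerge : β = 0 ∧ t * B = γ + t - 1
  · obtain ⟨rfl, htB⟩ := hmerge
    obtain rfl : α = 0 := by omega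
    obtain ⟨B, rfl⟩ : ∃ B', B = B' + 1 := Nat.exists_eq_succ_of_ne_zero (by rintro rfl; omega)
    rw [mul_add, mul_one] at htB
    have hAB : A = B + 1 := by
      have h1 : t * A < t * (B + 2) := by rw [mul_add]; omega
      have h2 : t * B < t * A := by omega
      have := Nat.lt_of_mul_lt_mul_left h1
      have := Nat.lt_of_mul_lt_mul_left h2
      omega
    subst hAB
    rcases (𝓖 B).eq_empty_or_nonempty with hemp | ⟨Γ₀, hΓ₀⟩
    · have hsub : (Finset.range (B + 1)).biUnion 𝓖 = (Finset.range B).biUnion 𝓖 := by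
        rw [Finset.range_add_one, Finset.biUnion_insert, hemp, Finset.empty_union]
      refine ⟨_, ?_, hprop, fun y hy ↦ ?_⟩
      · refine (Finset.card_insert_le _ _).trans ?_
        rw [hsub]
        calc _ ≤ M * (t * B) + M := Nat.add_le_add (hcard B) hM1
          _ = M * (t * B + 1) := by ring
          _ ≤ _ := Nat.mul_le_mul hMle (by omega)
      · rcases hcov y hy with h | ⟨Γ, hΓ, h⟩
        · exact ⟨_, Finset.mem_insert_self _ _, h⟩
        · exact ⟨Γ, Finset.mem_insert_of_mem hΓ, h⟩
    · refine ⟨(Finset.range (B + 1)).biUnion 𝓖, ?_,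
        fun Γ hΓ ↦ hprop Γ (Finset.mem_insert_of_mem hΓ), fun y hy ↦ ?_⟩
      · refine (hcard _).trans (Nat.mul_le_mul hMle ?_)
        rw [mul_add]; omega
      · rcases hcov y hy with h | h
        · refine ⟨Γ₀, Finset.mem_biUnion.2 ⟨B, Finset.self_mem_range_succ B, hΓ₀⟩, ?_⟩
          obtain ⟨p, hp, -, hmem, -⟩ := h𝓖 B Γ₀ hΓ₀
          have hpB : p = B := Nat.eq_of_mul_eq_mul_left ht1 (by omega)
          have hD : γ - (0 + t * B) = 1 := by omega
          rw [hD, hpB] at hmem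
          exact hmem y h.1 h.2
        · exact h
  · refine ⟨_, ?_, hprop, fun y hy ↦ ?_⟩
    · refine (Finset.card_insert_le _ _).trans ?_
      calc _ ≤ M * (t * B) + M := Nat.add_le_add (hcard B) hM1
        _ = M * (t * B + 1) := by ring
        _ ≤ _ := Nat.mul_le_mul hMle (by omega)
    · rcases hcov y hy with h | ⟨Γ, hΓ, h⟩
      · exact ⟨_, Finset.mem_insert_self _ _, h⟩
      · exact ⟨Γ, Finset.mem_insert_of_mem hΓ, h⟩

end Local

section Global

variable {R : Type*} [CommRing R]

/-- Local coverings at finitely many maximal ideals combine to a global one. -/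
theorem exists_family_of_local (X : Set (Fin 3 → R)) (t : ℕ) (c l w : Ideal R → ℕ)
    (S : Finset (Ideal R)) (hS : ∀ P ∈ S, P.IsMaximal)
    (hloc : ∀ P ∈ S, ∃ 𝓕 : Finset (Submodule R (Fin 3 → R)), 𝓕.card ≤ c P ∧
      (∀ Γ ∈ 𝓕, (∃ n, ∀ y : Fin 3 → R, (∀ i, y i ∈ P ^ n) → y ∈ Γ) ∧
        l P ≤ Γ.toAddSubgroup.index ^ t * w P) ∧
      ∀ y ∈ X, ∃ Γ ∈ 𝓕, y ∈ Γ) :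
    ∃ 𝓕 : Finset (Submodule R (Fin 3 → R)), 𝓕.card ≤ ∏ P ∈ S, c P ∧
      (∀ Γ ∈ 𝓕, (∃ n : Ideal R → ℕ, ∀ y : Fin 3 → R, (∀ i, y i ∈ ∏ P ∈ S, P ^ n P) → y ∈ Γ) ∧
        ∏ P ∈ S, l P ≤ Γ.toAddSubgroup.index ^ t * ∏ P ∈ S, w P) ∧
      ∀ y ∈ X, ∃ Γ ∈ 𝓕, y ∈ Γ := by
  classical
  induction S using Finset.induction_on with
  | empty => exact ⟨{⊤}, by simp, by simp, by simp⟩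
  | insert P S hPS ih =>
    obtain ⟨𝓕, h𝓕c, h𝓕, h𝓕X⟩ := ih (fun Q hQ ↦ hS Q (Finset.mem_insert_of_mem hQ))
      (fun Q hQ ↦ hloc Q (Finset.mem_insert_of_mem hQ))
    obtain ⟨𝓖, h𝓖c, h𝓖, h𝓖X⟩ := hloc P (Finset.mem_insert_self _ _)
    refine ⟨(𝓖 ×ˢ 𝓕).image fun Γ ↦ Γ.1 ⊓ Γ.2, ?_, ?_, ?_⟩
    · rw [Finset.prod_insert hPS]
      refine Finset.card_image_le.trans ?_
      rw [Finset.card_product]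
      exact Nat.mul_le_mul h𝓖c h𝓕c
    · intro Γ hΓ
      obtain ⟨⟨Γ₁, Γ₂⟩, hΓ', rfl⟩ := Finset.mem_image.1 hΓ
      obtain ⟨hΓ₁, hΓ₂⟩ := Finset.mem_product.1 hΓ'
      obtain ⟨⟨n₁, hn₁⟩, hl₁⟩ := h𝓖 Γ₁ hΓ₁
      obtain ⟨⟨n₂, hn₂⟩, hl₂⟩ := h𝓕 Γ₂ hΓ₂
      have hcop : IsCoprime (P ^ n₁) (∏ Q ∈ S, Q ^ n₂ Q) := by
        refine IsCoprime.prod_right fun Q hQ ↦ IsCoprime.pow ?_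
        have := hS P (Finset.mem_insert_self _ _)
        have := hS Q (Finset.mem_insert_of_mem hQ)
        exact Ideal.isCoprime_of_isMaximal (by rintro rfl; exact hPS hQ)
      refine ⟨⟨Function.update n₂ P n₁, fun y hy ↦ ?_⟩, ?_⟩
      · have hprod : ∏ Q ∈ insert P S, Q ^ Function.update n₂ P n₁ Q =
            P ^ n₁ * ∏ Q ∈ S, Q ^ n₂ Q := by
          rw [Finset.prod_insert hPS, Function.update_self]
          congr 1
          refine Finset.prod_congr rfl fun Q hQ ↦ ?_
          rw [Function.update_of_ne (by rintro rfl; exact hPS hQ)]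
        rw [hprod] at hy
        have hle₁ : P ^ n₁ * ∏ Q ∈ S, Q ^ n₂ Q ≤ P ^ n₁ := Ideal.mul_le_left
        have hle₂ : P ^ n₁ * ∏ Q ∈ S, Q ^ n₂ Q ≤ ∏ Q ∈ S, Q ^ n₂ Q := Ideal.mul_le_right
        exact ⟨hn₁ y fun i ↦ hle₁ (hy i), hn₂ y fun i ↦ hle₂ (hy i)⟩
      · rw [Finset.prod_insert hPS, Finset.prod_insert hPS, index_inf_eq_mul hcop hn₁ hn₂, mul_pow]
        exact (Nat.mul_le_mul hl₁ hl₂).trans_eq (mul_mul_mul_comm _ _ _ _)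
    · intro y hy
      obtain ⟨Γ₁, hΓ₁, hy₁⟩ := h𝓖X y hy
      obtain ⟨Γ₂, hΓ₂, hy₂⟩ := h𝓕X y hy
      exact ⟨Γ₁ ⊓ Γ₂, Finset.mem_image.2 ⟨(Γ₁, Γ₂), Finset.mem_product.2 ⟨hΓ₁, hΓ₂⟩, rfl⟩, hy₁, hy₂⟩

theorem span_image_eq_top {k : Type*} [Field k] [Algebra R k] [FaithfulSMul R k] {I : Ideal R}
    (hI : I ≠ ⊥) {Γ : Submodule R (Fin 3 → R)}
    (hΓ : ∀ y : Fin 3 → R, (∀ i, y i ∈ I) → y ∈ Γ) :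
    Submodule.span k ((fun (y : Fin 3 → R) => fun i => algebraMap R k (y i)) ''
      (Γ : Set (Fin 3 → R))) = ⊤ := by
  obtain ⟨c, hcI, hc⟩ := Submodule.exists_mem_ne_zero_of_ne_bot hI
  rw [eq_top_iff, ← (Pi.basisFun k (Fin 3)).span_eq, Submodule.span_le]
  rintro _ ⟨m, rfl⟩
  have hmem : Pi.single m c ∈ Γ := hΓ _ fun i ↦ by
    by_cases h : i = m
    · subst h; simpa using hcI
    · simp [h]
  have hc' : algebraMap R k c ≠ 0 := by
    simpa using hc
  have hspan := Submodule.smul_mem _ (algebraMap R k c)⁻¹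
    (Submodule.subset_span (R := k) (Set.mem_image_of_mem
      (fun (y : Fin 3 → R) => fun i => algebraMap R k (y i)) hmem))
  refine (congrArg (· ∈ Submodule.span k _) (funext fun i ↦ ?_)).mpr hspan
  by_cases h : i = m
  · subst h; simp [hc']
  · simp [h]

theorem map_prod_prime_pow (S : Finset (Ideal R)) (hS : ∀ P ∈ S, P.IsMaximal)
    (hbot : ∀ P ∈ S, P ≠ ⊥) (δ : Ideal R → ℕ) (t : ℕ) (hδ_one : δ ⊤ = 1)
    (hδ_mul : ∀ I J : Ideal R, I ⊔ J = ⊤ → δ (I * J) = δ I * δ J)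
    (hδ_pp : ∀ P : Ideal R, P.IsPrime → P ≠ ⊥ → ∀ r : ℕ, 1 ≤ r → δ (P ^ r) = r + t - 1)
    (r : Ideal R → ℕ) (hr : ∀ P ∈ S, 1 ≤ r P) :
    δ (∏ P ∈ S, P ^ r P) = ∏ P ∈ S, (r P + t - 1) := by
  classical
  induction S using Finset.induction_on with
  | empty => simpa using hδ_one
  | insert P S hPS ih =>
    have hP := hS P (Finset.mem_insert_self _ _)
    rw [Finset.prod_insert hPS, Finset.prod_insert hPS, hδ_mul, hδ_pp P hP.isPrime
      (hbot P (Finset.mem_insert_self _ _)) _ (hr P (Finset.mem_insert_self _ _)),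
      ih (fun Q hQ ↦ hS Q (Finset.mem_insert_of_mem hQ))
        (fun Q hQ ↦ hbot Q (Finset.mem_insert_of_mem hQ))
        (fun Q hQ ↦ hr Q (Finset.mem_insert_of_mem hQ))]
    rw [← Ideal.isCoprime_iff_sup_eq]
    refine IsCoprime.prod_right fun Q hQ ↦ IsCoprime.pow ?_
    have := hS Q (Finset.mem_insert_of_mem hQ)
    exact Ideal.isCoprime_of_isMaximal (by rintro rfl; exact hPS hQ)

variable [IsDedekindDomain R]

theorem prod_pow_le_absNorm [Module.Free ℤ R] [Module.Finite ℤ R]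
    {S : Finset (Ideal R)} (hS : ∀ P ∈ S, P.IsMaximal) {I : Ideal R} (hI : I ≠ ⊥) {n : Ideal R → ℕ}
    (h : ∀ P ∈ S, I ≤ P ^ n P) :
    ∏ P ∈ S, Ideal.absNorm P ^ n P ≤ Ideal.absNorm I := by
  have hdvd : ∏ P ∈ S, P ^ n P ∣ I := by
    refine Finset.prod_dvd_of_coprime (fun P hP Q hQ hPQ ↦ IsCoprime.pow ?_)
      fun P hP ↦ Ideal.dvd_iff_le.2 (h P hP)
    have := hS P hP
    have := hS Q hQ
    exact Ideal.isCoprime_of_isMaximal hPQ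
  have := Ideal.absNorm_dvd_absNorm_of_le (Ideal.dvd_iff_le.1 hdvd)
  simp only [map_prod, map_pow] at this
  exact Nat.le_of_dvd (Nat.pos_of_ne_zero (Ideal.absNorm_eq_zero_iff.not.2 hI)) this

/-- A nonzero element generates the product of its prime powers. -/
theorem exists_prod_prime_pow {x : R} (hx : x ≠ 0) :
    ∃ (S : Finset (Ideal R)) (r : Ideal R → ℕ), (∀ P ∈ S, Prime P ∧ 1 ≤ r P ∧ HasOrd P x (r P)) ∧
      Ideal.span {x} = ∏ P ∈ S, P ^ r P := by
  classical
  have hx0 : Ideal.span {x} ≠ 0 := by simpa using hx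
  refine ⟨(UniqueFactorizationMonoid.normalizedFactors (Ideal.span {x})).toFinset,
    fun P ↦ (UniqueFactorizationMonoid.normalizedFactors (Ideal.span {x})).count P, ?_, ?_⟩
  · intro P hP
    have hmem := Multiset.mem_toFinset.1 hP
    have hprime := UniqueFactorizationMonoid.prime_of_normalized_factor P hmem
    refine ⟨hprime, Multiset.one_le_count_iff_mem.2 hmem, ?_⟩
    rw [hasOrd_iff, UniqueFactorizationMonoid.emultiplicity_eq_count_normalizedFactors
      hprime.irreducible hx0, normalize_eq]
  · rw [← Finset.prod_multiset_count]
    exact (associated_iff_eq.1 (UniqueFactorizationMonoid.prod_normalizedFactors hx0)).symm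

end Global

section Sorting

variable {R : Type*} [CommRing R] [IsDedekindDomain R] [Module.Free ℤ R] [Module.Finite ℤ R]
  {P : Ideal R}

theorem sum_comp_perm {M : Type*} [AddCommMonoid M] (σ : Equiv.Perm (Fin 3)) (f : Fin 3 → M) :
    f (σ 0) + f (σ 1) + f (σ 2) = f 0 + f 1 + f 2 := by
  have := Equiv.sum_comp σ f
  rwa [Fin.sum_univ_three, Fin.sum_univ_three] at this

theorem exists_local_covering (hP : Prime P) {t : ℕ} (ht : 2 ≤ t) (ht0 : (t : R) ≠ 0)
    {a : Fin 3 → R} (ha : ∀ i, a i ≠ 0) {r : ℕ} (hr : HasOrd P (a 0 * a 1 * a 2) r)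
    (hr1 : 1 ≤ r) :
    ∃ e s : ℕ, (t : R) ∈ P ^ e ∧
      (a 0 * a 1 ∈ P ^ s ∧ a 1 * a 2 ∈ P ^ s ∧ a 2 * a 0 ∈ P ^ s) ∧
      ∃ 𝓕 : Finset (Submodule R (Fin 3 → R)),
        𝓕.card ≤ (Ideal.absNorm P ^ e) ^ 3 * (r + t - 1) ∧
        (∀ Γ ∈ 𝓕, (∃ n, ∀ y : Fin 3 → R, (∀ i, y i ∈ P ^ n) → y ∈ Γ) ∧
          (Ideal.absNorm P ^ r) ^ 2 ≤ Γ.toAddSubgroup.index ^ t *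
            ((Ideal.absNorm P ^ s) ^ 3 * ((Ideal.absNorm P ^ e) ^ 2) ^ t)) ∧
        ∀ y ∈ {y : Fin 3 → R | a 0 * y 0 ^ t + a 1 * y 1 ^ t + a 2 * y 2 ^ t = 0},
          ∃ Γ ∈ 𝓕, y ∈ Γ := by
  obtain ⟨e, he⟩ := exists_hasOrd hP ht0
  choose α hα using fun i ↦ exists_hasOrd hP (ha i)
  set σ := Tuple.sort α
  have hσ : Monotone (α ∘ σ) := Tuple.monotone_sort α
  have hmax : ∀ m, α m ≤ α (σ 2) := fun m ↦ by
    simpa using hσ (Fin.le_last (σ.symm m))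
  have hsum : α 0 + α 1 + α 2 = r := (((hα 0).mul hP (hα 1)).mul hP (hα 2)).unique hr
  have hsum' : α (σ 0) + α (σ 1) + α (σ 2) = r := (sum_comp_perm σ α).trans hsum
  have hmem : ∀ m n q, α m + α n + α q = r → a m * a n ∈ P ^ (α (σ 0) + α (σ 1)) :=
    fun m n q h ↦
      Ideal.pow_le_pow_right (by have := hmax q; omega) ((hα m).mul hP (hα n)).1
  obtain ⟨𝓕, hc, hF, hX⟩ := exists_local_family hP ht (i := σ 0) (j := σ 1)
    (by simp) he (hα _) (hα _) (hα (σ 2)) (hσ (by decide)) (hσ (by decide))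
    (by have := hmax 0; have := hmax 1; have := hmax 2; omega)
  rw [hsum'] at hc hF
  refine ⟨e, α (σ 0) + α (σ 1), he.1,
    ⟨hmem 0 1 2 hsum, hmem 1 2 0 (by omega), hmem 2 0 1 (by omega)⟩,
    𝓕, hc, hF, fun y hy ↦ hX y ?_⟩
  exact (sum_comp_perm σ fun m ↦ a m * y m ^ t).trans hy

end Sorting

theorem rpow_bound_of_pow_le {t A B T m : ℕ} (ht : t ≠ 0) (hB : 0 < B) (hT : 0 < T)
    (h : A ^ 2 ≤ m ^ t * (B ^ 3 * T ^ t)) :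
    (T : ℝ)⁻¹ * (A : ℝ) ^ ((2 : ℝ) / t) / (B : ℝ) ^ ((3 : ℝ) / t) ≤ m := by
  have hB' : (0 : ℝ) < B := by exact_mod_cast hB
  have hT' : (0 : ℝ) < T := by exact_mod_cast hT
  rw [div_le_iff₀ (Real.rpow_pos_of_pos hB' _), inv_mul_le_iff₀ hT',
    ← Real.rpow_le_rpow_iff (z := t) (by positivity) (by positivity) (by positivity)]
  have ht' : (t : ℝ) ≠ 0 := by exact_mod_cast ht
  rw [← Real.rpow_mul (by positivity), div_mul_cancel₀ _ ht', Real.rpow_natCast, mul_pow, mul_pow,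
    ← Real.rpow_natCast ((B : ℝ) ^ ((3 : ℝ) / t)), ← Real.rpow_mul (by positivity),
    div_mul_cancel₀ _ ht']
  norm_num
  calc (A : ℝ) ^ 2 ≤ m ^ t * (B ^ 3 * T ^ t) := by exact_mod_cast h
    _ = _ := by ring

end FermatLattice

/-- lattice covering for Fermat-type equations:  let
`F(x) = a₁x₁^t + a₂x₂^t + a₃x₃^t` with `a₁, a₂, a₃ ∈ 𝔬` nonzero and `t ≥ 2`, let
`Δ(F) = ⟨a₁a₂a₃⟩`, `Δ₀(F) = ⟨a₁a₂, a₂a₃, a₃a₁⟩` and let `δ_t` be the multiplicative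
function on integral ideals with `δ_t(𝔭^r) = r + t − 1`.  Then the solutions `x ∈ 𝔬³`
of `F(x) = 0` are covered by at most `J ≤ t^{3d}·δ_t(Δ(F))` full (3-dimensional)
`𝔬`-lattices `Γ_j ⊆ 𝔬³`, each of determinant
`det Γ_j ≥ t^{-2d}·N(Δ(F))^{2/t}/N(Δ₀(F))^{3/t}`, where `d = [k : ℚ]`. -/
theorem fermat_lattice_covering {k : Type*} [Field k] [NumberField k]
    (t : ℕ) (ht : 2 ≤ t) (a : Fin 3 → 𝓞 k) (ha : ∀ i, a i ≠ 0)
    (δ : Ideal (𝓞 k) → ℕ)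
    (hδ_one : δ ⊤ = 1)
    (hδ_mul : ∀ I J : Ideal (𝓞 k), I ⊔ J = ⊤ → δ (I * J) = δ I * δ J)
    (hδ_pp : ∀ P : Ideal (𝓞 k), P.IsPrime → P ≠ ⊥ →
      ∀ r : ℕ, 1 ≤ r → δ (P ^ r) = r + t - 1) :
    ∃ (J : ℕ) (Γ : Fin J → Submodule (𝓞 k) (Fin 3 → 𝓞 k)),
      J ≤ t ^ (3 * Module.finrank ℚ k) * δ (Ideal.span {a 0 * a 1 * a 2}) ∧
      (∀ j,
        Submodule.span k ((fun (y : Fin 3 → 𝓞 k) => fun i => (y i : k)) ''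
          ((Γ j : Set (Fin 3 → 𝓞 k)))) = ⊤ ∧
        ((t : ℝ) ^ (2 * Module.finrank ℚ k))⁻¹ *
            (Ideal.absNorm (Ideal.span {a 0 * a 1 * a 2}) : ℝ) ^ ((2 : ℝ) / t) /
            (Ideal.absNorm (Ideal.span ({a 0 * a 1, a 1 * a 2, a 2 * a 0} : Set (𝓞 k))) : ℝ) ^
              ((3 : ℝ) / t) ≤
          ((Γ j).toAddSubgroup.index : ℝ)) ∧
      ∀ x : Fin 3 → 𝓞 k,
        a 0 * x 0 ^ t + a 1 * x 1 ^ t + a 2 * x 2 ^ t = 0 → ∃ j, x ∈ Γ j := by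
  classical
  have hΔ : a 0 * a 1 * a 2 ≠ 0 := mul_ne_zero (mul_ne_zero (ha 0) (ha 1)) (ha 2)
  have ht0 : (t : 𝓞 k) ≠ 0 := by exact_mod_cast (by omega : t ≠ 0)
  obtain ⟨S, r, hS, hprod⟩ := FermatLattice.exists_prod_prime_pow hΔ
  have hmax : ∀ P ∈ S, P.IsMaximal := fun P hP ↦
    (Ideal.isPrime_of_prime (hS P hP).1).isMaximal (hS P hP).1.ne_zero
  have hloc := fun P : S ↦ FermatLattice.exists_local_covering (hS P.1 P.2).1 ht ht0 ha
    (hS P.1 P.2).2.2 (hS P.1 P.2).2.1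
  choose e' s' he' hs' hloc using hloc
  let e : Ideal (𝓞 k) → ℕ := fun P ↦ if h : P ∈ S then e' ⟨P, h⟩ else 0
  let s : Ideal (𝓞 k) → ℕ := fun P ↦ if h : P ∈ S then s' ⟨P, h⟩ else 0
  have he_eq : ∀ P (h : P ∈ S), e P = e' ⟨P, h⟩ := fun P h ↦ dif_pos h
  have hs_eq : ∀ P (h : P ∈ S), s P = s' ⟨P, h⟩ := fun P h ↦ dif_pos h
  obtain ⟨𝓕, hcard, h𝓕, hcov⟩ := FermatLattice.exists_family_of_local
    {y : Fin 3 → 𝓞 k | a 0 * y 0 ^ t + a 1 * y 1 ^ t + a 2 * y 2 ^ t = 0} t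
    (fun P ↦ (Ideal.absNorm P ^ e P) ^ 3 * (r P + t - 1))
    (fun P ↦ (Ideal.absNorm P ^ r P) ^ 2)
    (fun P ↦ (Ideal.absNorm P ^ s P) ^ 3 * ((Ideal.absNorm P ^ e P) ^ 2) ^ t) S hmax
    (fun P hP ↦ by simpa only [he_eq P hP, hs_eq P hP] using hloc ⟨P, hP⟩)
  set T := t ^ Module.finrank ℚ k with hT
  have hTpos : 0 < T := Nat.pow_pos (by omega)
  have heT : ∏ P ∈ S, Ideal.absNorm P ^ e P ≤ T := by
    rw [hT, ← RingOfIntegers.rank k, ← Ideal.absNorm_span_natCast]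
    refine FermatLattice.prod_pow_le_absNorm hmax (by simpa using ht0) fun P hP ↦ ?_
    rw [Ideal.span_singleton_le_iff_mem, he_eq P hP]
    exact he' ⟨P, hP⟩
  set Δ₀ := Ideal.span ({a 0 * a 1, a 1 * a 2, a 2 * a 0} : Set (𝓞 k))
  have hΔ₀ : Δ₀ ≠ ⊥ := by
    intro h
    have : a 0 * a 1 ∈ Δ₀ := Ideal.subset_span (by simp)
    rw [h, Ideal.mem_bot] at this
    exact mul_ne_zero (ha 0) (ha 1) this
  have hsΔ₀ : ∏ P ∈ S, Ideal.absNorm P ^ s P ≤ Ideal.absNorm Δ₀ := by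
    refine FermatLattice.prod_pow_le_absNorm hmax hΔ₀ fun P hP ↦ ?_
    obtain ⟨h1, h2, h3⟩ := hs' ⟨P, hP⟩
    rw [hs_eq P hP, Ideal.span_le]
    rintro _ (rfl | rfl | rfl) <;> assumption
  have hδ : δ (Ideal.span {a 0 * a 1 * a 2}) = ∏ P ∈ S, (r P + t - 1) := by
    rw [hprod]
    exact FermatLattice.map_prod_prime_pow S hmax (fun P hP ↦ (hS P hP).1.ne_zero) δ t hδ_one
      hδ_mul hδ_pp r fun P hP ↦ (hS P hP).2.1
  have hnorm : Ideal.absNorm (Ideal.span {a 0 * a 1 * a 2}) = ∏ P ∈ S, Ideal.absNorm P ^ r P := by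
    rw [hprod, map_prod]
    exact Finset.prod_congr rfl fun P _ ↦ map_pow _ _ _
  refine ⟨𝓕.card, fun m ↦ 𝓕.equivFin.symm m, ?_, fun m ↦ ⟨?_, ?_⟩, fun x hx ↦ ?_⟩
  · refine hcard.trans ?_
    rw [Finset.prod_mul_distrib, Finset.prod_pow, hδ, mul_comm 3, pow_mul]
    exact Nat.mul_le_mul_right _ (Nat.pow_le_pow_left heT 3)
  · obtain ⟨⟨n, hn⟩, -⟩ := h𝓕 _ (𝓕.equivFin.symm m).2
    exact FermatLattice.span_image_eq_top
      (Finset.prod_ne_zero_iff.2 fun P hP ↦ pow_ne_zero _ (hS P hP).1.ne_zero) hn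
  · obtain ⟨-, h⟩ := h𝓕 _ (𝓕.equivFin.symm m).2
    have := FermatLattice.rpow_bound_of_pow_le (t := t) (T := T ^ 2)
      (A := Ideal.absNorm (Ideal.span {a 0 * a 1 * a 2})) (B := Ideal.absNorm Δ₀) (by omega)
      (Nat.pos_of_ne_zero (Ideal.absNorm_eq_zero_iff.not.2 hΔ₀)) (Nat.pow_pos hTpos) (by
        rw [Finset.prod_pow, Finset.prod_mul_distrib, Finset.prod_pow, Finset.prod_pow,
          Finset.prod_pow, ← hnorm] at h
        refine h.trans (Nat.mul_le_mul_left _ (Nat.mul_le_mul (Nat.pow_le_pow_left hsΔ₀ 3) ?_))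
        exact Nat.pow_le_pow_left (Nat.pow_le_pow_left heT 2) t)
    rw [hT] at this
    push_cast at this
    rwa [← pow_mul, mul_comm _ 2] at this
  · obtain ⟨Γ, hΓ, hxΓ⟩ := hcov x hx
    exact ⟨𝓕.equivFin ⟨Γ, hΓ⟩, by simpa using hxΓ⟩
end

section
/- Let t ≥ 2 be an integer and let δ_t be the multiplicative function on integral ideals of 𝔬 determined by δ_t(𝔭^r) = r + t − 1 for each prime ideal 𝔭 and r ≥ 1. Then ∑_{𝔞 ⊂ 𝔬, N_k(𝔞) ≤ B} δ_t(𝔞) ≤ C·B·(log B)^{t−1} for all B ≥ 2, where the sum is over nonzero integral ideals and C is a constant depending only on k and t. -/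
open NumberField

namespace NumberField.Ideal

variable (k : Type*) [Field k] [NumberField k]

/-- The finite set of nonzero integral ideals of norm at most `n`. -/
noncomputable def normLE (n : ℕ) : Finset (Ideal (𝓞 k)) :=
  ((Ideal.finite_setOfPred_absNorm_le n).subset
    (show {I : Ideal (𝓞 k) | I ≠ ⊥ ∧ Ideal.absNorm I ≤ n} ⊆ _ from fun _ h ↦ h.2)).toFinset

variable {k}

@[simp]
theorem mem_normLE {n : ℕ} {I : Ideal (𝓞 k)} :
    I ∈ normLE k n ↔ I ≠ ⊥ ∧ Ideal.absNorm I ≤ n := by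
  simp [normLE]

theorem absNorm_pos {I : Ideal (𝓞 k)} (hI : I ≠ ⊥) : 0 < Ideal.absNorm I :=
  Nat.pos_of_ne_zero (mt Ideal.absNorm_eq_zero_iff.mp hI)

theorem normLE_zero : normLE k 0 = ∅ :=
  Finset.eq_empty_of_forall_notMem fun _ hI ↦
    (absNorm_pos (mem_normLE.mp hI).1).not_ge (mem_normLE.mp hI).2

theorem mem_normLE_of_dvd {I J : Ideal (𝓞 k)} {n : ℕ} (hI : I ∈ normLE k n) (h : J ∣ I) :
    J ∈ normLE k n := by
  rw [mem_normLE] at hI ⊢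
  refine ⟨ne_zero_of_dvd_ne_zero hI.1 h, le_trans ?_ hI.2⟩
  exact Nat.le_of_dvd (absNorm_pos hI.1) (map_dvd Ideal.absNorm h)

variable (k) in
theorem exists_card_normLE_le : ∃ C : ℝ, 0 < C ∧ ∀ n : ℕ, ((normLE k n).card : ℝ) ≤ C * n := by
  have h := (NumberField.Ideal.tendsto_norm_le_div_atTop k).comp tendsto_natCast_atTop_atTop
  obtain ⟨C, hC⟩ := h.bddAbove_range
  refine ⟨max C 1, by positivity, fun n ↦ ?_⟩
  rcases n.eq_zero_or_pos with rfl | hn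
  · simp [normLE_zero]
  · have h1 : ((normLE k n).card : ℝ) ≤ Nat.card {I : Ideal (𝓞 k) // Ideal.absNorm I ≤ n} := by
      have : Finite {I : Ideal (𝓞 k) // Ideal.absNorm I ≤ n} :=
        Ideal.finite_setOfPred_absNorm_le n
      rw [Nat.cast_le, ← Nat.card_eq_finsetCard]
      exact Nat.card_le_card_of_injective
        (fun I : normLE k n ↦ (⟨I.1, (mem_normLE.mp I.2).2⟩ :
          {I : Ideal (𝓞 k) // Ideal.absNorm I ≤ n}))
        fun I J hIJ ↦ Subtype.ext (Subtype.mk.inj hIJ)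
    have h2 := hC (Set.mem_range_self n)
    simp only [Function.comp_apply, Nat.cast_le] at h2
    rw [div_le_iff₀ (by positivity)] at h2
    refine h1.trans (h2.trans ?_)
    gcongr
    exact le_max_left _ _

theorem sum_inv_absNorm_le {C : ℝ} (hC : 0 < C)
    (h : ∀ n : ℕ, ((normLE k n).card : ℝ) ≤ C * n) (n : ℕ) :
    ∑ I ∈ normLE k n, (Ideal.absNorm I : ℝ)⁻¹ ≤ C * (2 + Real.log n) := by
  have key : ∀ n : ℕ, ∑ I ∈ normLE k n, (Ideal.absNorm I : ℝ)⁻¹ ≤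
      (normLE k n).card / (n + 1) + C * (harmonic n : ℝ) := by
    intro n
    induction n with
    | zero =>
      simp [normLE_zero]
    | succ n ih =>
      have hsub : normLE k n ⊆ normLE k (n + 1) := fun I hI ↦ by
        rw [mem_normLE] at hI ⊢
        exact ⟨hI.1, hI.2.trans n.le_succ⟩
      have hsd : ∑ I ∈ normLE k (n + 1) \ normLE k n, (Ideal.absNorm I : ℝ)⁻¹ =
          ((normLE k (n + 1)).card - (normLE k n).card) * ((n : ℝ) + 1)⁻¹ := by
        rw [← Nat.cast_sub (Finset.card_le_card hsub), ← Finset.card_sdiff_of_subset hsub,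
          ← nsmul_eq_mul]
        refine Finset.sum_eq_card_nsmul fun I hI ↦ ?_
        simp only [Finset.mem_sdiff, mem_normLE, not_and, not_le] at hI
        have : Ideal.absNorm I = n + 1 := le_antisymm hI.1.2 (hI.2 hI.1.1)
        rw [this]
        push_cast
        rfl
      rw [← Finset.sum_sdiff hsub, hsd, harmonic_succ]
      have hA := h (n + 1)
      set a : ℝ := ((normLE k (n + 1)).card : ℝ)
      push_cast at hA ⊢
      have h3 : a * ((n : ℝ) + 1)⁻¹ - a / (n + 1 + 1) ≤ C * ((n : ℝ) + 1)⁻¹ := by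
        have : a * ((n : ℝ) + 1)⁻¹ - a / (n + 1 + 1) = a * (((n : ℝ) + 1)⁻¹ / (n + 1 + 1)) := by
          field_simp
          ring
        rw [this]
        calc a * (((n : ℝ) + 1)⁻¹ / (n + 1 + 1))
            ≤ C * (n + 1) * (((n : ℝ) + 1)⁻¹ / (n + 1 + 1)) := by gcongr
          _ = C * ((n : ℝ) + 1 + 1)⁻¹ := by field_simp
          _ ≤ C * ((n : ℝ) + 1)⁻¹ := by
            gcongr
            linarith
      rw [sub_mul, mul_add]
      rw [div_eq_mul_inv] at ih
      linarith
  refine (key n).trans ?_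
  have h1 : ((normLE k n).card : ℝ) / (n + 1) ≤ C := by
    rw [div_le_iff₀ (by positivity)]
    linarith [h n]
  nlinarith [harmonic_le_one_add_log n]

open scoped Classical in
/-- The iterated divisor sum of the constant function `1`: the number of ordered factorizations
of a nonzero ideal into `t + 1` factors. -/
noncomputable def factorizationCount : ℕ → Ideal (𝓞 k) → ℕ
  | 0, _ => 1
  | t + 1, I => ∑ J ∈ normLE k (Ideal.absNorm I) with J ∣ I, factorizationCount t J

open scoped Classical in
/-- The sum of a divisor sum weighted by `g`, after exchanging the order of summation. -/
theorem sum_mul_factorizationCount_succ_le (g : Ideal (𝓞 k) → ℝ) (hg : ∀ I, 0 ≤ g I) (t n : ℕ) :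
    ∑ I ∈ normLE k n, g I * factorizationCount (t + 1) I ≤
      ∑ J ∈ normLE k n, factorizationCount t J * ∑ H ∈ normLE k (n / Ideal.absNorm J), g (J * H) := by
  have h1 : ∀ I ∈ normLE k n, g I * factorizationCount (t + 1) I =
      ∑ J ∈ normLE k n, if J ∣ I then factorizationCount t J * g I else 0 := by
    intro I hI
    rw [factorizationCount, ← Finset.sum_filter, Nat.cast_sum, Finset.mul_sum]
    have hI' : I ∈ normLE k (Ideal.absNorm I) := mem_normLE.mpr ⟨(mem_normLE.mp hI).1, le_rfl⟩
    refine Finset.sum_congr ?_ fun J _ ↦ mul_comm _ _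
    ext J
    simp only [Finset.mem_filter]
    exact ⟨fun h ↦ ⟨mem_normLE_of_dvd hI h.2, h.2⟩, fun h ↦ ⟨mem_normLE_of_dvd hI' h.2, h.2⟩⟩
  rw [Finset.sum_congr rfl h1, Finset.sum_comm]
  refine Finset.sum_le_sum fun J hJ ↦ ?_
  rw [← Finset.sum_filter, ← Finset.mul_sum]
  refine mul_le_mul_of_nonneg_left ?_ (Nat.cast_nonneg _)
  have hJ0 : J ≠ 0 := (mem_normLE.mp hJ).1
  rw [← Finset.sum_image (f := g) (g := fun H ↦ J * H) (mul_right_injective₀ hJ0).injOn]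
  refine Finset.sum_le_sum_of_subset_of_nonneg ?_ fun I _ _ ↦ hg I
  intro I hI
  obtain ⟨hI, H, rfl⟩ := Finset.mem_filter.mp hI
  refine Finset.mem_image.mpr ⟨H, ?_, rfl⟩
  rw [mem_normLE] at hI ⊢
  refine ⟨right_ne_zero_of_mul hI.1, ?_⟩
  rw [Nat.le_div_iff_mul_le (absNorm_pos hJ0), mul_comm, ← map_mul]
  exact hI.2

theorem sum_inv_absNorm_mul_factorizationCount_le (t n : ℕ) :
    ∑ I ∈ normLE k n, (Ideal.absNorm I : ℝ)⁻¹ * factorizationCount t I ≤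
      (∑ I ∈ normLE k n, (Ideal.absNorm I : ℝ)⁻¹) ^ (t + 1) := by
  induction t with
  | zero => simp [factorizationCount]
  | succ t ih =>
    refine (sum_mul_factorizationCount_succ_le _ (fun _ ↦ by positivity) t n).trans ?_
    rw [pow_succ]
    refine le_trans ?_ (mul_le_mul_of_nonneg_right ih (by positivity))
    rw [Finset.sum_mul]
    refine Finset.sum_le_sum fun J hJ ↦ ?_
    simp only [map_mul, Nat.cast_mul, mul_inv]
    rw [← Finset.mul_sum, ← mul_assoc, mul_comm (factorizationCount t J : ℝ)]
    refine mul_le_mul_of_nonneg_left ?_ (by positivity)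
    refine Finset.sum_le_sum_of_subset_of_nonneg (fun I hI ↦ ?_) fun I _ _ ↦ by positivity
    rw [mem_normLE] at hI ⊢
    exact ⟨hI.1, hI.2.trans (Nat.div_le_self _ _)⟩

theorem sum_factorizationCount_le {C : ℝ} (hC : 0 < C)
    (h : ∀ n : ℕ, ((normLE k n).card : ℝ) ≤ C * n) (t n : ℕ) :
    ∑ I ∈ normLE k n, (factorizationCount t I : ℝ) ≤
      C * n * (∑ I ∈ normLE k n, (Ideal.absNorm I : ℝ)⁻¹) ^ t := by
  cases t with
  | zero => simpa [factorizationCount] using h n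
  | succ t =>
    have h1 := sum_mul_factorizationCount_succ_le (k := k) (fun _ ↦ 1) (fun _ ↦ zero_le_one) t n
    simp only [one_mul, Finset.sum_const, nsmul_eq_mul, mul_one] at h1
    refine h1.trans (le_trans ?_ (mul_le_mul_of_nonneg_left
      (sum_inv_absNorm_mul_factorizationCount_le t n) (by positivity)))
    rw [Finset.mul_sum]
    refine Finset.sum_le_sum fun J hJ ↦ ?_
    calc (factorizationCount t J : ℝ) * (normLE k (n / Ideal.absNorm J)).card
        ≤ factorizationCount t J * (C * (n / Ideal.absNorm J)) := by
          refine mul_le_mul_of_nonneg_left ((h _).trans ?_) (by positivity)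
          exact mul_le_mul_of_nonneg_left Nat.cast_div_le hC.le
      _ = _ := by ring

theorem factorizationCount_pos (t : ℕ) {I : Ideal (𝓞 k)} (hI : I ≠ ⊥) :
    0 < factorizationCount t I := by
  classical
  induction t generalizing I with
  | zero => simp [factorizationCount]
  | succ t ih =>
    rw [factorizationCount]
    refine Finset.sum_pos (fun J hJ ↦ ih ?_) ⟨I, ?_⟩
    · exact (mem_normLE.mp (Finset.mem_filter.mp hJ).1).1
    · simp [hI]

theorem factorizationCount_mul_le (t : ℕ) {I J : Ideal (𝓞 k)} (hI : I ≠ ⊥) (hJ : J ≠ ⊥)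
    (h : IsRelPrime I J) :
    factorizationCount t I * factorizationCount t J ≤ factorizationCount t (I * J) := by
  classical
  induction t generalizing I J with
  | zero => simp [factorizationCount]
  | succ t ih =>
    simp only [factorizationCount]
    rw [Finset.sum_mul_sum, ← Finset.sum_product']
    have hIJ : I * J ∈ normLE k (Ideal.absNorm (I * J)) :=
      mem_normLE.mpr ⟨mul_ne_zero hI hJ, le_rfl⟩
    refine (Finset.sum_le_sum (g := fun x ↦ factorizationCount t (x.1 * x.2))
      fun x hx ↦ ?_).trans ?_
    · simp only [Finset.mem_product, Finset.mem_filter, mem_normLE] at hx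
      exact ih hx.1.1.1 hx.2.1.1 ((h.of_dvd_left hx.1.2).of_dvd_right hx.2.2)
    · rw [← Finset.sum_image (f := factorizationCount t)
        (g := fun x : Ideal (𝓞 k) × Ideal (𝓞 k) ↦ x.1 * x.2)]
      · refine Finset.sum_le_sum_of_subset fun x hx ↦ ?_
        obtain ⟨⟨a, b⟩, hab, rfl⟩ := Finset.mem_image.mp hx
        simp only [Finset.mem_product, Finset.mem_filter] at hab ⊢
        have hd : a * b ∣ I * J := mul_dvd_mul hab.1.2 hab.2.2
        exact ⟨mem_normLE_of_dvd hIJ hd, hd⟩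
      · rintro ⟨a, b⟩ hab ⟨c, d⟩ hcd heq
        simp only [Finset.coe_product, Finset.coe_filter, Set.mem_prod, Set.mem_ofPred_eq] at hab hcd
        have had : IsRelPrime a d := (h.of_dvd_left hab.1.2).of_dvd_right hcd.2.2
        have hcb : IsRelPrime c b := (h.of_dvd_left hcd.1.2).of_dvd_right hab.2.2
        have heq : a * b = c * d := heq
        have hac : a = c := dvd_antisymm
          (had.dvd_of_dvd_mul_right (heq ▸ dvd_mul_right a b))
          (hcb.dvd_of_dvd_mul_right (heq ▸ dvd_mul_right c d))
        subst hac
        have ha : a ≠ 0 := (mem_normLE.mp hab.1.1).1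
        rw [mul_left_cancel₀ ha heq]

theorem le_factorizationCount_pow {P : Ideal (𝓞 k)} (hP : Prime P) (t : ℕ) {r : ℕ} (hr : 1 ≤ r) :
    r + t + 1 ≤ factorizationCount (t + 1) (P ^ r) := by
  classical
  have hmem : ∀ i ≤ r,
      P ^ i ∈ (normLE k (Ideal.absNorm (P ^ r))).filter (· ∣ P ^ r) := fun i hi ↦ by
    have hd : P ^ i ∣ P ^ r := pow_dvd_pow P hi
    exact Finset.mem_filter.mpr
      ⟨mem_normLE_of_dvd (mem_normLE.mpr ⟨pow_ne_zero r hP.ne_zero, le_rfl⟩) hd, hd⟩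
  have hinj : Function.Injective (P ^ · : ℕ → Ideal (𝓞 k)) :=
    pow_injective_of_not_isUnit hP.not_isUnit hP.ne_zero
  induction t with
  | zero =>
    simp only [factorizationCount, Finset.sum_const, smul_eq_mul, mul_one, add_zero]
    calc r + 1 = ((Finset.range (r + 1)).image (P ^ ·)).card := by
          rw [Finset.card_image_of_injective _ hinj, Finset.card_range]
      _ ≤ _ := Finset.card_le_card fun x hx ↦ by
          obtain ⟨i, hi, rfl⟩ := Finset.mem_image.mp hx
          exact hmem i (Nat.lt_succ_iff.mp (Finset.mem_range.mp hi))
  | succ t ih =>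
    have hne : P ^ r ≠ P ^ 0 := fun h ↦ by
      have := hinj h
      omega
    have h0 : 0 < factorizationCount (t + 1) (P ^ 0) :=
      factorizationCount_pos _ (pow_ne_zero 0 hP.ne_zero)
    have hsum : factorizationCount (t + 1) (P ^ r) + factorizationCount (t + 1) (P ^ 0) ≤
        factorizationCount (t + 1 + 1) (P ^ r) := by
      rw [← Finset.sum_pair hne]
      conv_rhs => rw [factorizationCount]
      refine Finset.sum_le_sum_of_subset fun x hx ↦ ?_
      rcases Finset.mem_insert.mp hx with rfl | hx
      · exact hmem r le_rfl
      · rw [Finset.mem_singleton.mp hx]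
        exact hmem 0 r.zero_le
    omega

theorem le_factorizationCount {t : ℕ} (ht : 2 ≤ t) {δ : Ideal (𝓞 k) → ℕ}
    (hδ_one : δ ⊤ = 1)
    (hδ_mul : ∀ I J : Ideal (𝓞 k), I ⊔ J = ⊤ → δ (I * J) = δ I * δ J)
    (hδ_pp : ∀ P : Ideal (𝓞 k), P.IsPrime → P ≠ ⊥ →
      ∀ r : ℕ, 1 ≤ r → δ (P ^ r) = r + t - 1) (I : Ideal (𝓞 k)) (hI : I ≠ ⊥) :
    δ I ≤ factorizationCount (t - 1) I := by
  have hone : δ ⊤ ≤ factorizationCount (t - 1) (⊤ : Ideal (𝓞 k)) := by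
    rw [hδ_one]
    exact factorizationCount_pos _ top_ne_bot
  induction I using UniqueFactorizationMonoid.induction_on_coprime with
  | h0 => exact absurd rfl hI
  | h1 hx => rwa [Ideal.isUnit_iff.mp hx]
  | @hpr P r hP =>
    rcases r.eq_zero_or_pos with rfl | hr
    · rwa [pow_zero, Ideal.one_eq_top]
    · rw [hδ_pp P (Ideal.isPrime_of_prime hP) hP.ne_zero r hr]
      obtain ⟨s, rfl⟩ := Nat.exists_eq_add_of_le' ht
      exact le_factorizationCount_pow hP s hr
  | @hcp I J h ihI ihJ =>
    have hI0 : I ≠ ⊥ := left_ne_zero_of_mul hI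
    have hJ0 : J ≠ ⊥ := right_ne_zero_of_mul hI
    have hsup : I ⊔ J = ⊤ := Ideal.isUnit_iff.mp
      (h (Ideal.dvd_iff_le.mpr le_sup_left) (Ideal.dvd_iff_le.mpr le_sup_right))
    rw [hδ_mul I J hsup]
    exact (Nat.mul_le_mul (ihI hI0) (ihJ hJ0)).trans (factorizationCount_mul_le _ hI0 hJ0 h)

end NumberField.Ideal

/-- average of the generalized divisor function `δ_t`:  let `t ≥ 2` and
let `δ` be the multiplicative function on integral ideals of `𝓞 k` with
`δ(𝔭^r) = r + t - 1` for all prime ideals `𝔭` and `r ≥ 1` (and `δ(1) = 1`).  Then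
`∑_{N(𝔞) ≤ B} δ(𝔞) ≤ C · B · (log B)^{t-1}` for all `B ≥ 2`, with `C = C(k, t)`. -/
theorem delta_average {k : Type*} [Field k] [NumberField k]
    (t : ℕ) (ht : 2 ≤ t) (δ : Ideal (𝓞 k) → ℕ)
    (hδ_one : δ ⊤ = 1)
    (hδ_mul : ∀ I J : Ideal (𝓞 k), I ⊔ J = ⊤ → δ (I * J) = δ I * δ J)
    (hδ_pp : ∀ P : Ideal (𝓞 k), P.IsPrime → P ≠ ⊥ →
      ∀ r : ℕ, 1 ≤ r → δ (P ^ r) = r + t - 1) :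
    ∃ C : ℝ, 0 < C ∧ ∀ B : ℝ, 2 ≤ B →
      ∑' I : {I : Ideal (𝓞 k) // I ≠ ⊥ ∧ (Ideal.absNorm I : ℝ) ≤ B}, ((δ I : ℕ) : ℝ) ≤
        C * B * Real.log B ^ (t - 1) := by
  obtain ⟨C, hC, hcard⟩ := NumberField.Ideal.exists_card_normLE_le k
  have hlog2 : 0 < Real.log 2 := Real.log_pos one_lt_two
  refine ⟨C * (C * (2 / Real.log 2 + 1)) ^ (t - 1), by positivity, fun B hB ↦ ?_⟩
  have hB0 : 0 ≤ B := by linarith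
  have hmem : ∀ I : Ideal (𝓞 k), I ∈ NumberField.Ideal.normLE k ⌊B⌋₊ ↔
      I ≠ ⊥ ∧ (Ideal.absNorm I : ℝ) ≤ B := fun I ↦ by
    rw [NumberField.Ideal.mem_normLE, Nat.le_floor_iff hB0]
  have htsum : ∑' I : {I : Ideal (𝓞 k) // I ≠ ⊥ ∧ (Ideal.absNorm I : ℝ) ≤ B}, ((δ I : ℕ) : ℝ) =
      ∑ I ∈ NumberField.Ideal.normLE k ⌊B⌋₊, (δ I : ℝ) := by
    rw [← Finset.tsum_subtype]
    exact (Equiv.subtypeEquivRight hmem).symm.tsum_eq (fun I ↦ ((δ I : ℕ) : ℝ))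
  have hfloor : (⌊B⌋₊ : ℝ) ≤ B := Nat.floor_le hB0
  have hfloor_pos : (0 : ℝ) < ⌊B⌋₊ := Nat.cast_pos.mpr (Nat.floor_pos.mpr (by linarith))
  have hlog : 2 + Real.log ⌊B⌋₊ ≤ (2 / Real.log 2 + 1) * Real.log B := by
    have h1 : Real.log ⌊B⌋₊ ≤ Real.log B := Real.log_le_log hfloor_pos hfloor
    have h2 : 2 / Real.log 2 * Real.log 2 ≤ 2 / Real.log 2 * Real.log B := by gcongr
    rw [div_mul_cancel₀ _ hlog2.ne'] at h2
    linarith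
  rw [htsum]
  calc ∑ I ∈ NumberField.Ideal.normLE k ⌊B⌋₊, (δ I : ℝ)
      ≤ ∑ I ∈ NumberField.Ideal.normLE k ⌊B⌋₊,
          (NumberField.Ideal.factorizationCount (t - 1) I : ℝ) :=
        Finset.sum_le_sum fun I hI ↦ Nat.cast_le.mpr
          (NumberField.Ideal.le_factorizationCount ht hδ_one hδ_mul hδ_pp I ((hmem I).mp hI).1)
    _ ≤ C * ⌊B⌋₊ *
          (∑ I ∈ NumberField.Ideal.normLE k ⌊B⌋₊, (Ideal.absNorm I : ℝ)⁻¹) ^ (t - 1) :=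
        NumberField.Ideal.sum_factorizationCount_le hC hcard _ _
    _ ≤ C * B * (C * ((2 / Real.log 2 + 1) * Real.log B)) ^ (t - 1) := by
        gcongr
        exact (NumberField.Ideal.sum_inv_absNorm_le hC hcard _).trans
          (mul_le_mul_of_nonneg_left hlog hC.le)
    _ = C * (C * (2 / Real.log 2 + 1)) ^ (t - 1) * B * Real.log B ^ (t - 1) := by
        rw [← mul_assoc, mul_pow]
        ring
end

section
/- Let K be a finite extension of k, and for each infinite place ν of k fix an extension of ν to K, with completion K_ν and the normalized absolute value ∥·∥_ν extended to K_ν. Let B ∈ (ℝ_{>0})^{s_k} with components B_ν, and for each ν | ∞ let t_ν ∈ K_ν. Then 𝒮 = {u ∈ 𝔬 : ∥u − t_ν∥_ν < B_ν for all ν | ∞} satisfies #𝒮 ≤ C·(1 + ∏_{ν|∞} B_ν), where C is a constant depending only on k (in particular, independent of the t_ν). -/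
open NumberField

/-- A nonzero algebraic integer has `∏ w, w x ^ mult w ≥ 1`. -/
lemma one_le_prod_infinitePlace_pow_mult {k : Type*} [Field k] [NumberField k] {x : 𝓞 k}
    (hx : x ≠ 0) : 1 ≤ ∏ w : InfinitePlace k, w (x : k) ^ w.mult := by
  rw [InfinitePlace.prod_eq_abs_norm, ← Algebra.coe_norm_int]
  have h : 1 ≤ |Algebra.norm ℤ x| := Int.one_le_abs (Algebra.norm_ne_zero_iff.mpr hx)
  exact_mod_cast h

/-- Two reals with the same integer part after rescaling by `r / N` differ by less than `r / N`. -/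
lemma abs_sub_lt_of_floor_mul_div_eq {a b r N : ℝ} (hr : 0 < r) (hN : 0 < N)
    (h : ⌊a * N / r⌋ = ⌊b * N / r⌋) : |a - b| < r / N := by
  have h1 := Int.abs_sub_lt_one_of_floor_eq_floor h
  have h2 : a * N / r - b * N / r = (a - b) * (N / r) := by ring
  rw [h2, abs_mul, abs_of_pos (div_pos hN hr), ← lt_div_iff₀ (div_pos hN hr)] at h1
  simpa using h1

lemma floor_mul_div_mem_Ico {a r : ℝ} {N : ℕ} (hr : 0 < r) (hN : 0 < N) (h : |a| < r) :
    ⌊a * N / r⌋ ∈ Finset.Ico (-(N : ℤ)) N := by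
  have hN' : (0 : ℝ) < N := by exact_mod_cast hN
  obtain ⟨h1, h2⟩ := abs_lt.mp h
  rw [Finset.mem_Ico, Int.le_floor, Int.floor_lt]
  push_cast
  rw [le_div_iff₀ hr, div_lt_iff₀ hr]
  constructor <;> nlinarith

/-- The algebraic integers in a box of radii `r` are at most `(2 N) ^ [k : ℚ]` in number, as soon
as the box rescaled by `2 / N` has normalized volume at most `1`. -/
lemma finite_and_ncard_integers_in_box_le {k : Type*} [Field k] [NumberField k]
    (φ : InfinitePlace k → (k →+* ℂ)) (hφ : ∀ w, InfinitePlace.mk (φ w) = w)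
    (t : InfinitePlace k → ℂ) {r : InfinitePlace k → ℝ} (hr : ∀ w, 0 < r w) {N : ℕ} (hN : 0 < N)
    (hprod : ∏ w : InfinitePlace k, (2 * r w / N) ^ w.mult ≤ 1) :
    {u : 𝓞 k | ∀ w, ‖φ w (u : k) - t w‖ < r w}.Finite ∧
      {u : 𝓞 k | ∀ w, ‖φ w (u : k) - t w‖ < r w}.ncard ≤ (2 * N) ^ Module.finrank ℚ k := by
  classical
  set S := {u : 𝓞 k | ∀ w, ‖φ w (u : k) - t w‖ < r w}
  have hN' : (0 : ℝ) < N := by exact_mod_cast hN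
  let cell : 𝓞 k → InfinitePlace k → ℤ × ℤ := fun u w =>
    (⌊(φ w (u : k) - t w).re * N / r w⌋,
      if w.IsReal then 0 else ⌊(φ w (u : k) - t w).im * N / r w⌋)
  let cells : Finset (InfinitePlace k → ℤ × ℤ) := Fintype.piFinset fun w =>
    Finset.Ico (-(N : ℤ)) N ×ˢ (if w.IsReal then {0} else Finset.Ico (-(N : ℤ)) N)
  have hmaps : Set.MapsTo cell S cells := by
    intro u hu
    simp only [cells, Finset.mem_coe, Fintype.mem_piFinset, Finset.mem_product]
    intro w
    refine ⟨floor_mul_div_mem_Ico (hr w) hN ((Complex.abs_re_le_norm _).trans_lt (hu w)), ?_⟩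
    by_cases hw : w.IsReal
    · simp [cell, hw]
    · simp only [cell, hw, if_false]
      exact floor_mul_div_mem_Ico (hr w) hN ((Complex.abs_im_le_norm _).trans_lt (hu w))
  have hinj : Set.InjOn cell S := by
    intro u _ v _ huv
    by_contra hne
    have hlt : ∀ w : InfinitePlace k, w ((u - v : 𝓞 k) : k) < 2 * r w / N := by
      intro w
      have hw := congrFun huv w
      simp only [cell, Prod.mk.injEq] at hw
      have hre := abs_sub_lt_of_floor_mul_div_eq (hr w) hN' hw.1
      have him : |(φ w (u : k) - t w).im - (φ w (v : k) - t w).im| < r w / N := by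
        by_cases hreal : w.IsReal
        · have hφr : ComplexEmbedding.IsReal (φ w) :=
            InfinitePlace.isReal_of_mk_isReal (by rwa [hφ w])
          have h0 : ∀ x : k, (φ w x).im = 0 := fun x =>
            Complex.conj_eq_iff_im.mp (RingHom.congr_fun hφr x)
          simpa [h0] using div_pos (hr w) hN'
        · simp only [hreal, if_false] at hw
          exact abs_sub_lt_of_floor_mul_div_eq (hr w) hN' hw.2
      have hnorm : w ((u - v : 𝓞 k) : k) = ‖φ w (u : k) - φ w (v : k)‖ := by
        conv_lhs => rw [← hφ w]
        simp [InfinitePlace.apply]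
      have htri := Complex.norm_le_abs_re_add_abs_im (φ w (u : k) - φ w (v : k))
      rw [← Complex.sub_re] at hre
      rw [← Complex.sub_im] at him
      rw [sub_sub_sub_cancel_right] at hre him
      rw [hnorm, mul_div_assoc]
      linarith
    have hsub : u - v ≠ 0 := sub_ne_zero.mpr hne
    have hpos : ∀ w : InfinitePlace k, 0 < w ((u - v : 𝓞 k) : k) := fun w =>
      InfinitePlace.pos_iff.mpr (RingOfIntegers.coe_ne_zero_iff.mpr hsub)
    have h1 : ∏ w : InfinitePlace k, w ((u - v : 𝓞 k) : k) ^ w.mult <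
        ∏ w : InfinitePlace k, (2 * r w / N) ^ w.mult :=
      Finset.prod_lt_prod_of_nonempty (fun w _ => pow_pos (hpos w) _)
        (fun w _ => pow_lt_pow_left₀ (hlt w) (hpos w).le InfinitePlace.mult_ne_zero)
        Finset.univ_nonempty
    linarith [one_le_prod_infinitePlace_pow_mult hsub]
  have hcard : cells.card = (2 * N) ^ Module.finrank ℚ k := by
    rw [← InfinitePlace.sum_mult_eq (K := k), ← Finset.prod_pow_eq_pow_sum,
      Fintype.card_piFinset]
    refine Finset.prod_congr rfl fun w _ => ?_
    have hIco : (Finset.Ico (-(N : ℤ)) N).card = 2 * N := by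
      rw [Int.card_Ico]; omega
    by_cases hw : w.IsReal <;> simp only [Finset.card_product, hIco, InfinitePlace.mult, hw,
      if_true, if_false, Finset.card_singleton] <;> ring
  refine ⟨Set.Finite.of_injOn hmaps hinj cells.finite_toSet, ?_⟩
  rw [← hcard, ← Set.ncard_coe_finset]
  exact Set.ncard_le_ncard_of_injOn cell hmaps hinj cells.finite_toSet

/-- Every `P > 0` admits `N ≥ 1` with `(2 / N) ^ d * P ≤ 1` and `(2 N) ^ d = O(1 + P)`. -/
lemma exists_nat_two_div_pow_mul_le_one {d : ℕ} (hd : d ≠ 0) {P : ℝ} (hP : 0 < P) :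
    ∃ N : ℕ, 0 < N ∧ (2 / (N : ℝ)) ^ d * P ≤ 1 ∧ (2 * (N : ℝ)) ^ d ≤ 6 ^ d * (1 + P) := by
  set Q : ℝ := P ^ (d : ℝ)⁻¹
  have hQ : 0 < Q := Real.rpow_pos_of_pos hP _
  have hQd : Q ^ d = P := Real.rpow_inv_natCast_pow hP.le hd
  have hlt : 2 * Q < (⌊2 * Q⌋₊ + 1 : ℕ) := by exact_mod_cast Nat.lt_floor_add_one (2 * Q)
  have hle : ((⌊2 * Q⌋₊ + 1 : ℕ) : ℝ) ≤ 2 * Q + 1 := by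
    push_cast
    linarith [Nat.floor_le (by positivity : 0 ≤ 2 * Q)]
  generalize ⌊2 * Q⌋₊ + 1 = N at hlt hle
  have hN : (0 : ℝ) < N := by linarith
  refine ⟨N, by exact_mod_cast hN, ?_, ?_⟩
  · rw [← hQd, ← mul_pow]
    refine pow_le_one₀ (by positivity) ?_
    rw [div_mul_eq_mul_div, div_le_one hN]
    exact hlt.le
  · have hmax : max 1 Q ^ d ≤ 1 + P := by
      rcases max_cases 1 Q with ⟨h, _⟩ | ⟨h, _⟩ <;> rw [h]
      · rw [one_pow]; linarith
      · rw [hQd]; linarith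
    calc (2 * (N : ℝ)) ^ d ≤ (6 * max 1 Q) ^ d := by
          refine pow_le_pow_left₀ (by positivity) ?_ d
          linarith [le_max_left 1 Q, le_max_right 1 Q]
      _ = 6 ^ d * max 1 Q ^ d := mul_pow _ _ _
      _ ≤ 6 ^ d * (1 + P) := by gcongr

/-- box-counting lemma:  there is a constant `C` depending only on `k`
with the following property.  Let `K` be a finite extension of `k` and for each infinite
place `w` of `k` fix an embedding `σ_w : K → ℂ` extending `w` (i.e. a completion of `K` at
a place above `w`, with the normalized absolute value `∥x∥_w = |σ_w x|^{mult w}`).  Then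
for all targets `t_w` (in the completion) and all `B_w > 0`, the set
`𝒮 = {u ∈ 𝔬 : ∥u − t_w∥_w < B_w for all w | ∞}` satisfies `#𝒮 ≤ C·(1 + ∏_w B_w)`. -/
theorem box_counting {k : Type*} [Field k] [NumberField k] :
    ∃ C : ℝ, 0 < C ∧
      ∀ (K : Type*) [Field K] [Algebra k K], FiniteDimensional k K →
      ∀ (σ : InfinitePlace k → (K →+* ℂ)),
        (∀ (w : InfinitePlace k) (x : k), ‖σ w (algebraMap k K x)‖ = w x) →
      ∀ (t : InfinitePlace k → ℂ) (B : InfinitePlace k → ℝ), (∀ w, 0 < B w) →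
        (let S : Set (𝓞 k) :=
          {u | ∀ w : InfinitePlace k,
            ‖σ w (algebraMap k K (u : k)) - t w‖ ^ w.mult < B w};
        S.Finite ∧ (S.ncard : ℝ) ≤ C * (1 + ∏ w : InfinitePlace k, B w)) := by
  refine ⟨6 ^ Module.finrank ℚ k, by positivity, ?_⟩
  intro K _ _ _ σ hσ t B hB
  have hφ : ∀ w, InfinitePlace.mk ((σ w).comp (algebraMap k K)) = w := fun w =>
    InfinitePlace.ext _ _ fun x => by simpa [InfinitePlace.apply] using hσ w x
  let r : InfinitePlace k → ℝ := fun w => B w ^ (w.mult : ℝ)⁻¹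
  have hr : ∀ w, 0 < r w := fun w => Real.rpow_pos_of_pos (hB w) _
  have hrB : ∀ w, r w ^ w.mult = B w := fun w =>
    Real.rpow_inv_natCast_pow (hB w).le InfinitePlace.mult_ne_zero
  obtain ⟨N, hN, hN1, hN2⟩ := exists_nat_two_div_pow_mul_le_one
    (Module.finrank_pos (R := ℚ) (M := k)).ne' (Finset.prod_pos fun w _ => hB w)
  have hprod : ∏ w : InfinitePlace k, (2 * r w / N) ^ w.mult ≤ 1 := by
    simp_rw [mul_div_right_comm, mul_pow, hrB, Finset.prod_mul_distrib,
      Finset.prod_pow_eq_pow_sum, InfinitePlace.sum_mult_eq]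
    exact hN1
  have hbox := finite_and_ncard_integers_in_box_le _ hφ t hr hN hprod
  have hS : {u : 𝓞 k | ∀ w, ‖σ w (algebraMap k K (u : k)) - t w‖ ^ w.mult < B w} =
      {u : 𝓞 k | ∀ w, ‖(σ w).comp (algebraMap k K) (u : k) - t w‖ < r w} := by
    ext u
    refine forall_congr' fun w => ?_
    rw [← hrB w, pow_lt_pow_iff_left₀ (norm_nonneg _) (hr w).le InfinitePlace.mult_ne_zero]
    rfl
  intro S
  rw [show S = _ from hS]
  refine ⟨hbox.1, le_trans ?_ hN2⟩
  exact_mod_cast hbox.2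
end

section
/- In the setting: F(u,v) = (u + α_1 v)⋯(u + α_n v) is a separable binary form of degree n with α_1,…,α_n distinct algebraic numbers, K = k(α_1,…,α_n), each infinite place ν of k is extended to K, ε > 0, θ = ε/n, A ∈ (ℝ_{≥1})^{s_k} with components A_ν, 𝒜 is the set of (u,v) ∈ 𝔬² with A_ν ≤ max{∥u∥_ν, ∥v∥_ν} < 2A_ν for all ν | ∞ and F(u,v) ≠ 0, C > 0 is a constant such that ∥u + α_i v∥_ν < C·A_ν for all (u,v) ∈ 𝒜, all i, and all ν | ∞, and 𝒜_ν(i, q) = {(u,v) ∈ 𝒜 : C·A_ν^{1−(q+1)θ} ≤ ∥u + α_i v∥_ν < C·A_ν^{1−qθ}} for (i,q) ∈ {1,…,n} × ℤ_{≥0}. Then for any choice of pairs (i(ν), q(ν)) ∈ {1,…,n} × ℤ_{≥0} for each ν | ∞, one has #(∩_{ν|∞} 𝒜_ν(i(ν), q(ν))) ≤ C'·∥A∥·(1 + ∏_{ν|∞} A_ν^{1−θ·q(ν)}), where ∥A∥ = ∏_{ν|∞} A_ν and C' depends only on k, F and ε. -/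
open NumberField

/-- The natural map `𝓞 k → K` for a `k`-algebra `K`. -/
noncomputable def iotaK {k : Type*} [Field k] [NumberField k]
    (K : Type*) [Field K] [Algebra k K] (u : 𝓞 k) : K :=
  algebraMap k K (u : k)

/-- The normalized absolute value on `K` extending `∥·∥_w`, computed via the fixed
embedding `σ_w : K → ℂ` lying above `w`. -/
noncomputable def KNorm {k : Type*} [Field k] [NumberField k]
    {K : Type*} [Field K] (σ : InfinitePlace k → (K →+* ℂ))
    (w : InfinitePlace k) (x : K) : ℝ :=
  ‖σ w x‖ ^ w.mult

/-- The set `𝒜`: pairs `(u,v) ∈ 𝔬²` with `A_w ≤ max{∥u∥_w, ∥v∥_w} < 2A_w` for all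
`w | ∞` and `F(u,v) = ∏ᵢ (u + αᵢ v) ≠ 0`. -/
noncomputable def setA {k : Type*} [Field k] [NumberField k]
    {K : Type*} [Field K] [Algebra k K] {n : ℕ} (α : Fin n → K)
    (A : InfinitePlace k → ℝ) : Set (𝓞 k × 𝓞 k) :=
  {p | (∀ w : InfinitePlace k,
          A w ≤ max (plNorm w (p.1 : k)) (plNorm w (p.2 : k)) ∧
          max (plNorm w (p.1 : k)) (plNorm w (p.2 : k)) < 2 * A w) ∧
       (∏ i, (iotaK K p.1 + α i * iotaK K p.2)) ≠ 0}

/-- The set `𝒜_ν(i, q) = {(u,v) ∈ 𝒜 : C·A_ν^{1-(q+1)θ} ≤ ∥u + αᵢ v∥_ν < C·A_ν^{1-qθ}}`. -/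
noncomputable def setAnu {k : Type*} [Field k] [NumberField k]
    {K : Type*} [Field K] [Algebra k K] {n : ℕ} (α : Fin n → K)
    (σ : InfinitePlace k → (K →+* ℂ)) (C θ : ℝ) (A : InfinitePlace k → ℝ)
    (w : InfinitePlace k) (i : Fin n) (q : ℕ) : Set (𝓞 k × 𝓞 k) :=
  {p ∈ setA α A |
    C * A w ^ ((1 : ℝ) - (q + 1) * θ) ≤ KNorm σ w (iotaK K p.1 + α i * iotaK K p.2) ∧
    KNorm σ w (iotaK K p.1 + α i * iotaK K p.2) < C * A w ^ ((1 : ℝ) - q * θ)}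

/-- The set `𝒞_ν(i, q) = {(u,v) ∈ 𝒜 : ∥u + αᵢ v∥_ν < C·A_ν^{1-qθ}}`. -/
noncomputable def setCnu {k : Type*} [Field k] [NumberField k]
    {K : Type*} [Field K] [Algebra k K] {n : ℕ} (α : Fin n → K)
    (σ : InfinitePlace k → (K →+* ℂ)) (C θ : ℝ) (A : InfinitePlace k → ℝ)
    (w : InfinitePlace k) (i : Fin n) (q : ℕ) : Set (𝓞 k × 𝓞 k) :=
  {p ∈ setA α A |
    KNorm σ w (iotaK K p.1 + α i * iotaK K p.2) < C * A w ^ ((1 : ℝ) - q * θ)}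

open NumberField.InfinitePlace in
/-- A point of a number field which is integral and small at all infinite places vanishes. -/
theorem ringOfIntegers_eq_zero_of_prod_lt_one {k : Type*} [Field k] [NumberField k] (x : 𝓞 k)
    (hx : ∏ w : InfinitePlace k, w (x : k) ^ w.mult < 1) : x = 0 := by
  by_contra h
  rw [prod_eq_abs_norm, ← Algebra.coe_norm_int] at hx
  have h1 : Algebra.norm ℤ x ≠ 0 := Algebra.norm_ne_zero_iff.mpr h
  have h2 := Int.one_le_abs h1
  have h3 : (1 : ℚ) ≤ |((Algebra.norm ℤ x : ℤ) : ℚ)| := by exact_mod_cast h2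
  have h4 : (1 : ℝ) ≤ ((|((Algebra.norm ℤ x : ℤ) : ℚ)| : ℚ) : ℝ) := by exact_mod_cast h3
  linarith

/-- If `|a| ≤ R` then `⌊a M / R⌋` lies between `-M` and `M`. -/
theorem floor_mul_div_mem_Icc {a R : ℝ} (hR : 0 < R) (M : ℕ) (ha : |a| ≤ R) :
    ⌊a * M / R⌋ ∈ Finset.Icc (-(M : ℤ)) M := by
  have hM : (0 : ℝ) ≤ M := Nat.cast_nonneg M
  obtain ⟨h1, h2⟩ := abs_le.mp ha
  rw [Finset.mem_Icc]
  constructor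
  · rw [Int.le_floor, le_div_iff₀ hR]
    push_cast
    nlinarith
  · have h : a * M / R ≤ (M : ℝ) := by
      rw [div_le_iff₀ hR]
      nlinarith
    exact_mod_cast (Int.floor_le _).trans h

/-- Two reals in the same cell of length `R / M` are closer than `R / M`. -/
theorem abs_sub_lt_of_floor_eq {a b R M : ℝ} (hR : 0 < R) (hM : 0 < M)
    (h : ⌊a * M / R⌋ = ⌊b * M / R⌋) : |a - b| < R / M := by
  have h1 := Int.abs_sub_lt_one_of_floor_eq_floor h
  rw [← sub_div, ← sub_mul, abs_div, abs_mul, abs_of_pos hR, abs_of_pos hM, div_lt_one hR] at h1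
  rwa [lt_div_iff₀ hM]

open NumberField.InfinitePlace in
/-- Upper bound for the number of integers of a number field in a box. -/
theorem ncard_ringOfIntegers_box_le {k : Type*} [Field k] [NumberField k]
    (R : InfinitePlace k → ℝ) (hR : ∀ w, 0 < R w) :
    {x : 𝓞 k | ∀ w : InfinitePlace k, w (x : k) ≤ R w}.Finite ∧
    ({x : 𝓞 k | ∀ w : InfinitePlace k, w (x : k) ≤ R w}.ncard : ℝ) ≤
      7 ^ Module.finrank ℚ k * (1 + ∏ w, R w ^ w.mult) := by
  classical
  set d := Module.finrank ℚ k with hd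
  have hdpos : 0 < d := Module.finrank_pos
  set N : ℝ := ∏ w, R w ^ w.mult with hN
  have hNpos : 0 < N := Finset.prod_pos fun w _ => pow_pos (hR w) _
  set T : ℝ := max 1 N ^ ((d : ℝ)⁻¹) with hT
  have hT1 : 1 ≤ T := Real.one_le_rpow (le_max_left _ _) (by positivity)
  have hTd : T ^ d = max 1 N := Real.rpow_inv_natCast_pow (by positivity) hdpos.ne'
  set M : ℕ := ⌈2 * T⌉₊ with hM
  have hMT : 2 * T ≤ M := Nat.le_ceil _
  have hMT' : (M : ℝ) < 2 * T + 1 := Nat.ceil_lt_add_one (by linarith)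
  have hMpos : (0 : ℝ) < M := by linarith
  let f : 𝓞 k → InfinitePlace k → ℤ × ℤ := fun x w =>
    (⌊(w.embedding (x : k)).re * M / R w⌋, ⌊(w.embedding (x : k)).im * M / R w⌋)
  let D : Finset (InfinitePlace k → ℤ × ℤ) := Fintype.piFinset fun w =>
    Finset.Icc (-(M : ℤ)) M ×ˢ (if IsReal w then {0} else Finset.Icc (-(M : ℤ)) M)
  have hmaps : ∀ x ∈ {x : 𝓞 k | ∀ w : InfinitePlace k, w (x : k) ≤ R w}, f x ∈ (D : Set _) := by
    intro x hx
    rw [Finset.mem_coe, Fintype.mem_piFinset]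
    intro w
    have hw : ‖w.embedding (x : k)‖ ≤ R w := by rw [norm_embedding_eq]; exact hx w
    rw [Finset.mem_product]
    refine ⟨floor_mul_div_mem_Icc (hR w) M ((Complex.abs_re_le_norm _).trans hw), ?_⟩
    split_ifs with h
    · have him : (w.embedding (x : k)).im = 0 := by
        rw [← embedding_of_isReal_apply h]
        exact Complex.ofReal_im _
      simp [f, him]
    · exact floor_mul_div_mem_Icc (hR w) M ((Complex.abs_im_le_norm _).trans hw)
  have hinj : Set.InjOn f {x : 𝓞 k | ∀ w : InfinitePlace k, w (x : k) ≤ R w} := by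
    intro x _ y _ hxy
    have hlt : ∀ w : InfinitePlace k, w ((x - y : 𝓞 k) : k) < R w / T := by
      intro w
      have h := congrFun hxy w
      have h1 := abs_sub_lt_of_floor_eq (hR w) hMpos (congrArg Prod.fst h)
      have h2 := abs_sub_lt_of_floor_eq (hR w) hMpos (congrArg Prod.snd h)
      have h3 := Complex.norm_le_abs_re_add_abs_im (w.embedding ((x - y : 𝓞 k) : k))
      have hsub : ((x - y : 𝓞 k) : k) = (x : k) - (y : k) := map_sub _ x y
      rw [norm_embedding_eq, hsub, map_sub w.embedding, Complex.sub_re, Complex.sub_im] at h3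
      have h4 : R w / M ≤ R w / (2 * T) :=
        div_le_div_of_nonneg_left (hR w).le (by linarith) hMT
      have h5 : R w / T = R w / (2 * T) + R w / (2 * T) := by field_simp; norm_num
      rw [hsub]
      linarith
    have hprod : ∏ w : InfinitePlace k, w ((x - y : 𝓞 k) : k) ^ w.mult < 1 := by
      calc ∏ w : InfinitePlace k, w ((x - y : 𝓞 k) : k) ^ w.mult
          < ∏ w : InfinitePlace k, (R w / T) ^ w.mult := by
            by_cases h0 : x - y = 0
            · rw [h0]
              rw [Finset.prod_eq_zero (Finset.mem_univ (Classical.arbitrary (InfinitePlace k)))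
                (by simp [mult_ne_zero])]
              exact Finset.prod_pos fun w _ => pow_pos (div_pos (hR w) (by linarith)) _
            · refine Finset.prod_lt_prod_of_nonempty (fun w _ => ?_) (fun w _ => ?_)
                Finset.univ_nonempty
              · exact pow_pos (pos_iff.mpr (by simpa [sub_eq_zero] using h0)) _
              · exact pow_lt_pow_left₀ (hlt w) (apply_nonneg _ _) mult_ne_zero
        _ = N / T ^ d := by
            simp_rw [div_pow]
            rw [Finset.prod_div_distrib, Finset.prod_pow_eq_pow_sum, sum_mult_eq]
        _ ≤ 1 := by
            rw [hTd]
            exact div_le_one_of_le₀ (le_max_right _ _) (by positivity)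
    exact sub_eq_zero.mp (ringOfIntegers_eq_zero_of_prod_lt_one _ hprod)
  refine ⟨Set.Finite.of_injOn hmaps hinj D.finite_toSet, ?_⟩
  have hcard : D.card = (2 * M + 1) ^ d := by
    rw [Fintype.card_piFinset, hd, ← sum_mult_eq, ← Finset.prod_pow_eq_pow_sum]
    refine Finset.prod_congr rfl fun w _ => ?_
    have hI : (Finset.Icc (-(M : ℤ)) M).card = 2 * M + 1 := by
      rw [Int.card_Icc]
      omega
    rw [Finset.card_product, hI, mult]
    split_ifs
    · simp
    · rw [hI, sq]
  have hle := Set.ncard_le_ncard_of_injOn f hmaps hinj D.finite_toSet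
  rw [Set.ncard_coe_finset, hcard] at hle
  calc (_ : ℝ) ≤ ((2 * M + 1) ^ d : ℕ) := by exact_mod_cast hle
    _ = (2 * M + 1 : ℝ) ^ d := by push_cast; rfl
    _ ≤ (7 * T) ^ d := by gcongr; linarith
    _ = 7 ^ d * max 1 N := by rw [mul_pow, hTd]
    _ ≤ 7 ^ d * (1 + N) := by
        gcongr
        exact max_le (by linarith) (by linarith)

/-- A set of pairs is finite, with an explicit bound for its size, when the second projection
maps it to a finite set with uniformly bounded fibres. -/
theorem ncard_le_mul_of_fibers {X Y : Type*} (S : Set (X × Y)) (V : Set Y) (hV : V.Finite)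
    (b : ℝ) (hS : ∀ p ∈ S, p.2 ∈ V)
    (hb : ∀ y ∈ V, {x | (x, y) ∈ S}.Finite ∧ ({x | (x, y) ∈ S}.ncard : ℝ) ≤ b) :
    S.Finite ∧ (S.ncard : ℝ) ≤ V.ncard * b := by
  classical
  have hfin : S.Finite := by
    refine (hV.biUnion fun y hy => ((hb y hy).1.image fun x => (x, y))).subset ?_
    intro p hp
    exact Set.mem_biUnion (hS p hp) ⟨p.1, hp, rfl⟩
  refine ⟨hfin, ?_⟩
  rw [Set.ncard_eq_toFinset_card S hfin, Set.ncard_eq_toFinset_card V hV,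
    Finset.card_eq_sum_card_fiberwise (f := Prod.snd) (t := hV.toFinset)
      (fun p hp => by simpa using hS p (by simpa using hp))]
  push_cast
  rw [← nsmul_eq_mul]
  refine Finset.sum_le_card_nsmul _ _ _ fun y hy => ?_
  obtain ⟨h1, h2⟩ := hb y (by simpa using hy)
  refine le_trans ?_ h2
  rw [Set.ncard_eq_toFinset_card _ h1]
  refine Nat.cast_le.mpr (Finset.card_le_card_of_injOn Prod.fst ?_ ?_)
  · rintro ⟨x, z⟩ hp
    simp only [Finset.coe_filter, Set.Finite.mem_toFinset, Set.mem_ofPred_eq] at hp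
    obtain ⟨hp, rfl⟩ := hp
    simpa using hp
  · rintro ⟨x, z⟩ hp ⟨x', z'⟩ hp' hx
    simp only [Finset.coe_filter, Set.Finite.mem_toFinset, Set.mem_ofPred_eq] at hp hp'
    exact Prod.ext hx (hp.2.trans hp'.2.symm)

open NumberField.InfinitePlace in
/-- Upper bound for the number of integers of a number field lying in a translated box, where
the centre of the box may have coordinates outside of the number field. -/
theorem ncard_ringOfIntegers_translated_box_le {k : Type*} [Field k] [NumberField k]
    {K : Type*} [Field K] [Algebra k K] (σ : InfinitePlace k → (K →+* ℂ))
    (hσ : ∀ (w : InfinitePlace k) (x : k), ‖σ w (algebraMap k K x)‖ = w x)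
    (c : InfinitePlace k → K) (R : InfinitePlace k → ℝ) (hR : ∀ w, 0 < R w) (S : Set (𝓞 k))
    (hS : ∀ x ∈ S, ∀ w, ‖σ w (iotaK K x + c w)‖ ≤ R w) :
    S.Finite ∧ (S.ncard : ℝ) ≤
      7 ^ Module.finrank ℚ k * (1 + ∏ w : InfinitePlace k, (2 * R w) ^ w.mult) := by
  rcases S.eq_empty_or_nonempty with rfl | ⟨x₀, hx₀⟩
  · refine ⟨Set.finite_empty, ?_⟩
    have : 0 ≤ ∏ w : InfinitePlace k, (2 * R w) ^ w.mult :=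
      Finset.prod_nonneg fun w _ => pow_nonneg (by linarith [hR w]) _
    rw [Set.ncard_empty, Nat.cast_zero]
    positivity
  · obtain ⟨h1, h2⟩ := ncard_ringOfIntegers_box_le (fun w => 2 * R w)
      fun w => mul_pos two_pos (hR w)
    have hmaps : ∀ x ∈ S, x - x₀ ∈ {x : 𝓞 k | ∀ w : InfinitePlace k, w (x : k) ≤ 2 * R w} := by
      intro x hx w
      rw [← hσ w]
      have : algebraMap k K ((x - x₀ : 𝓞 k) : k) = (iotaK K x + c w) - (iotaK K x₀ + c w) := by
        simp [iotaK]
      rw [this, map_sub]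
      linarith [norm_sub_le (σ w (iotaK K x + c w)) (σ w (iotaK K x₀ + c w)), hS x hx w,
        hS x₀ hx₀ w]
    have hinj : Set.InjOn (fun x => x - x₀) S := sub_left_injective.injOn
    exact ⟨Set.Finite.of_injOn hmaps hinj h1,
      (Nat.cast_le.mpr (Set.ncard_le_ncard_of_injOn _ hmaps hinj h1)).trans h2⟩

/-- counting points in the sets `𝒜_ν(i,q)`:  in the setting of a
separable form `F(u,v) = ∏ᵢ(u + αᵢ v)` with distinct roots `αᵢ ∈ K`, embeddings `σ_w`
extending the infinite places of `k`, `θ = ε/n`, and a constant `C` bounding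
`∥u + αᵢ v∥_w < C·A_w` on `𝒜`, one has
`#(⋂_w 𝒜_w(i(w), q(w))) ≤ C'·∥A∥·(1 + ∏_w A_w^{1-θ·q(w)})` with `C' = C'(k, F, ε)`. -/
theorem count_Anu_intersection {k : Type*} [Field k] [NumberField k]
    {K : Type*} [Field K] [Algebra k K] [FiniteDimensional k K]
    {n : ℕ} (α : Fin n → K) (hα : Function.Injective α)
    (σ : InfinitePlace k → (K →+* ℂ))
    (hσ : ∀ (w : InfinitePlace k) (x : k), ‖σ w (algebraMap k K x)‖ = w x)
    (ε : ℝ) (hε : 0 < ε) (C : ℝ) (hC : 0 < C)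
    (hCA : ∀ A : InfinitePlace k → ℝ, (∀ w, 1 ≤ A w) →
      ∀ p ∈ setA α A, ∀ (i : Fin n) (w : InfinitePlace k),
        KNorm σ w (iotaK K p.1 + α i * iotaK K p.2) < C * A w) :
    ∃ C' : ℝ, 0 < C' ∧
      ∀ A : InfinitePlace k → ℝ, (∀ w, 1 ≤ A w) →
      ∀ iq : InfinitePlace k → Fin n × ℕ,
        (⋂ w : InfinitePlace k, setAnu α σ C (ε / n) A w (iq w).1 (iq w).2).Finite ∧
        ((⋂ w : InfinitePlace k, setAnu α σ C (ε / n) A w (iq w).1 (iq w).2).ncard : ℝ) ≤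
          C' * (∏ w : InfinitePlace k, A w) *
            (1 + ∏ w : InfinitePlace k, A w ^ ((1 : ℝ) - (ε / n) * ((iq w).2 : ℝ))) := by
  set d := Module.finrank ℚ k
  set s := Fintype.card (InfinitePlace k)
  have root : ∀ (w : InfinitePlace k) {b : ℝ}, 0 < b →
      (0 < b ^ ((w.mult : ℝ)⁻¹)) ∧ (b ^ ((w.mult : ℝ)⁻¹)) ^ w.mult = b := fun w b hb =>
    ⟨Real.rpow_pos_of_pos hb _, Real.rpow_inv_natCast_pow hb.le InfinitePlace.mult_ne_zero⟩
  refine ⟨(7 ^ d * (1 + 2 ^ s)) * (7 ^ d * (1 + 2 ^ d * C ^ s)), by positivity, ?_⟩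
  intro A hA iq
  have hApos : ∀ w, 0 < A w := fun w => one_pos.trans_le (hA w)
  set P : ℝ := ∏ w, A w
  set Q : ℝ := ∏ w : InfinitePlace k, A w ^ ((1 : ℝ) - (ε / n) * ((iq w).2 : ℝ))
  have hP1 : 1 ≤ P := Finset.one_le_prod fun w _ => hA w
  have hQpos : 0 < Q := Finset.prod_pos fun w _ => Real.rpow_pos_of_pos (hApos w) _
  have hBpos : ∀ w, 0 < C * A w ^ ((1 : ℝ) - (ε / n) * ((iq w).2 : ℝ)) := fun w =>
    mul_pos hC (Real.rpow_pos_of_pos (hApos w) _)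
  obtain ⟨hV, hVcard⟩ := ncard_ringOfIntegers_box_le
    (fun w : InfinitePlace k => (2 * A w) ^ ((w.mult : ℝ)⁻¹))
    fun w => (root w (mul_pos two_pos (hApos w))).1
  have hVprod : ∏ w : InfinitePlace k, ((2 * A w) ^ ((w.mult : ℝ)⁻¹)) ^ w.mult = 2 ^ s * P := by
    rw [Finset.prod_congr rfl fun w _ => (root w (mul_pos two_pos (hApos w))).2,
      Finset.prod_mul_distrib, Finset.prod_const, Finset.card_univ]
  have hFprod : ∏ w : InfinitePlace k,
      (2 * (C * A w ^ ((1 : ℝ) - (ε / n) * ((iq w).2 : ℝ))) ^ ((w.mult : ℝ)⁻¹)) ^ w.mult =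
        2 ^ d * C ^ s * Q := by
    simp_rw [mul_pow]
    rw [Finset.prod_mul_distrib, Finset.prod_pow_eq_pow_sum, InfinitePlace.sum_mult_eq,
      Finset.prod_congr rfl fun w _ => (root w (hBpos w)).2, Finset.prod_mul_distrib,
      Finset.prod_const, Finset.card_univ, mul_assoc]
  set S := ⋂ w : InfinitePlace k, setAnu α σ C (ε / n) A w (iq w).1 (iq w).2
  have hsnd : ∀ p ∈ S, p.2 ∈
      {x : 𝓞 k | ∀ w : InfinitePlace k, w (x : k) ≤ (2 * A w) ^ ((w.mult : ℝ)⁻¹)} := by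
    intro p hp w
    have h := ((Set.mem_iInter.mp hp w).1.1 w).2
    refine le_of_pow_le_pow_left₀ (InfinitePlace.mult_ne_zero (w := w))
      (root w (mul_pos two_pos (hApos w))).1.le ?_
    rw [(root w (mul_pos two_pos (hApos w))).2]
    exact (le_max_right _ _).trans h.le
  have hfib : ∀ v : 𝓞 k, {u | (u, v) ∈ S}.Finite ∧
      ({u | (u, v) ∈ S}.ncard : ℝ) ≤ 7 ^ d * (1 + 2 ^ d * C ^ s * Q) := by
    intro v
    rw [← hFprod]
    refine ncard_ringOfIntegers_translated_box_le σ hσ (fun w => α (iq w).1 * iotaK K v) _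
      (fun w => (root w (hBpos w)).1) _ ?_
    intro u hu w
    have h := (Set.mem_iInter.mp hu w).2.2
    refine le_of_pow_le_pow_left₀ (InfinitePlace.mult_ne_zero (w := w)) (root w (hBpos w)).1.le ?_
    rw [(root w (hBpos w)).2, mul_comm (ε / n)]
    exact h.le
  obtain ⟨hfin, hcard⟩ := ncard_le_mul_of_fibers S _ hV _ hsnd fun v _ => hfib v
  refine ⟨hfin, hcard.trans ?_⟩
  rw [hVprod] at hVcard
  have hV' : 7 ^ d * (1 + 2 ^ s * P) ≤ 7 ^ d * (1 + 2 ^ s) * P := by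
    rw [mul_assoc]
    gcongr
    linarith
  have hF' : 7 ^ d * (1 + 2 ^ d * C ^ s * Q) ≤ 7 ^ d * (1 + 2 ^ d * C ^ s) * (1 + Q) := by
    rw [mul_assoc (7 ^ d) (1 + 2 ^ d * C ^ s)]
    refine mul_le_mul_of_nonneg_left ?_ (by positivity)
    have : 0 < 2 ^ d * C ^ s := by positivity
    nlinarith
  calc _ ≤ 7 ^ d * (1 + 2 ^ s) * P * (7 ^ d * (1 + 2 ^ d * C ^ s) * (1 + Q)) :=
        mul_le_mul (hVcard.trans hV') hF' (by positivity) (by positivity)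
    _ = _ := by ring
end

section
/- In the setting: F(u,v) = (u + α_1 v)⋯(u + α_n v) is a separable binary form of degree n with α_1,…,α_n distinct algebraic numbers, K = k(α_1,…,α_n), each infinite place ν of k is extended to K, ε > 0, θ = ε/n, A ∈ (ℝ_{≥1})^{s_k} with components A_ν, 𝒜 is the set of (u,v) ∈ 𝔬² with A_ν ≤ max{∥u∥_ν, ∥v∥_ν} < 2A_ν for all ν | ∞ and F(u,v) ≠ 0, C > 0 is a constant such that ∥u + α_i v∥_ν < C·A_ν for all (u,v) ∈ 𝒜, all i, and all ν | ∞, and 𝒞_ν(i, q) = {(u,v) ∈ 𝒜 : ∥u + α_i v∥_ν < C·A_ν^{1−qθ}}. Then for any choice of pairs (i_ν, q_ν) ∈ {1,…,n} × ℤ_{≥0} for each ν | ∞ satisfying ∏_{ν|∞} A_ν^{1−θ·q_ν} < 1, one has #(∩_{ν|∞} 𝒞_ν(i_ν, q_ν)) ≤ C'·∥A∥, where ∥A∥ = ∏_{ν|∞} A_ν and C' depends only on k, F and ε. -/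
open NumberField

/-- A grid of mesh `s / m` on the disc of radius `s` in `ℂ`, or only on its real axis if `d = 1`. -/
lemma exists_grid_labelling {d m : ℕ} (hd : d = 1 ∨ d = 2) (hm : 0 < m) {s : ℝ} (hs : 0 < s) :
    ∃ (T : Finset (ℤ × ℤ)) (f : ℂ → ℤ × ℤ), (T.card : ℝ) ≤ 9 * (m : ℝ) ^ d ∧
      (∀ z, ‖z‖ ≤ s → f z ∈ T) ∧
      ∀ z z' : ℂ, (d = 1 → (z - z').im = 0) → f z = f z' →
        ‖z - z'‖ ^ d < 2 * (s ^ d / (m : ℝ) ^ d) := by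
  have hm' : (1 : ℝ) ≤ m := by exact_mod_cast hm
  have hms : 0 < (m : ℝ) / s := by positivity
  have hmem : ∀ t : ℝ, |t| ≤ s → ⌊t * (m / s)⌋ ∈ Finset.Icc (-(m : ℤ)) m := by
    intro t ht
    obtain ⟨h1, h2⟩ := abs_le.1 ht
    have hsm : s * (m / s) = m := by field_simp
    rw [Finset.mem_Icc, Int.le_floor]
    constructor
    · push_cast
      nlinarith
    · have : (⌊t * (m / s)⌋ : ℝ) ≤ (m : ℤ) := (Int.floor_le _).trans (by push_cast; nlinarith)
      exact_mod_cast this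
  have hclose : ∀ t t' : ℝ, ⌊t * (m / s)⌋ = ⌊t' * (m / s)⌋ → |t - t'| < s / m := by
    intro t t' h
    have h1 := Int.abs_sub_lt_one_of_floor_eq_floor h
    rw [← sub_mul, abs_mul, abs_of_pos hms, ← lt_div_iff₀ hms, one_div_div] at h1
    exact h1
  have hcard : ((Finset.Icc (-(m : ℤ)) m).card : ℝ) ≤ 3 * m := by
    have : (Finset.Icc (-(m : ℤ)) m).card = 2 * m + 1 := by
      rw [Int.card_Icc]; omega
    rw [this]
    push_cast
    linarith
  rcases hd with rfl | rfl
  · refine ⟨Finset.Icc (-(m : ℤ)) m ×ˢ {0}, fun z => (⌊z.re * (m / s)⌋, 0), ?_, ?_, ?_⟩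
    · rw [Finset.card_product, Finset.card_singleton, mul_one, pow_one]
      linarith
    · intro z hz
      simpa using hmem z.re ((Complex.abs_re_le_norm z).trans hz)
    · intro z z' him h
      have h1 := hclose _ _ (Prod.ext_iff.1 h).1
      rw [← Complex.sub_re, Complex.abs_re_eq_norm.2 (him rfl)] at h1
      have : 0 < s / m := by positivity
      simp only [pow_one]
      linarith
  · refine ⟨Finset.Icc (-(m : ℤ)) m ×ˢ Finset.Icc (-(m : ℤ)) m,
      fun z => (⌊z.re * (m / s)⌋, ⌊z.im * (m / s)⌋), ?_, ?_, ?_⟩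
    · rw [Finset.card_product]
      push_cast
      nlinarith
    · intro z hz
      exact Finset.mem_product.2 ⟨hmem _ ((Complex.abs_re_le_norm z).trans hz),
        hmem _ ((Complex.abs_im_le_norm z).trans hz)⟩
    · intro z z' _ h
      have h1 := hclose _ _ (Prod.ext_iff.1 h).1
      have h2 := hclose _ _ (Prod.ext_iff.1 h).2
      have h3 := sq_lt_sq' (by linarith [abs_nonneg (z.re - z'.re)]) h1
      have h4 := sq_lt_sq' (by linarith [abs_nonneg (z.im - z'.im)]) h2
      rw [sq_abs, div_pow] at h3 h4
      rw [Complex.sq_norm, Complex.normSq_apply, Complex.sub_re, Complex.sub_im]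
      linarith

/-- For `d = 1` or `d = 2`, a number `X` is at most some `d`-th power that is at most
`4 * max 1 X`. -/
lemma exists_pow_ge_and_le {d : ℕ} (hd : d = 1 ∨ d = 2) (X : ℝ) :
    ∃ m : ℕ, 0 < m ∧ X ≤ (m : ℝ) ^ d ∧ (m : ℝ) ^ d ≤ 4 * max 1 X := by
  have hd0 : d ≠ 0 := by omega
  obtain ⟨t, ht, htd⟩ : ∃ t : ℝ, 1 ≤ t ∧ t ^ d = max 1 X := by
    refine ⟨max 1 X ^ ((d : ℝ)⁻¹), Real.one_le_rpow (le_max_left _ _) (by positivity), ?_⟩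
    exact Real.rpow_inv_natCast_pow (zero_le_one.trans (le_max_left _ _)) hd0
  have h1 := Nat.le_ceil t
  have h2 := Nat.ceil_lt_add_one (zero_le_one.trans ht)
  refine ⟨⌈t⌉₊, Nat.ceil_pos.2 (by linarith), ?_, ?_⟩
  · calc X ≤ t ^ d := htd ▸ le_max_right _ _
      _ ≤ _ := by gcongr
  · calc (⌈t⌉₊ : ℝ) ^ d ≤ (2 * t) ^ d := by gcongr; linarith
      _ = 2 ^ d * max 1 X := by rw [mul_pow, htd]
      _ ≤ 4 * max 1 X := by
        gcongr
        rcases hd with rfl | rfl <;> norm_num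

lemma NumberField.InfinitePlace.mult_eq_one_or_two {k : Type*} [Field k] (w : InfinitePlace k) :
    w.mult = 1 ∨ w.mult = 2 := by
  unfold InfinitePlace.mult
  split_ifs <;> simp

/-- An embedding inducing a place of multiplicity one takes real values. -/
lemma im_eq_zero_of_mult_eq_one {k : Type*} [Field k] {w : InfinitePlace k} {τ : k →+* ℂ}
    (hτ : ∀ x, ‖τ x‖ = w x) (hw : w.mult = 1) (x : k) : (τ x).im = 0 := by
  have hmk : InfinitePlace.mk τ = w := by
    ext x
    exact hτ x
  have hreal : w.IsReal := by
    by_contra h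
    simp [InfinitePlace.mult, h] at hw
  rw [← hmk, InfinitePlace.isReal_mk_iff] at hreal
  exact Complex.conj_eq_iff_im.1 (RingHom.congr_fun hreal x)

/-- Algebraic integers in a translate of a box `∏ {‖z‖_w < r w}` are told apart by boundedly many
labels, read off at a single place `w₀`. -/
lemma exists_labelling_separating_integers {k : Type*} [Field k] [NumberField k]
    (τ : InfinitePlace k → (k →+* ℂ)) (hτ : ∀ w x, ‖τ w x‖ = w x) (w₀ : InfinitePlace k)
    {r : InfinitePlace k → ℝ} (hr : ∀ w, 0 < r w) :
    ∃ (T : Finset (ℤ × ℤ)) (f : ℂ → ℤ × ℤ), (T.card : ℝ) ≤ 36 * max 1 (∏ w, 4 * r w) ∧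
      (∀ z, ‖z‖ ^ w₀.mult < r w₀ → f z ∈ T) ∧
      ∀ (x : 𝓞 k) (z z' : InfinitePlace k → ℂ), (∀ w, ‖z w‖ ^ w.mult < r w) →
        (∀ w, ‖z' w‖ ^ w.mult < r w) → (∀ w, z w - z' w = τ w x) → f (z w₀) = f (z' w₀) →
        x = 0 := by
  classical
  obtain ⟨m, hm, hXm, hmX⟩ := exists_pow_ge_and_le w₀.mult_eq_one_or_two (∏ w, 4 * r w)
  set s := r w₀ ^ ((w₀.mult : ℝ)⁻¹)
  have hs : 0 < s := Real.rpow_pos_of_pos (hr w₀) _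
  have hsd : s ^ w₀.mult = r w₀ :=
    Real.rpow_inv_natCast_pow (hr w₀).le InfinitePlace.mult_ne_zero
  obtain ⟨T, f, hT, hfT, hf⟩ := exists_grid_labelling w₀.mult_eq_one_or_two hm hs
  refine ⟨T, f, by linarith, fun z hz => hfT z ?_, ?_⟩
  · rw [← hsd] at hz
    exact (lt_of_pow_lt_pow_left₀ _ hs.le hz).le
  intro x z z' hz hz' hzz h
  have hmd : (0 : ℝ) < (m : ℝ) ^ w₀.mult := by positivity
  have h0 : w₀ x ^ w₀.mult < 4 * r w₀ / (m : ℝ) ^ w₀.mult := by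
    have him : w₀.mult = 1 → (z w₀ - z' w₀).im = 0 := fun h1 => by
      rw [hzz]
      exact im_eq_zero_of_mult_eq_one (hτ w₀) h1 _
    have := hf (z w₀) (z' w₀) him h
    rw [hzz, hτ, hsd] at this
    have hpos : 0 < r w₀ / (m : ℝ) ^ w₀.mult := div_pos (hr w₀) hmd
    rw [mul_div_assoc]
    linarith
  have hle : ∀ w : InfinitePlace k, w x ^ w.mult ≤ 4 * r w := by
    intro w
    rw [← hτ w, ← hzz w]
    have h1 := hz w
    have h2 := hz' w
    have h3 := norm_sub_le (z w) (z' w)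
    rcases w.mult_eq_one_or_two with hw | hw <;> rw [hw] at h1 h2 ⊢
    · have := hr w
      simp only [pow_one] at *
      linarith
    · nlinarith [sq_nonneg (‖z w‖ - ‖z' w‖), norm_nonneg (z w - z' w)]
  have hprod : ∏ w : InfinitePlace k, w x ^ w.mult < 1 := by
    rw [← Finset.mul_prod_erase _ _ (Finset.mem_univ w₀)]
    have hP : 0 < ∏ w ∈ Finset.univ.erase w₀, 4 * r w :=
      Finset.prod_pos fun w _ => mul_pos four_pos (hr w)
    calc w₀ x ^ w₀.mult * ∏ w ∈ Finset.univ.erase w₀, w x ^ w.mult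
        ≤ w₀ x ^ w₀.mult * ∏ w ∈ Finset.univ.erase w₀, 4 * r w := by
          gcongr with w _
          · exact hle w
      _ < 4 * r w₀ / (m : ℝ) ^ w₀.mult * ∏ w ∈ Finset.univ.erase w₀, 4 * r w := by gcongr
      _ = (∏ w, 4 * r w) / (m : ℝ) ^ w₀.mult := by
          rw [← Finset.mul_prod_erase _ _ (Finset.mem_univ w₀)]
          ring
      _ ≤ 1 := (div_le_one hmd).2 hXm
  by_contra hx
  rw [InfinitePlace.prod_eq_abs_norm] at hprod
  have hint : Algebra.norm ℤ x ≠ 0 := Algebra.norm_ne_zero_iff.2 hx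
  rw [← Algebra.coe_norm_int] at hprod
  have : |Algebra.norm ℤ x| < 1 := by exact_mod_cast hprod
  exact hint (Int.abs_lt_one_iff.1 this)

/-- counting points in the sets `𝒞_ν(i,q)` with large `q`:  in the
setting of a separable form `F(u,v) = ∏ᵢ(u + αᵢ v)` with distinct roots `αᵢ ∈ K`,
embeddings `σ_w` extending the infinite places of `k`, `θ = ε/n`, and a constant `C`
bounding `∥u + αᵢ v∥_w < C·A_w` on `𝒜`, for any choice of pairs `(i_w, q_w)` with
`∏_w A_w^{1-θ·q_w} < 1` one has `#(⋂_w 𝒞_w(i_w, q_w)) ≤ C'·∥A∥`, `C' = C'(k, F, ε)`. -/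
theorem count_Cnu_intersection {k : Type*} [Field k] [NumberField k]
    {K : Type*} [Field K] [Algebra k K] [FiniteDimensional k K]
    {n : ℕ} (α : Fin n → K) (hα : Function.Injective α)
    (σ : InfinitePlace k → (K →+* ℂ))
    (hσ : ∀ (w : InfinitePlace k) (x : k), ‖σ w (algebraMap k K x)‖ = w x)
    (ε : ℝ) (hε : 0 < ε) (C : ℝ) (hC : 0 < C)
    (hCA : ∀ A : InfinitePlace k → ℝ, (∀ w, 1 ≤ A w) →
      ∀ p ∈ setA α A, ∀ (i : Fin n) (w : InfinitePlace k),
        KNorm σ w (iotaK K p.1 + α i * iotaK K p.2) < C * A w) :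
    ∃ C' : ℝ, 0 < C' ∧
      ∀ A : InfinitePlace k → ℝ, (∀ w, 1 ≤ A w) →
      ∀ iq : InfinitePlace k → Fin n × ℕ,
        (∏ w : InfinitePlace k, A w ^ ((1 : ℝ) - (ε / n) * ((iq w).2 : ℝ))) < 1 →
        (⋂ w : InfinitePlace k, setCnu α σ C (ε / n) A w (iq w).1 (iq w).2).Finite ∧
        ((⋂ w : InfinitePlace k, setCnu α σ C (ε / n) A w (iq w).1 (iq w).2).ncard : ℝ) ≤
          C' * ∏ w : InfinitePlace k, A w := by
  classical
  obtain ⟨w₀⟩ := (inferInstance : Nonempty (InfinitePlace k))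
  set N := Fintype.card (InfinitePlace k)
  refine ⟨36 * 8 ^ N * (36 * max 1 ((4 * C) ^ N)), by positivity, fun A hA iq hq => ?_⟩
  have hA0 : ∀ w, 0 < A w := fun w => zero_lt_one.trans_le (hA w)
  let τ : InfinitePlace k → (k →+* ℂ) := fun w => (σ w).comp (algebraMap k K)
  have hτ : ∀ w x, ‖τ w x‖ = w x := hσ
  let ρ : InfinitePlace k → ℝ := fun w => C * A w ^ ((1 : ℝ) - ((iq w).2 : ℝ) * (ε / n))
  have hρ : ∀ w, 0 < ρ w := fun w => mul_pos hC (Real.rpow_pos_of_pos (hA0 w) _)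
  obtain ⟨T₁, f₁, hT₁, hf₁T, hf₁⟩ := exists_labelling_separating_integers τ hτ w₀
    (r := fun w => 2 * A w) (fun w => mul_pos two_pos (hA0 w))
  obtain ⟨T₂, f₂, hT₂, hf₂T, hf₂⟩ := exists_labelling_separating_integers τ hτ w₀ hρ
  set S := ⋂ w : InfinitePlace k, setCnu α σ C (ε / n) A w (iq w).1 (iq w).2
  let y : 𝓞 k × 𝓞 k → InfinitePlace k → ℂ :=
    fun p w => σ w (iotaK K p.1 + α (iq w).1 * iotaK K p.2)
  have hv : ∀ p ∈ S, ∀ w, ‖τ w p.2‖ ^ w.mult < 2 * A w := by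
    intro p hp w
    have h := ((Set.mem_iInter.1 hp w).1.1 w).2
    rw [hτ]
    exact (le_max_right _ _).trans_lt h
  have hu : ∀ p ∈ S, ∀ w, ‖y p w‖ ^ w.mult < ρ w := fun p hp w => (Set.mem_iInter.1 hp w).2
  let g : 𝓞 k × 𝓞 k → (ℤ × ℤ) × (ℤ × ℤ) := fun p => (f₁ (τ w₀ p.2), f₂ (y p w₀))
  have hg : Set.MapsTo g S (T₁ ×ˢ T₂ : Finset _) := fun p hp =>
    Finset.mem_coe.2 (Finset.mem_product.2 ⟨hf₁T _ (hv p hp w₀), hf₂T _ (hu p hp w₀)⟩)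
  have hinj : Set.InjOn g S := by
    rintro p hp p' hp' h
    obtain ⟨h1, h2⟩ := Prod.ext_iff.1 h
    have e2 : p.2 = p'.2 := sub_eq_zero.1 <|
      hf₁ (p.2 - p'.2) (fun w => τ w p.2) (fun w => τ w p'.2) (hv p hp) (hv p' hp')
        (fun w => by simp) h1
    have e1 : p.1 = p'.1 := sub_eq_zero.1 <|
      hf₂ (p.1 - p'.1) (y p) (y p') (hu p hp) (hu p' hp')
        (fun w => by simp [y, τ, iotaK, e2]) h2
    exact Prod.ext e1 e2
  refine ⟨Set.Finite.of_injOn hg hinj (Finset.finite_toSet _), ?_⟩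
  have hcard : S.ncard ≤ T₁.card * T₂.card := by
    have := Set.ncard_le_ncard_of_injOn g hg hinj (Finset.finite_toSet _)
    rwa [Set.ncard_coe_finset, Finset.card_product] at this
  have hPA : 1 ≤ ∏ w, A w := Finset.one_le_prod fun w _ => hA w
  have hv_prod : ∏ w, 4 * (2 * A w) = 8 ^ N * ∏ w, A w := by
    simp only [← mul_assoc]
    rw [Finset.prod_mul_distrib, Finset.prod_const, Finset.card_univ]
    norm_num [N]
  have hu_prod : ∏ w, 4 * ρ w ≤ (4 * C) ^ N := by
    simp only [ρ, ← mul_assoc]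
    rw [Finset.prod_mul_distrib, Finset.prod_const, Finset.card_univ]
    refine mul_le_of_le_one_right (by positivity) ?_
    simpa only [mul_comm] using hq.le
  rw [hv_prod, max_eq_right (one_le_mul_of_one_le_of_one_le (one_le_pow₀ (by norm_num)) hPA)] at hT₁
  calc (S.ncard : ℝ) ≤ T₁.card * T₂.card := by exact_mod_cast hcard
    _ ≤ (36 * (8 ^ N * ∏ w, A w)) * (36 * max 1 ((4 * C) ^ N)) := by
      refine mul_le_mul hT₁ (hT₂.trans ?_) (by positivity) (by positivity)
      gcongr
    _ = _ := by ring
end
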